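/- arXiv:1411.4998 — 2 statements merged into one kernel-verified Lean document; each statement's English description precedes it below -/
import Mathlib

section
/- Let p be an odd prime, ζ a fixed primitive p-th root of unity in an algebraic closure Q̄ of ℚ, K = ℚ(ζ), and L ⊆ Q̄ the splitting field over K of f_p(x) = 1 − (1 − x^p)^p. If Vandiver's conjecture fails for p, i.e., p divides the class number h⁺ of K⁺ = ℚ(ζ + ζ⁻¹), then the rank of the elementary abelian p-group Gal(L/K) is strictly less than (p+1)/2; equivalently, [L : K] < p^{(p+1)/2}. -/
section Part1

open Filter Topology NumberField

section EulerIdeal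
variable {R : Type*} [CommRing R] [IsDedekindDomain R]

/-- nonzero ideals all of whose prime divisors lie in `S` -/
def suppIdeals (S : Finset (Ideal R)) : Set (Ideal R) :=
  {I | I ≠ ⊥ ∧ ∀ P, Prime P → P ∣ I → P ∈ S}

lemma hasSum_suppIdeals (g : Ideal R →* ℝ) (hg0 : ∀ I, 0 ≤ g I) (S : Finset (Ideal R))
    (hS : ∀ P ∈ S, Prime P ∧ g P < 1) :
    HasSum (fun I : suppIdeals S ↦ g I) (∏ P ∈ S, (1 - g P)⁻¹) := by
  classical
  induction S using Finset.induction_on with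
  | empty =>
    have h1 : (1 : Ideal R) ∈ suppIdeals (∅ : Finset (Ideal R)) := by
      refine ⟨by simp [Ideal.one_eq_top], fun P hP h ↦ ?_⟩
      exact absurd (isUnit_of_dvd_one h) hP.not_isUnit
    have hu : ∀ I : suppIdeals (∅ : Finset (Ideal R)), I = ⟨1, h1⟩ := by
      rintro ⟨I, hI, h⟩
      apply Subtype.ext
      by_contra hne
      have : ¬ IsUnit I := by rwa [Ideal.isUnit_iff, ← Ideal.one_eq_top]
      obtain ⟨P, hP, hPI⟩ := WfDvdMonoid.exists_irreducible_factor this hI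
      simpa using h P hP.prime hPI
    have := hasSum_single (f := fun I : suppIdeals (∅ : Finset (Ideal R)) ↦ g I) ⟨1, h1⟩
      (fun b hb ↦ absurd (hu b) hb)
    simpa only [map_one, Finset.prod_empty] using this
  | insert P S hPS ih =>
    have ih := ih (fun Q hQ ↦ hS Q (Finset.mem_insert_of_mem hQ))
    obtain ⟨hP, hP1⟩ := hS P (Finset.mem_insert_self _ _)
    have hgeo := hasSum_geometric_of_lt_one (hg0 P) hP1
    have hprod := hgeo.mul ih (hgeo.summable.mul_of_nonneg ih.summable
      (fun n ↦ pow_nonneg (hg0 P) n) (fun I ↦ hg0 I))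
    rw [Finset.prod_insert hPS]
    have hnd : ∀ J ∈ suppIdeals S, ¬ P ∣ J := fun J hJ h ↦ hPS (hJ.2 P hP h)
    let e : ℕ × suppIdeals S → suppIdeals (insert P S) := fun x ↦
      ⟨P ^ x.1 * x.2.1, by
        refine ⟨mul_ne_zero (pow_ne_zero _ hP.ne_zero) x.2.2.1, fun Q hQ h ↦ ?_⟩
        rcases hQ.dvd_or_dvd h with h | h
        · have := hQ.dvd_of_dvd_pow h
          have := (hQ.associated_of_dvd hP this).eq_of_normalized (by simp) (by simp)
          simp [this]
        · exact Finset.mem_insert_of_mem (x.2.2.2 Q hQ h)⟩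
    have he : Function.Bijective e := by
      constructor
      · rintro ⟨k, J, hJ⟩ ⟨k', J', hJ'⟩ h
        replace h : P ^ k * J = P ^ k' * J' := congrArg Subtype.val h
        have hk : k = k' := by
          have key : ∀ (a b : ℕ) (I I' : Ideal R), ¬ P ∣ I' → P ^ a * I = P ^ b * I' → a ≤ b := by
            intro a b I I' hI' h
            by_contra hlt
            push Not at hlt
            obtain ⟨c, rfl⟩ := Nat.exists_eq_add_of_lt hlt
            rw [add_assoc, pow_add, mul_assoc] at h
            have := mul_left_cancel₀ (pow_ne_zero b hP.ne_zero) h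
            exact hI' ⟨P ^ c * I, by rw [← this]; ring⟩
          exact le_antisymm (key _ _ _ _ (hnd _ hJ') h) (key _ _ _ _ (hnd _ hJ) h.symm)
        subst hk
        have := mul_left_cancel₀ (pow_ne_zero k hP.ne_zero) h
        subst this
        rfl
      · rintro ⟨I, hI, h⟩
        obtain ⟨k, J, hJ, hIJ⟩ := (FiniteMultiplicity.of_not_isUnit hP.not_isUnit hI).exists_eq_pow_mul_and_not_dvd |> fun ⟨c, h1, h2⟩ ↦ (⟨_, c, h2, h1⟩ : ∃ k J, ¬ P ∣ J ∧ I = P ^ k * J)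
        refine ⟨⟨k, J, ?_, ?_⟩, ?_⟩
        · rintro rfl
          simp at hJ
        · intro Q hQ hQJ
          have := h Q hQ (hIJ ▸ dvd_mul_of_dvd_right hQJ _)
          rcases Finset.mem_insert.1 this with rfl | h'
          · exact absurd hQJ hJ
          · exact h'
        · exact Subtype.ext hIJ.symm
    rw [← (Equiv.ofBijective e he).hasSum_iff]
    have hfun : (fun I : suppIdeals (insert P S) ↦ g I) ∘ (Equiv.ofBijective e he) =
        fun x : ℕ × suppIdeals S ↦ g P ^ x.1 * g x.2 := by
      funext x
      change g (P ^ x.1 * x.2.1) = _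
      rw [map_mul, map_pow]
    rw [hfun]
    exact hprod

lemma tendsto_suppIdeals (g : Ideal R →* ℝ) (hg0 : ∀ I, 0 ≤ g I) (hbot : g ⊥ = 0)
    (hsum : Summable g) (S : ℕ → Finset (Ideal R))
    (hS : ∀ N, ∀ P ∈ S N, Prime P ∧ g P < 1) (hev : ∀ P, Prime P → ∀ᶠ N in atTop, P ∈ S N) :
    Tendsto (fun N ↦ ∏ P ∈ S N, (1 - g P)⁻¹) atTop (𝓝 (∑' I, g I)) := by
  classical
  have h1 : ∀ N, ∏ P ∈ S N, (1 - g P)⁻¹ = ∑' I, (suppIdeals (S N)).indicator g I := by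
    intro N
    exact (hasSum_subtype_iff_indicator.1 (hasSum_suppIdeals g hg0 (S N) (hS N))).tsum_eq.symm
  simp_rw [h1]
  refine tendsto_tsum_of_dominated_convergence hsum (fun I ↦ ?_) (Eventually.of_forall fun N I ↦ ?_)
  · by_cases hI : I = ⊥
    · subst hI
      have : ∀ N, (suppIdeals (S N)).indicator g ⊥ = 0 := fun N ↦ by
        rw [Set.indicator_apply, hbot, ite_self]
      simp_rw [this, hbot]
      exact tendsto_const_nhds
    · apply tendsto_const_nhds.congr'
      have hfin : {P : Ideal R | Prime P ∧ P ∣ I}.Finite := by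
        refine (Ideal.finite_factors (I := I) hI).image (fun v ↦ v.asIdeal) |>.subset ?_
        rintro P ⟨hP, hPI⟩
        exact ⟨⟨P, Ideal.isPrime_of_prime hP, hP.ne_zero⟩, hPI, rfl⟩
      have := (hfin.eventually_all (l := atTop) (p := fun P N ↦ P ∈ S N)).2 (fun P hP ↦ hev P hP.1)
      filter_upwards [this] with N hN
      rw [Set.indicator_of_mem]
      exact ⟨hI, fun P hP hPI ↦ hN P ⟨hP, hPI⟩⟩
  · rw [Real.norm_eq_abs, Set.indicator_apply]
    split_ifs
    · rw [abs_of_nonneg (hg0 I)]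
    · simpa using hg0 I

end EulerIdeal

section Dedekind
variable (K : Type*) [Field K] [NumberField K]

/-- the multiplicative function `I ↦ (N I)^{-s}` -/
noncomputable def normPow (s : ℝ) : Ideal (𝓞 K) →* ℝ where
  toFun I := (Ideal.absNorm I : ℝ) ^ (-s)
  map_one' := by simp
  map_mul' I J := by
    rw [map_mul, Nat.cast_mul, Real.mul_rpow (by positivity) (by positivity)]

lemma hasSum_normPow {s : ℝ} (hs : 1 < s) 
    (hsum : LSeriesSummable (fun n ↦ Nat.card {I : Ideal (𝓞 K) // Ideal.absNorm I = n}) s) :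
    Summable (normPow K s) ∧ ((∑' I, normPow K s I : ℝ) : ℂ) = dedekindZeta K s := by
  set a : ℕ → ℕ := fun n ↦ Nat.card {I : Ideal (𝓞 K) // Ideal.absNorm I = n} with ha
  have hs0 : -s ≠ 0 := by linarith
  have hterm : ∀ n, LSeries.term (fun n ↦ (a n : ℂ)) s n = (((a n : ℝ) * (n : ℝ) ^ (-s) : ℝ) : ℂ) := by
    intro n
    rcases eq_or_ne n 0 with rfl | hn
    · simp [Real.zero_rpow hs0]
    · rw [LSeries.term_of_ne_zero hn]
      push_cast
      rw [Complex.ofReal_cpow (by positivity)]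
      push_cast
      rw [Complex.cpow_neg, div_eq_mul_inv]
  have hfib : ∀ n : ℕ, HasSum (fun I : {I : Ideal (𝓞 K) // Ideal.absNorm I = n} ↦ normPow K s I)
      ((a n : ℝ) * (n : ℝ) ^ (-s)) := by
    intro n
    have hfin : Finite {I : Ideal (𝓞 K) // Ideal.absNorm I = n} := 
      Ideal.finite_setOfPred_absNorm_eq n
    have := Fintype.ofFinite {I : Ideal (𝓞 K) // Ideal.absNorm I = n}
    convert hasSum_fintype (fun I : {I : Ideal (𝓞 K) // Ideal.absNorm I = n} ↦ normPow K s I)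
    have : ∀ I : {I : Ideal (𝓞 K) // Ideal.absNorm I = n}, normPow K s I = (n : ℝ) ^ (-s) := by
      rintro ⟨I, rfl⟩
      rfl
    simp [this, ha, Nat.card_eq_fintype_card]
  have hsumR : Summable (fun n ↦ (a n : ℝ) * (n : ℝ) ^ (-s)) := by
    have h0 : LSeriesSummable (fun n ↦ (a n : ℂ)) s := hsum
    rw [LSeriesSummable, funext hterm] at h0
    exact Complex.summable_ofReal.1 h0
  have hsig : Summable (fun x : Σ n, {I : Ideal (𝓞 K) // Ideal.absNorm I = n} ↦ normPow K s x.2) := by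
    rw [summable_sigma_of_nonneg]
    · refine ⟨fun n ↦ (hfib n).summable, ?_⟩
      simp_rw [(hfib _).tsum_eq]
      exact hsumR
    · intro x
      exact Real.rpow_nonneg (by positivity) _
  let e := Equiv.sigmaFiberEquiv (fun I : Ideal (𝓞 K) ↦ Ideal.absNorm I)
  have h1 : Summable (normPow K s) := by
    rw [← e.summable_iff]
    exact hsig
  refine ⟨h1, ?_⟩
  have h2 : ∑' I, normPow K s I = ∑' n, (a n : ℝ) * (n : ℝ) ^ (-s) := by
    have h21 : ∑' x : (Σ n, {I : Ideal (𝓞 K) // Ideal.absNorm I = n}), normPow K s x.2 =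
        ∑' I, normPow K s I := e.tsum_eq (normPow K s)
    have h22 := hsig.tsum_sigma' (fun n ↦ (hfib n).summable)
    rw [← h21, h22]
    exact tsum_congr fun n ↦ (hfib n).tsum_eq
  have h3 : dedekindZeta K s = LSeries (fun n ↦ (a n : ℂ)) s := rfl
  rw [h2, Complex.ofReal_tsum, h3, LSeries]
  simp_rw [hterm]

lemma dedekind_euler_product :
    ∀ᶠ s : ℝ in 𝓝[>] 1, Tendsto (fun N : ℕ ↦ ∏ ℓ ∈ N.primesBelow,
      ∏ P ∈ IsDedekindDomain.primesOverFinset (Ideal.span {(ℓ : ℤ)}) (𝓞 K),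
        (1 - (Ideal.absNorm P : ℂ) ^ (-(s : ℂ)))⁻¹) atTop (𝓝 (dedekindZeta K s)) := by
  have hres := tendsto_sub_one_mul_dedekindZeta_nhdsGT K
  have hne := hres.eventually_ne (Complex.ofReal_ne_zero.2 (dedekindZeta_residue_ne_zero K))
  filter_upwards [hne, self_mem_nhdsWithin] with s hs hs1
  have hs1 : 1 < s := hs1
  have hsum : LSeriesSummable (fun n ↦ Nat.card {I : Ideal (𝓞 K) // Ideal.absNorm I = n}) s := by
    by_contra h
    apply hs
    unfold dedekindZeta LSeries
    rw [tsum_eq_zero_of_not_summable h, mul_zero]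
  obtain ⟨hS, hval⟩ := hasSum_normPow K hs1 hsum
  rw [← hval]
  classical
  let S : ℕ → Finset (Ideal (𝓞 K)) := fun N ↦ N.primesBelow.biUnion
    fun ℓ ↦ IsDedekindDomain.primesOverFinset (Ideal.span {(ℓ : ℤ)}) (𝓞 K)
  have hmem : ∀ ℓ : ℕ, ℓ.Prime → ∀ P, P ∈ IsDedekindDomain.primesOverFinset (Ideal.span {(ℓ : ℤ)}) (𝓞 K) ↔
      P.IsPrime ∧ P.LiesOver (Ideal.span {(ℓ : ℤ)}) := by
    intro ℓ hℓ P
    have hb : Ideal.span {(ℓ : ℤ)} ≠ ⊥ := by simpa using hℓ.ne_zero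
    have : (Ideal.span {(ℓ : ℤ)}).IsMaximal := 
      Ideal.IsPrime.isMaximal ((Ideal.span_singleton_prime (by exact_mod_cast hℓ.ne_zero)).2 (Nat.prime_iff_prime_int.1 hℓ)) hb
    rw [← Finset.mem_coe, IsDedekindDomain.coe_primesOverFinset hb]
    rfl
  have hpr : ∀ ℓ : ℕ, ℓ.Prime → ∀ P, P ∈ IsDedekindDomain.primesOverFinset (Ideal.span {(ℓ : ℤ)}) (𝓞 K) → Prime P := by
    intro ℓ hℓ P hP
    rw [hmem ℓ hℓ] at hP
    obtain ⟨h1, h2⟩ := hP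
    refine Ideal.prime_of_isPrime ?_ h1
    rintro rfl
    have := h2.over
    rw [Ideal.under, Ideal.comap_bot_of_injective _ (FaithfulSMul.algebraMap_injective ℤ (𝓞 K))] at this
    simp [hℓ.ne_zero] at this
  have h := tendsto_suppIdeals (normPow K s) (fun I ↦ Real.rpow_nonneg (by positivity) _)
    (by simp [normPow, Real.zero_rpow (by linarith : -s ≠ 0)]) hS S ?_ ?_
  · have h' := (Complex.continuous_ofReal.tendsto _).comp h
    refine h'.congr fun N ↦ ?_
    simp only [Function.comp_apply, S]
    rw [Finset.prod_biUnion]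
    · push_cast
      refine Finset.prod_congr rfl fun ℓ _ ↦ Finset.prod_congr rfl fun P _ ↦ ?_
      simp only [normPow, MonoidHom.coe_mk, OneHom.coe_mk]
      rw [Complex.ofReal_cpow (by positivity)]
      push_cast
      rfl
    · intro ℓ hℓ ℓ' hℓ' hne
      rw [Function.onFun, Finset.disjoint_left]
      intro P hP hP'
      have hℓ := Nat.prime_of_mem_primesBelow hℓ
      have hℓ' := Nat.prime_of_mem_primesBelow hℓ'
      rw [hmem _ hℓ] at hP
      rw [hmem _ hℓ'] at hP'
      have := hP.2.over.trans hP'.2.over.symm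
      rw [Ideal.span_singleton_eq_span_singleton, Int.associated_iff_natAbs] at this
      exact hne (by simpa using this)
  · intro N P hP
    simp only [S, Finset.mem_biUnion] at hP
    obtain ⟨ℓ, hℓ, hP⟩ := hP
    have hP := hpr ℓ (Nat.prime_of_mem_primesBelow hℓ) P hP
    refine ⟨hP, ?_⟩
    apply Real.rpow_lt_one_of_one_lt_of_neg _ (by linarith)
    have h1 : Ideal.absNorm P ≠ 0 := by
      rw [Ne, Ideal.absNorm_eq_zero_iff]; exact hP.ne_zero
    have h2 : Ideal.absNorm P ≠ 1 := by
      rw [Ne, Ideal.absNorm_eq_one_iff]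
      intro h; exact hP.not_isUnit (by rw [Ideal.isUnit_iff, h])
    exact_mod_cast (by omega : 1 < Ideal.absNorm P)
  · intro P hP
    have := Ideal.isPrime_of_prime hP
    obtain ⟨ℓ, hℓ, hPℓ⟩ : ∃ ℓ : ℕ, ℓ.Prime ∧ P.LiesOver (Ideal.span {(ℓ : ℤ)}) := by
      have : NeZero P := ⟨hP.ne_zero⟩
      exact ⟨_, Nat.absNorm_under_prime P, inferInstance⟩
    filter_upwards [eventually_gt_atTop ℓ] with N hN
    simp only [S, Finset.mem_biUnion]
    exact ⟨ℓ, Nat.mem_primesBelow.2 ⟨hN, hℓ⟩, (hmem ℓ hℓ P).2 ⟨this, hPℓ⟩⟩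

end Dedekind

end Part1

section Part2

section Chars
variable {A : Type*} [CommGroup A] [Fintype A] [Fintype (A →* ℂˣ)]

lemma card_dual : Fintype.card (A →* ℂˣ) = Fintype.card A := by
  rw [← Nat.card_eq_fintype_card, ← Nat.card_eq_fintype_card]
  exact CommGroup.card_monoidHom_of_hasEnoughRootsOfUnity A ℂ

lemma prod_one_sub_char (a : A) (f g : ℕ) (hf : orderOf a = f) (hfg : f * g = Fintype.card A)
    (X : ℂ) : ∏ ψ : A →* ℂˣ, (1 - (ψ a : ℂ) * X) = (1 - X ^ f) ^ g := by
  classical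
  have hfpos : 0 < f := hf ▸ orderOf_pos a
  have : NeZero f := ⟨hfpos.ne'⟩
  let ev : (A →* ℂˣ) →* ℂˣ := ⟨⟨fun ψ ↦ ψ a, rfl⟩, fun _ _ ↦ rfl⟩
  have hle : ev.range ≤ rootsOfUnity f ℂ := by
    rintro _ ⟨ψ, rfl⟩
    rw [mem_rootsOfUnity]
    change ψ a ^ f = 1
    rw [← map_pow, ← hf, pow_orderOf_eq_one, map_one]
  have hcard : Nat.card (rootsOfUnity f ℂ) = f := by
    exact Complex.card_rootsOfUnity f
  have hdvd : f ∣ Nat.card ev.range := by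
    rw [← hf]
    apply orderOf_dvd_of_pow_eq_one
    by_contra h
    obtain ⟨ψ, hψ⟩ := CommGroup.exists_apply_ne_one_of_hasEnoughRootsOfUnity A ℂ h
    apply hψ
    rw [map_pow]
    have := pow_card_eq_one' (x := (⟨ψ a, ψ, rfl⟩ : ev.range))
    exact congrArg Subtype.val this
  have hrange : ev.range = rootsOfUnity f ℂ := by
    apply Subgroup.eq_of_le_of_card_ge hle
    rw [hcard]
    exact Nat.le_of_dvd Nat.card_pos hdvd
  set T : Finset ℂˣ := Finset.univ.image ev with hT
  have hTmem : ∀ z, z ∈ T ↔ z ^ f = 1 := by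
    intro z
    rw [← mem_rootsOfUnity, ← hrange, hT]
    simp
  have hfib : ∀ z ∈ T, (Finset.univ.filter (fun ψ ↦ ev ψ = z)).card = (Finset.univ.filter (fun ψ ↦ ev ψ = 1)).card := by
    intro z hz
    apply MonoidHom.card_fiber_eq_of_mem_range ev
    · simpa [hT] using hz
    · exact ⟨1, map_one _⟩
  have hTimg : T.image (fun z : ℂˣ ↦ (z : ℂ)) = Polynomial.nthRootsFinset f (1 : ℂ) := by
    ext z
    rw [Finset.mem_image, Polynomial.mem_nthRootsFinset hfpos]
    constructor
    · rintro ⟨z, hz, rfl⟩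
      rw [← Units.val_pow_eq_pow_val, (hTmem z).1 hz, Units.val_one]
    · intro hz
      refine ⟨Units.mk0 z ?_, ?_, rfl⟩
      · rintro rfl; simp [hfpos.ne'] at hz
      · rw [hTmem]; ext; simpa using hz
  have hTcard : T.card = f := by
    have h1 : Nat.card ev.range = T.card := by
      rw [show T.card = Nat.card T by simp]
      refine Nat.card_congr (Equiv.subtypeEquivRight fun z ↦ ?_)
      simp [hT]
    rw [← h1, hrange, hcard]
  have hc : (Finset.univ.filter (fun ψ ↦ ev ψ = 1)).card = g := by
    have := Finset.card_eq_sum_card_image ev (Finset.univ : Finset (A →* ℂˣ))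
    rw [← hT, Finset.sum_congr rfl hfib, Finset.sum_const, smul_eq_mul, hTcard, Finset.card_univ, card_dual, ← hfg] at this
    exact (Nat.eq_of_mul_eq_mul_left hfpos this).symm
  have hX := (Complex.isPrimitiveRoot_exp f hfpos.ne').pow_sub_pow_eq_prod_sub_mul 1 X hfpos
  rw [one_pow, ← hTimg, Finset.prod_image (fun _ _ _ _ h ↦ Units.ext h)] at hX
  rw [hX, ← Finset.prod_pow, ← Finset.prod_fiberwise_of_maps_to (g := ev) (t := T) (by simp [hT])]
  refine Finset.prod_congr rfl fun z hz ↦ ?_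
  rw [← hc, ← hfib z hz]
  rw [Finset.prod_congr rfl (g := fun _ ↦ 1 - (z : ℂ) * X), Finset.prod_const]
  intro ψ hψ
  rw [← (Finset.mem_filter.1 hψ).2]
  rfl

lemma sum_char_eq_zero {ψ : A →* ℂˣ} (h : ψ ≠ 1) : ∑ a, (ψ a : ℂ) = 0 := by
  obtain ⟨b, hb⟩ : ∃ b, ψ b ≠ 1 := by
    by_contra hh
    push Not at hh
    exact h (MonoidHom.ext hh)
  have h1 : (ψ b : ℂ) * ∑ a, (ψ a : ℂ) = ∑ a, (ψ a : ℂ) := by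
    rw [Finset.mul_sum]
    refine Fintype.sum_equiv (Equiv.mulLeft b) _ _ fun a ↦ ?_
    simp
  have h2 : ((ψ b : ℂ) - 1) * ∑ a, (ψ a : ℂ) = 0 := by rw [sub_mul, h1]; ring
  rcases mul_eq_zero.1 h2 with h3 | h3
  · exact absurd (Units.ext (sub_eq_zero.1 h3)) hb
  · exact h3

/-- Dedekind's group determinant up to absolute value. -/
lemma abs_group_det [DecidableEq A] (f : A → ℂ) :
    ‖(Matrix.of fun a b : A ↦ f (a * b)).det‖ = ∏ ψ : A →* ℂˣ, ‖∑ a, (ψ a : ℂ) * f a‖ := by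
  classical
  obtain ⟨e⟩ : Nonempty (A ≃ (A →* ℂˣ)) := ⟨Fintype.equivOfCardEq card_dual.symm⟩
  let X : Matrix A A ℂ := Matrix.of fun b c ↦ (e c b : ℂ)
  let Y : Matrix A A ℂ := Matrix.of fun b c ↦ ((e c)⁻¹ b : ℂ)
  have hXY : X.transpose * Y = (Fintype.card A : ℂ) • (1 : Matrix A A ℂ) := by
    ext i j
    simp only [X, Y, Matrix.mul_apply, Matrix.transpose_apply, Matrix.of_apply, Matrix.smul_apply, smul_eq_mul]
    rcases eq_or_ne i j with rfl | hij
    · simp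
    · have : e i * (e j)⁻¹ ≠ 1 := by
        exact fun h ↦ hij (e.injective (mul_inv_eq_one.1 h))
      have := sum_char_eq_zero this
      simpa [hij] using this
  have hdet : X.det * Y.det ≠ 0 := by
    rw [← Matrix.det_transpose X, ← Matrix.det_mul, hXY, Matrix.det_smul]
    simp
  have hTX : (Matrix.of fun a b : A ↦ f (a * b)) * X = Y * Matrix.diagonal (fun c ↦ ∑ a, (e c a : ℂ) * f a) := by
    ext a c
    rw [Matrix.mul_diagonal]
    simp only [X, Y, Matrix.mul_apply, Matrix.of_apply, Finset.mul_sum]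
    refine Fintype.sum_equiv (Equiv.mulLeft a) _ _ fun b ↦ ?_
    have h0 : (e c a : ℂ) ≠ 0 := Units.ne_zero _
    simp only [Equiv.coe_mulLeft, map_mul, MonoidHom.inv_apply, Units.val_mul, Units.val_inv_eq_inv_val]
    field_simp
  have hconj : ‖Y.det‖ = ‖X.det‖ := by
    have : Y = X.map (starRingEnd ℂ) := by
      ext a c
      simp only [X, Y, Matrix.of_apply, Matrix.map_apply]
      rw [MonoidHom.inv_apply, Units.val_inv_eq_inv_val, Complex.inv_eq_conj]
      have h1 : (e c a : ℂ) ^ Fintype.card A = 1 := by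
        rw [← Units.val_pow_eq_pow_val, ← map_pow, pow_card_eq_one, map_one, Units.val_one]
      exact Complex.norm_eq_one_of_pow_eq_one h1 Fintype.card_ne_zero
    rw [this, show X.map (starRingEnd ℂ) = (starRingEnd ℂ).mapMatrix X from rfl, ← RingHom.map_det, RCLike.norm_conj]
  have h := congrArg (fun M ↦ ‖Matrix.det M‖) hTX
  simp only [Matrix.det_mul, norm_mul, Matrix.det_diagonal] at h
  rw [hconj, mul_comm] at h
  have hX0 : ‖X.det‖ ≠ 0 := norm_ne_zero_iff.2 (left_ne_zero_of_mul hdet)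
  have h' := mul_left_cancel₀ hX0 h
  rw [h', norm_prod]
  exact Fintype.prod_equiv e _ _ (fun _ ↦ rfl)

lemma abs_reduced_group_det [DecidableEq A] [DecidableEq (A →* ℂˣ)] (f : A → ℝ) (hf : ∑ a, f a ≠ 0) :
    |(Matrix.of fun a b : A ↦ if a = 1 then 1 else f (a * b) - f b).det| =
      Fintype.card A * ∏ ψ ∈ (Finset.univ : Finset (A →* ℂˣ)).erase 1, ‖∑ a, (ψ a : ℂ) * (f a : ℂ)‖ := by
  set n := (Fintype.card A : ℝ) with hn
  set S := ∑ a, f a with hS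
  let T : Matrix A A ℝ := Matrix.of fun a b : A ↦ f (a * b)
  let M : Matrix A A ℝ := Matrix.of fun a b : A ↦ if a = 1 then 1 else f (a * b) - f b
  -- `Q` : row 1 is `n * f b`
  have h1 : n * T.det = S * M.det := by
    have e1 : S * M.det = (M.updateRow 1 (S • M 1)).det := by
      rw [Matrix.det_updateRow_smul, Matrix.updateRow_eq_self]
    let T' : Matrix A A ℝ := Matrix.of fun a b : A ↦ if a = 1 then f b else f (a * b) - f b
    have e2 : T.det = T'.det := by
      refine (Matrix.det_eq_of_forall_row_eq_smul_add_const (fun a ↦ if a = 1 then 0 else (-1 : ℝ)) 1 (by simp) ?_).symm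
      intro i j
      simp only [T, T', Matrix.of_apply]
      split_ifs with h
      · simp [h]
      · simp; ring
    have e3 : n * T'.det = (T'.updateRow 1 (∑ k, (if k = 1 then n else 1) • T' k)).det := by
      rw [Matrix.det_updateRow_sum]; simp
    rw [e1, e2, e3]
    congr 1
    ext i b
    rcases eq_or_ne i 1 with rfl | hi
    · simp only [Matrix.updateRow_self, Finset.sum_apply, Pi.smul_apply, smul_eq_mul]
      have : ∀ k, (if k = 1 then n else 1) * T' k b = (f (k * b) - f b) + if k = 1 then n * f b else 0 := by
        intro k
        simp only [T', Matrix.of_apply]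
        split_ifs with h <;> simp [h]
      simp_rw [this]
      rw [Finset.sum_add_distrib, Finset.sum_sub_distrib, Fintype.sum_equiv (Equiv.mulRight b) (fun k ↦ f (k * b)) f (fun _ ↦ rfl)]
      simp [M, hn, hS]
    · simp [Matrix.updateRow_ne hi, T', M, hi]
  have h2 := abs_group_det (fun a ↦ (f a : ℂ))
  have h3 : ‖(Matrix.of fun a b : A ↦ ((f (a * b) : ℝ) : ℂ)).det‖ = |T.det| := by
    rw [show (Matrix.of fun a b : A ↦ ((f (a * b) : ℝ) : ℂ)) = Complex.ofRealHom.mapMatrix T from rfl, ← RingHom.map_det]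
    simp
  rw [h3, ← Finset.mul_prod_erase _ _ (Finset.mem_univ (1 : A →* ℂˣ))] at h2
  have h4 : ‖∑ a, (((1 : A →* ℂˣ) a : ℂˣ) : ℂ) * (f a : ℂ)‖ = |S| := by
    simp only [MonoidHom.one_apply, Units.val_one, one_mul]
    rw [← Complex.ofReal_sum, Complex.norm_real, Real.norm_eq_abs]
  rw [h4] at h2
  have h5 := congrArg abs h1
  rw [abs_mul, abs_mul, h2, abs_of_nonneg (by positivity : 0 ≤ n)] at h5
  have hS0 : |S| ≠ 0 := abs_ne_zero.2 hf
  apply mul_left_cancel₀ hS0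
  rw [← h5]
  ring

end Chars

end Part2

section Part3

open Filter Topology Complex
section abelpart

noncomputable def wgt (s : ℝ) (i : ℕ) : ℝ := ((i:ℝ)+1)^(-s)
noncomputable def geoS (z : ℂ) (i : ℕ) : ℂ := ∑ k ∈ Finset.range i, z^(k+1)
noncomputable def DD (z : ℂ) (s : ℝ) : ℂ := ∑' i : ℕ, (((wgt s i - wgt s (i+1) : ℝ)):ℂ) * geoS z (i+1)

lemma geoS_bound {z : ℂ} (hz : ‖z‖ = 1) (hz1 : z ≠ 1) (i : ℕ) : ‖geoS z i‖ ≤ 2 / ‖z - 1‖ := by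
  have h : z - 1 ≠ 0 := sub_ne_zero.mpr hz1
  have : geoS z i = z * ((z^i - 1)/(z-1)) := by
    rw [← geom_sum_eq hz1, Finset.mul_sum]
    exact Finset.sum_congr rfl fun k _ ↦ by ring
  rw [this, norm_mul, hz, one_mul, norm_div]
  gcongr
  calc _ ≤ ‖z^i‖ + ‖(1:ℂ)‖ := norm_sub_le _ _
    _ = 2 := by rw [norm_pow, hz]; norm_num

lemma wgt_bound {s : ℝ} (h1 : 1 ≤ s) (h2 : s ≤ 2) (i : ℕ) :
    |wgt s i - wgt s (i+1)| ≤ 2 / ((i:ℝ)+1)^2 := by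
  unfold wgt
  push_cast
  set x : ℝ := (i:ℝ)+1 with hx
  have hx1 : 1 ≤ x := by rw [hx]; linarith [Nat.cast_nonneg (α := ℝ) i]
  have hx0 : 0 < x := by linarith
  have hy0 : 0 < x + 1 := by linarith
  have e : (x+1)^(-s) = x^(-s) * (x/(x+1))^s := by
    rw [Real.div_rpow hx0.le hy0.le, Real.rpow_neg hx0.le, Real.rpow_neg hy0.le]
    have := (Real.rpow_pos_of_pos hx0 s).ne'
    field_simp
  have hq1 : x/(x+1) ≤ 1 := by rw [div_le_one hy0]; linarith
  have hq0 : 0 < x/(x+1) := by positivity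
  have a1 : (x/(x+1))^s ≤ 1 := Real.rpow_le_one hq0.le hq1 (by linarith)
  have a2 : (x/(x+1))^2 ≤ (x/(x+1))^s := by
    rw [← Real.rpow_natCast]
    exact Real.rpow_le_rpow_of_exponent_ge hq0 hq1 (by push_cast; linarith)
  have a3 : x^(-s) ≤ x⁻¹ := by
    rw [← Real.rpow_neg_one]
    exact Real.rpow_le_rpow_of_exponent_le hx1 (by linarith)
  have a4 : 0 < x^(-s) := Real.rpow_pos_of_pos hx0 _
  rw [e, show x^(-s) - x^(-s) * (x/(x+1))^s = x^(-s) * (1 - (x/(x+1))^s) by ring, abs_of_nonneg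
    (mul_nonneg a4.le (by linarith))]
  calc _ ≤ x⁻¹ * (1 - (x/(x+1))^2) := by
        apply mul_le_mul a3 (by linarith) (by linarith) (by positivity)
    _ ≤ 2 / x^2 := by
        have : x⁻¹ * (1 - (x/(x+1))^2) = (2*x+1)/(x*(x+1)^2) := by field_simp; ring
        rw [this, div_le_div_iff₀ (by positivity) (by positivity)]
        nlinarith [mul_pos hx0 hx0, mul_pos (mul_pos hx0 hx0) hx0]

lemma summable_bound (C : ℝ) : Summable (fun i : ℕ ↦ 2 / ((i:ℝ)+1)^2 * C) := by
  apply Summable.mul_right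
  have := (summable_nat_add_iff 1).mpr (Real.summable_one_div_nat_pow.mpr (by norm_num : 1 < 2))
  refine (this.mul_left 2).congr fun i ↦ ?_
  push_cast; ring

lemma term_bound {z : ℂ} (hz : ‖z‖ = 1) (hz1 : z ≠ 1) {s : ℝ} (h1 : 1 ≤ s) (h2 : s ≤ 2) (i : ℕ) :
    ‖(((wgt s i - wgt s (i+1) : ℝ)):ℂ) * geoS z (i+1)‖ ≤ 2 / ((i:ℝ)+1)^2 * (2 / ‖z - 1‖) := by
  rw [norm_mul, Complex.norm_real, Real.norm_eq_abs]
  exact mul_le_mul (wgt_bound h1 h2 i) (geoS_bound hz hz1 _) (norm_nonneg _) (by positivity)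

lemma DD_tendsto {z : ℂ} (hz : ‖z‖ = 1) (hz1 : z ≠ 1) :
    Tendsto (DD z) (𝓝[>] 1) (𝓝 (DD z 1)) := by
  refine tendsto_tsum_of_dominated_convergence (summable_bound (2 / ‖z - 1‖)) ?_ ?_
  · intro i
    refine Tendsto.mul_const _ ?_
    refine (Complex.continuous_ofReal.tendsto _).comp ?_
    refine Tendsto.mono_left ?_ nhdsWithin_le_nhds
    have hc : Continuous fun s : ℝ ↦ wgt s i - wgt s (i+1) := by
      unfold wgt
      have : ∀ j : ℕ, Continuous fun s : ℝ ↦ ((j:ℝ)+1)^(-s) := fun j ↦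
        Real.continuous_const_rpow (by positivity) |>.comp continuous_neg
      exact (this i).sub (this (i+1))
    exact hc.tendsto 1
  · have : ∀ᶠ s : ℝ in 𝓝[>] 1, s ∈ Set.Ioc (1:ℝ) 2 :=
      Ioc_mem_nhdsGT (by norm_num)
    filter_upwards [this] with s hs i
    exact term_bound hz hz1 hs.1.le hs.2 i

lemma wgt_tendsto {s : ℝ} (h1 : 1 ≤ s) : Tendsto (wgt s) atTop (𝓝 0) := by
  have := (tendsto_rpow_neg_atTop (y := s) (by linarith)).comp
    ((tendsto_natCast_atTop_atTop (R := ℝ)).atTop_add (tendsto_const_nhds (x := (1:ℝ))))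
  exact this

lemma partial_tendsto {z : ℂ} (hz : ‖z‖ = 1) (hz1 : z ≠ 1) {s : ℝ} (h1 : 1 ≤ s) (h2 : s ≤ 2) :
    Tendsto (fun N : ℕ ↦ ∑ i ∈ Finset.range N, (wgt s i : ℂ) * z^(i+1)) atTop (𝓝 (DD z s)) := by
  rw [← tendsto_add_atTop_iff_nat 1]
  have e : ∀ N : ℕ, ∑ i ∈ Finset.range (N+1), (wgt s i : ℂ) * z^(i+1) =
      (wgt s N : ℂ) * geoS z (N+1) +
      ∑ i ∈ Finset.range N, (((wgt s i - wgt s (i+1) : ℝ)):ℂ) * geoS z (i+1) := by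
    intro N
    have := Finset.sum_range_by_parts (fun i ↦ (wgt s i : ℂ)) (fun i ↦ z^(i+1)) (N+1)
    simp only [smul_eq_mul, Nat.add_sub_cancel] at this
    rw [this, sub_eq_add_neg, ← Finset.sum_neg_distrib]
    simp only [geoS]
    congr 1
    refine Finset.sum_congr rfl fun i _ ↦ ?_
    push_cast; ring
  simp_rw [e]
  rw [← zero_add (DD z s)]
  refine Tendsto.add ?_ ?_
  · have hw : Tendsto (fun N ↦ wgt s N * (2/‖z-1‖)) atTop (𝓝 0) := by
      simpa using (wgt_tendsto h1).mul_const (2/‖z-1‖)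
    refine squeeze_zero_norm (fun N ↦ ?_) hw
    rw [norm_mul, Complex.norm_real, Real.norm_eq_abs, abs_of_nonneg (by unfold wgt; positivity)]
    exact mul_le_mul_of_nonneg_left (geoS_bound hz hz1 _) (by unfold wgt; positivity)
  · refine HasSum.tendsto_sum_nat (Summable.hasSum ?_)
    exact Summable.of_norm_bounded (summable_bound (2/‖z-1‖)) (term_bound hz hz1 h1 h2)

lemma DD_one {z : ℂ} (hz : ‖z‖ = 1) (hz1 : z ≠ 1) : DD z 1 = - Complex.log (1 - z) := by
  have h := partial_tendsto hz hz1 le_rfl one_le_two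
  have e1 : ∀ N, ∑ i ∈ Finset.range N, (wgt 1 i : ℂ) * z^(i+1) =
     ∑ i ∈ Finset.range (N+1), z^i/(i:ℂ) := by
    intro N
    rw [Finset.sum_range_succ']
    simp only [Nat.cast_zero, div_zero, add_zero]
    refine Finset.sum_congr rfl fun i _ ↦ ?_
    unfold wgt
    rw [Real.rpow_neg_one]; push_cast; rw [div_eq_inv_mul]
  simp_rw [e1] at h
  rw [tendsto_add_atTop_iff_nat (f := fun N ↦ ∑ i ∈ Finset.range N, z^i/(i:ℂ)) 1] at h
  have A := Complex.tendsto_tsum_powerSeries_nhdsWithin_lt h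
  have hre : z.re < 1 := by
    have hn : z.re^2 + z.im^2 = 1 := by
      have := Complex.sq_norm z
      rw [hz, Complex.normSq_apply] at this; nlinarith
    by_contra hc
    push Not at hc
    have him : z.im = 0 := by nlinarith [sq_nonneg z.im]
    have : z.re = 1 := by nlinarith
    exact hz1 (Complex.ext this him)
  have B : Tendsto (fun x : ℝ ↦ - Complex.log (1 - z * x)) (𝓝[<] 1) (𝓝 (- Complex.log (1 - z))) := by
    refine Tendsto.mono_left ?_ nhdsWithin_le_nhds
    have : ContinuousAt (fun x : ℝ ↦ - Complex.log (1 - z * x)) 1 := by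
      refine (ContinuousAt.clog (by fun_prop) ?_).neg
      left
      simp
      exact hre
    simpa [ContinuousAt] using this
  refine tendsto_nhds_unique ?_ B
  have A' := (Filter.tendsto_map'_iff.mp A)
  refine A'.congr' ?_
  have : ∀ᶠ x : ℝ in 𝓝[<] 1, x ∈ Set.Ico (0:ℝ) 1 := Ico_mem_nhdsLT (by norm_num)
  filter_upwards [this] with x hx
  have hzx : ‖z * x‖ < 1 := by
    rw [norm_mul, hz, one_mul, Complex.norm_real, Real.norm_eq_abs, abs_of_nonneg hx.1]; exact hx.2
  rw [← (Complex.hasSum_taylorSeries_neg_log hzx).tsum_eq]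
  refine tsum_congr fun n ↦ ?_
  simp only [mul_pow]
  ring

lemma expZeta_one (a : ℝ) (ha : (a : UnitAddCircle) ≠ 0) :
    HurwitzZeta.expZeta (a : UnitAddCircle) 1 = - Complex.log (1 - Complex.exp (2*Real.pi*I*a)) := by
  set z := Complex.exp (2*Real.pi*I*a) with hzdef
  have hz : ‖z‖ = 1 := by
    rw [hzdef, show 2*Real.pi*I*a = ((2*Real.pi*a : ℝ):ℂ) * I by push_cast; ring, Complex.norm_exp_ofReal_mul_I]
  have hz1 : z ≠ 1 := by
    intro h
    rw [hzdef, Complex.exp_eq_one_iff] at h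
    obtain ⟨n, hn⟩ := h
    apply ha
    have : (a:ℂ) = n := by
      have h2 : (2*Real.pi*I : ℂ) ≠ 0 := Complex.two_pi_I_ne_zero
      apply mul_left_cancel₀ h2; rw [hn]; ring
    have : a = n := by exact_mod_cast this
    rw [this]
    rw [AddCircle.coe_eq_zero_iff]
    exact ⟨n, by simp⟩
  rw [← DD_one hz hz1]
  have c1 : Tendsto (fun s : ℝ ↦ HurwitzZeta.expZeta (a : UnitAddCircle) (s:ℂ)) (𝓝[>] 1)
      (𝓝 (HurwitzZeta.expZeta (a : UnitAddCircle) 1)) := by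
    refine Tendsto.mono_left ?_ nhdsWithin_le_nhds
    have : ContinuousAt (fun s : ℝ ↦ HurwitzZeta.expZeta (a : UnitAddCircle) (s:ℂ)) 1 := by
      exact ((HurwitzZeta.differentiable_expZeta_of_ne_zero ha).continuous.comp
        Complex.continuous_ofReal).continuousAt
    simpa [ContinuousAt] using this
  refine tendsto_nhds_unique c1 ((DD_tendsto hz hz1).congr' ?_)
  have : ∀ᶠ s : ℝ in 𝓝[>] 1, s ∈ Set.Ioc (1:ℝ) 2 := Ioc_mem_nhdsGT (by norm_num)
  filter_upwards [this] with s hs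
  have h := (HurwitzZeta.hasSum_expZeta_of_one_lt_re a (s := (s:ℂ)) (by simpa using hs.1)).tendsto_sum_nat
  rw [← tendsto_add_atTop_iff_nat 1] at h
  refine tendsto_nhds_unique (partial_tendsto hz hz1 hs.1.le hs.2) (h.congr fun N ↦ ?_)
  rw [Finset.sum_range_succ']
  have : (s:ℂ) ≠ 0 := by
    have : s ≠ 0 := by linarith [hs.1]
    exact_mod_cast this
  simp only [Nat.cast_zero, Complex.zero_cpow this, div_zero, add_zero]
  refine Finset.sum_congr rfl fun i _ ↦ ?_
  unfold wgt
  rw [hzdef, ← Complex.exp_nat_mul, Complex.ofReal_cpow (by positivity), div_eq_mul_inv, ← Complex.cpow_neg, mul_comm]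
  push_cast
  congr 2
  ring

end abelpart

end Part3

section Part3b

open Filter Topology Complex
section Lone
variable {p : ℕ} [hpf : Fact p.Prime]

lemma stdAddChar_norm (j : ZMod p) : ‖ZMod.stdAddChar j‖ = 1 := by
  exact Circle.norm_coe (ZMod.toCircle j)

lemma stdAddChar_eq_exp (j : ZMod p) : ZMod.stdAddChar j = Complex.exp (2*Real.pi*I*(((j.val:ℝ)/p : ℝ):ℂ)) := by
  rw [ZMod.stdAddChar_apply, ZMod.toCircle_apply]
  push_cast
  congr 1
  ring

lemma expZeta_stdAddChar (j : ZMod p) (hj : j ≠ 0) :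
    HurwitzZeta.expZeta (ZMod.toAddCircle j) 1 = - Complex.log (1 - ZMod.stdAddChar j) := by
  rw [stdAddChar_eq_exp, ZMod.toAddCircle_apply]
  apply expZeta_one
  rw [← ZMod.toAddCircle_apply]
  rwa [Ne, ZMod.toAddCircle_eq_zero]

lemma log_add_log_neg (j : ZMod p) (hj : j ≠ 0) :
    Complex.log (1 - ZMod.stdAddChar j) + Complex.log (1 - ZMod.stdAddChar (-j)) =
     2 * (Real.log ‖1 - ZMod.stdAddChar j‖ : ℝ) := by
  have hz := stdAddChar_norm j
  have hz1 : ZMod.stdAddChar j ≠ 1 := by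
    intro h
    exact hj (ZMod.injective_stdAddChar (by rw [h, AddChar.map_zero_eq_one]))
  rw [AddChar.map_neg_eq_conj]
  set z := ZMod.stdAddChar j
  have hre : z.re < 1 := by
    have hn : z.re^2 + z.im^2 = 1 := by
      have := Complex.sq_norm z
      rw [hz, Complex.normSq_apply] at this; nlinarith
    by_contra hc
    push Not at hc
    have him : z.im = 0 := by nlinarith [sq_nonneg z.im]
    have : z.re = 1 := by nlinarith
    exact hz1 (Complex.ext this him)
  have : 1 - (starRingEnd ℂ) z = (starRingEnd ℂ) (1 - z) := by simp
  rw [this, Complex.log_conj, Complex.add_conj, Complex.log_re]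
  · push_cast; ring
  · have : (1 - z) ∈ slitPlane := by left; simpa using hre
    exact Complex.slitPlane_arg_ne_pi this

lemma norm_gaussSum_sq {χ : DirichletCharacter ℂ p} (hχ : χ ≠ 1) :
    ‖gaussSum χ ZMod.stdAddChar‖ = √p := by
  have h := gaussSum_mul_gaussSum_eq_card hχ (ZMod.isPrimitive_stdAddChar p)
  rw [← star_gaussSum_eq, ZMod.card] at h
  rw [eq_comm, Real.sqrt_eq_iff_mul_self_eq (by positivity) (by positivity)]
  have := congrArg norm h
  rw [norm_mul, norm_star] at this
  simpa using this.symm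

lemma prim_of_ne_one {χ : DirichletCharacter ℂ p} (hχ : χ ≠ 1) : χ.IsPrimitive := by
  rw [DirichletCharacter.isPrimitive_def]
  rcases (Nat.dvd_prime hpf.out).mp (χ.conductor_dvd_level) with h | h
  · exact absurd (DirichletCharacter.eq_one_iff_conductor_eq_one.mpr h) hχ
  · exact h

lemma sum_L_one {χ : DirichletCharacter ℂ p} (hχ : χ ≠ 1) (hev : χ.Even) :
    √p * ‖χ.LFunction 1‖ = ‖∑ j, χ j * (Real.log ‖1 - ZMod.stdAddChar j‖ : ℂ)‖ := by
  have hinv : χ⁻¹ ≠ 1 := by simpa using hχ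
  have h0 : χ⁻¹ 0 = 0 := MulChar.map_zero _
  have hevi : ∀ j, χ⁻¹ (-j) = χ⁻¹ j := by
    intro j
    rw [← MulChar.star_apply', ← MulChar.star_apply', hev.eval_neg]
  have H := ZMod.LFunction_dft (⇑χ⁻¹) (s := 1) (Or.inl h0)
  have e1 : ZMod.LFunction (ZMod.dft (⇑χ⁻¹)) 1 = gaussSum χ⁻¹ ZMod.stdAddChar * χ.LFunction 1 := by
    have : (ZMod.dft (⇑χ⁻¹)) = fun k ↦ gaussSum χ⁻¹ ZMod.stdAddChar * χ k := by
      ext k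
      rw [(prim_of_ne_one hinv).fourierTransform_eq_inv_mul_gaussSum, inv_inv, hev.eval_neg, mul_comm]
    rw [this, DirichletCharacter.LFunction, ZMod.LFunction, ZMod.LFunction, Finset.mul_sum, Finset.mul_sum,
      Finset.mul_sum]
    exact Finset.sum_congr rfl fun j _ ↦ by ring
  rw [e1] at H
  have e2 : ∑ j, χ⁻¹ j * HurwitzZeta.expZeta (ZMod.toAddCircle (-j)) 1 =
      - ∑ j, χ⁻¹ j * (Real.log ‖1 - ZMod.stdAddChar j‖ : ℂ) := by
    have s1 : ∑ j, χ⁻¹ j * HurwitzZeta.expZeta (ZMod.toAddCircle (-j)) 1 =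
       ∑ j, χ⁻¹ j * HurwitzZeta.expZeta (ZMod.toAddCircle j) 1 := by
      exact Fintype.sum_equiv (Equiv.neg (ZMod p)) _ _ (by simp [hevi])
    have s2 : ∑ j, χ⁻¹ j * HurwitzZeta.expZeta (ZMod.toAddCircle (-j)) 1 +
       ∑ j, χ⁻¹ j * HurwitzZeta.expZeta (ZMod.toAddCircle j) 1 =
        2 * (- ∑ j, χ⁻¹ j * (Real.log ‖1 - ZMod.stdAddChar j‖ : ℂ)) := by
      rw [← Finset.sum_add_distrib, ← Finset.sum_neg_distrib, Finset.mul_sum]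
      refine Finset.sum_congr rfl fun j _ ↦ ?_
      by_cases hj : j = 0
      · subst hj; rw [h0]; ring
      · rw [expZeta_stdAddChar _ hj, expZeta_stdAddChar _ (neg_ne_zero.mpr hj)]
        linear_combination (- χ⁻¹ j) * log_add_log_neg j hj
    rw [← s1, ← two_mul] at s2
    exact mul_left_cancel₀ two_ne_zero s2
  rw [e2] at H
  have := congrArg norm H
  rw [norm_mul, norm_gaussSum_sq hinv, norm_neg] at this
  rw [this, ← norm_star]
  congr 1
  rw [star_sum]
  refine Finset.sum_congr rfl fun j _ ↦ ?_
  rw [star_mul', MulChar.star_apply', inv_inv]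
  congr 1
  exact Complex.conj_ofReal _

end Lone

end Part3b

section Part4

open Filter Topology Complex NumberField

def RG (p : ℕ) : Type := (ZMod p)ˣ ⧸ (Subgroup.zpowers (-1 : (ZMod p)ˣ))
noncomputable instance (p : ℕ) : CommGroup (RG p) := inferInstanceAs (CommGroup (_ ⧸ (Subgroup.zpowers (-1 : (ZMod p)ˣ))))
instance (p : ℕ) [Fact p.Prime] : Finite (RG p) := inferInstanceAs (Finite (_ ⧸ (Subgroup.zpowers (-1 : (ZMod p)ˣ))))
noncomputable instance (p : ℕ) [Fact p.Prime] : Fintype (RG p) := Fintype.ofFinite _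
noncomputable instance (p : ℕ) : DecidableEq (RG p) := Classical.decEq _

noncomputable def rgmk (p : ℕ) : (ZMod p)ˣ →* RG p := QuotientGroup.mk' _

lemma rgmk_surj (p : ℕ) : Function.Surjective (rgmk p) := QuotientGroup.mk'_surjective _

lemma rgmk_eq (p : ℕ) (a b : (ZMod p)ˣ) : rgmk p a = rgmk p b ↔ a = b ∨ a = -b := by
  have : rgmk p a = rgmk p b ↔ a⁻¹ * b ∈ Subgroup.zpowers (-1 : (ZMod p)ˣ) := QuotientGroup.eq
  rw [this, Subgroup.mem_zpowers_iff]
  constructor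
  · rintro ⟨k, hk⟩
    rcases Int.even_or_odd k with h | h
    · left
      rw [h.neg_one_zpow] at hk
      exact (inv_mul_eq_one.mp hk.symm)
    · right
      rw [h.neg_one_zpow] at hk
      have : b = - a := by rw [← mul_inv_cancel_left a b, ← hk]; simp
      rw [this, neg_neg]
  · rintro (rfl | rfl)
    · exact ⟨0, by simp⟩
    · exact ⟨1, by simp⟩

lemma card_RG (p : ℕ) [Fact p.Prime] (h2 : p ≠ 2) : Fintype.card (RG p) * 2 = p - 1 := by
  have h := Subgroup.card_eq_card_quotient_mul_card_subgroup (Subgroup.zpowers (-1 : (ZMod p)ˣ))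
  rw [Nat.card_zpowers, Nat.card_eq_fintype_card, ZMod.card_units] at h
  have ho : orderOf (-1 : (ZMod p)ˣ) = 2 := by
    rw [← orderOf_units, Units.val_neg, Units.val_one, orderOf_neg_one, ZMod.ringChar_zmod_n, if_neg h2]
  rw [ho] at h
  rw [h, ← Nat.card_eq_fintype_card]; rfl

/-- abstract data of the maximal real cyclotomic field -/
structure RC (p : ℕ) [Fact p.Prime] (F : Type*) [Field F] [NumberField F] where
  b : ZMod p → 𝓞 F
  φ : RG p ≃ (F →+* ℂ)
  hφ : ∀ (a : (ZMod p)ˣ) (j : ZMod p),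
    φ (rgmk p a) (b j) = ZMod.stdAddChar ((a:ZMod p) * j) + ZMod.stdAddChar (-((a:ZMod p) * j))

namespace RC
variable {p : ℕ} [hpf : Fact p.Prime] {F : Type*} [Field F] [NumberField F] (D : RC p F)

lemma finrank_eq (D : RC p F) : Module.finrank ℚ F = Fintype.card (RG p) := by
  rw [← NumberField.Embeddings.card F ℂ]
  exact Fintype.card_congr D.φ.symm

/-- embedding on integers -/
noncomputable def emb (a : (ZMod p)ˣ) : 𝓞 F →+* ℂ := (D.φ (rgmk p a)).comp (algebraMap (𝓞 F) F)

lemma emb_inj (a : (ZMod p)ˣ) : Function.Injective (D.emb a) :=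
  (D.φ (rgmk p a)).injective.comp RingOfIntegers.coe_injective

lemma emb_b (a : (ZMod p)ˣ) (j : ZMod p) :
    D.emb a (D.b j) = ZMod.stdAddChar ((a:ZMod p) * j) + ZMod.stdAddChar (-((a:ZMod p) * j)) := D.hφ a j

lemma b_zero : D.b 0 = 2 := by
  apply D.emb_inj 1
  rw [emb_b, map_ofNat]; simp; norm_num

lemma b_neg (j : ZMod p) : D.b (-j) = D.b j := by
  apply D.emb_inj 1
  rw [emb_b, emb_b]; simp [add_comm]

lemma b_mul (j k : ZMod p) : D.b j * D.b k = D.b (j + k) + D.b (j - k) := by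
  apply D.emb_inj 1
  simp only [map_mul, map_add, emb_b, Units.val_one, one_mul]
  simp only [sub_eq_add_neg, neg_add, neg_neg, AddChar.map_add_eq_mul]
  ring

/-- Chebyshev-like elements -/
noncomputable def c (t : ZMod p) : ℕ → 𝓞 F
  | 0 => 0
  | 1 => 1
  | (k+2) => D.b t * c t (k+1) - c t k

/-- sine -/
noncomputable def sn (p : ℕ) [Fact p.Prime] (j : ZMod p) : ℂ := ZMod.stdAddChar j - ZMod.stdAddChar (-j)

lemma stdmul (j : ZMod p) : ZMod.stdAddChar j * ZMod.stdAddChar (-j) = 1 := by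
  rw [← AddChar.map_add_eq_mul]; simp

lemma emb_c (a : (ZMod p)ˣ) (t : ZMod p) (k : ℕ) :
    D.emb a (D.c t k) * sn p (a * t) = sn p (a * (k * t)) := by
  induction k using Nat.twoStepInduction with
  | zero => simp [c, sn]
  | one => simp [c]
  | more k h1 h2 =>
    rw [c, map_sub, map_mul, sub_mul, h1, mul_assoc, h2, emb_b]
    have e2 : (a:ZMod p) * (((k+2 : ℕ) : ZMod p) * t) = a * (k * t) + a * t + a * t := by push_cast; ring
    have e1 : (a:ZMod p) * (((k+1 : ℕ) : ZMod p) * t) = a * (k * t) + a * t := by push_cast; ring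
    rw [e1, e2]
    unfold sn
    simp only [neg_add, AddChar.map_add_eq_mul]
    linear_combination (ZMod.stdAddChar ((a : ZMod p) * ((k:ZMod p) * t)) - ZMod.stdAddChar (-((a : ZMod p) * ((k:ZMod p) * t)))) * stdmul ((a:ZMod p)*t)

lemma sn_ne_zero (h2 : p ≠ 2) {j : ZMod p} (hj : j ≠ 0) : sn p j ≠ 0 := by
  intro h
  have := ZMod.injective_stdAddChar (sub_eq_zero.mp h)
  have h3 : (2:ZMod p) * j = 0 := by linear_combination this
  rcases mul_eq_zero.mp h3 with h4 | h4
  · have : ((2:ℕ):ZMod p) = 0 := by exact_mod_cast h4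
    rw [ZMod.natCast_eq_zero_iff] at this
    exact h2 ((Nat.prime_dvd_prime_iff_eq hpf.out Nat.prime_two).mp this)
  · exact hj h4

lemma c_mul (h2 : p ≠ 2) (t : ZMod p) (ht : t ≠ 0) (k : ℕ) (hk : (k : ZMod p) ≠ 0) (l : ℕ) (hl : (k : ZMod p) * l = 1) :
    D.c t k * D.c (k * t) l = 1 := by
  apply D.emb_inj 1
  rw [map_mul, map_one]
  have h1 := D.emb_c 1 t k
  have h3 := D.emb_c 1 (k * t) l
  have e : (l:ZMod p) * (k * t) = t := by linear_combination t * hl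
  rw [e] at h3
  simp only [Units.val_one, one_mul] at h1 h3
  have hs := sn_ne_zero h2 (mul_ne_zero hk ht)
  apply mul_right_cancel₀ hs
  linear_combination (D.emb 1 (D.c t k)) * h3 + h1

lemma c_isUnit (h2 : p ≠ 2) (t : ZMod p) (ht : t ≠ 0) (k : ℕ) (hk : (k : ZMod p) ≠ 0) : IsUnit (D.c t k) := by
  refine IsUnit.of_mul_eq_one _ (D.c_mul h2 t ht k hk ((k:ZMod p)⁻¹).val ?_)
  rw [ZMod.natCast_zmod_val]
  exact mul_inv_cancel₀ hk

/-- the prime above `p` up to units -/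
noncomputable def pi : 𝓞 F := D.b 2 - 2

lemma emb_pi (a : (ZMod p)ˣ) : D.emb a D.pi = (sn p a)^2 := by
  rw [pi, map_sub, emb_b, map_ofNat, sn, mul_two]
  rw [neg_add, AddChar.map_add_eq_mul, AddChar.map_add_eq_mul]
  linear_combination 2 * stdmul (a : ZMod p)

lemma b_sub (m n : ℕ) : D.b (m + n) - D.b (m - n) = D.c 1 m * D.c 1 n * D.pi := by
  apply D.emb_inj 1
  rw [map_sub, map_mul, map_mul, emb_pi, emb_b, emb_b]
  have h1 := D.emb_c 1 1 m
  have h3 := D.emb_c 1 1 n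
  simp only [Units.val_one, one_mul, mul_one] at *
  have : sn p m * sn p n = ZMod.stdAddChar ((m:ZMod p) + (n:ZMod p)) + ZMod.stdAddChar (-((m:ZMod p) + (n:ZMod p))) -
     (ZMod.stdAddChar ((m:ZMod p) - (n:ZMod p)) + ZMod.stdAddChar (-((m:ZMod p) - (n:ZMod p)))) := by
    simp only [sn, sub_eq_add_neg, neg_add, neg_neg, AddChar.map_add_eq_mul]
    ring
  rw [← this, ← h1, ← h3]; ring

lemma prod_sn (h2 : p ≠ 2) : ∏ k ∈ Finset.univ.erase (0 : ZMod p), sn p k = p := by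
  have h0 : ∀ k : ZMod p, sn p k = ZMod.stdAddChar k * (1 - ZMod.stdAddChar (-2 * k)) := by
    intro k
    rw [sn, mul_sub, ← AddChar.map_add_eq_mul, mul_one]; ring_nf
  simp_rw [h0]
  rw [Finset.prod_mul_distrib]
  have two_ne : (2:ZMod p) ≠ 0 := by
    intro h4
    have : ((2:ℕ):ZMod p) = 0 := by exact_mod_cast h4
    rw [ZMod.natCast_eq_zero_iff] at this
    exact h2 ((Nat.prime_dvd_prime_iff_eq hpf.out Nat.prime_two).mp this)
  have hsp : ∏ k : ZMod p, ZMod.stdAddChar k = ZMod.stdAddChar (∑ k : ZMod p, k) := by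
    have := map_prod (ZMod.stdAddChar (N := p)).toMonoidHom (fun k : ZMod p ↦ Multiplicative.ofAdd k) Finset.univ
    rw [← ofAdd_sum] at this
    exact this.symm
  have e1 : ∏ k ∈ Finset.univ.erase (0 : ZMod p), ZMod.stdAddChar k = (1:ℂ) := by
    rw [Finset.prod_erase _ (by simp), hsp]
    have : ∑ k : ZMod p, k = 0 := by
      have : ∑ k : ZMod p, k = ∑ k : ZMod p, -k := (Equiv.sum_comp (Equiv.neg _) _).symm
      rw [Finset.sum_neg_distrib] at this
      have h3 : 2 * ∑ k : ZMod p, k = 0 := by linear_combination this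
      exact (mul_eq_zero.mp h3).resolve_left two_ne
    rw [this, AddChar.map_zero_eq_one]
  have e2 : ∏ k ∈ Finset.univ.erase (0 : ZMod p), (1 - ZMod.stdAddChar (-2 * k)) =
     ∏ k ∈ Finset.univ.erase (0 : ZMod p), (1 - ZMod.stdAddChar k : ℂ) := by
    refine Finset.prod_bij (fun k _ ↦ -2 * k) ?_ ?_ ?_ ?_
    · intro k hk; simp at hk ⊢; exact ⟨two_ne, hk⟩
    · intro k _ l _ h; exact mul_left_cancel₀ (neg_ne_zero.mpr two_ne) h
    · intro k hk
      refine ⟨(-2)⁻¹ * k, ?_, mul_inv_cancel_left₀ (neg_ne_zero.mpr two_ne) k⟩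
      simp at hk ⊢; exact ⟨two_ne, hk⟩
    · intros; rfl
  rw [e1, e2, one_mul]
  have hz : IsPrimitiveRoot (ZMod.stdAddChar (1 : ZMod p)) p := by
    have := Complex.isPrimitiveRoot_exp p hpf.out.ne_zero
    convert this using 1
    have := ZMod.stdAddChar_coe (N := p) 1
    simpa using this
  obtain ⟨n, hn⟩ : ∃ n, p = n + 1 := ⟨p - 1, (Nat.succ_pred_prime hpf.out).symm⟩
  have hz' : IsPrimitiveRoot (ZMod.stdAddChar (1 : ZMod p)) (n+1) := hn ▸ hz
  have hpr := hz'.prod_one_sub_pow_eq_order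
  have hc : (p:ℂ) = n + 1 := by rw [hn]; push_cast; ring
  rw [hc, ← hpr]
  have hval : ∀ k : ZMod p, ZMod.stdAddChar k = (ZMod.stdAddChar (1:ZMod p) : ℂ)^k.val := by
    intro k
    rw [← AddChar.map_nsmul_eq_pow]; simp
  refine Finset.prod_bij (fun k _ ↦ k.val - 1) ?_ ?_ ?_ ?_
  · intro k hk
    have h1 := ZMod.val_lt k
    have h3 : k.val ≠ 0 := by simpa using hk
    simp only [Finset.mem_range]; omega
  · intro k hk l hl h
    have h3 : k.val ≠ 0 := by simpa using hk
    have h4 : l.val ≠ 0 := by simpa using hl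
    exact ZMod.val_injective p (by omega)
  · intro m hm
    rw [Finset.mem_range] at hm
    have hv : ((m + 1 : ℕ) : ZMod p).val = m + 1 := ZMod.val_cast_of_lt (by omega)
    refine ⟨((m+1 : ℕ) : ZMod p), ?_, ?_⟩
    · simp only [Finset.mem_erase, Finset.mem_univ, and_true]
      intro h
      rw [h] at hv; simp at hv
    · rw [hv]; rfl
  · intro k hk
    have h3 : k.val ≠ 0 := by simpa using hk
    rw [hval k, Nat.sub_add_cancel (by omega)]

/-- `p` equals a unit times `π ^ n`. -/
lemma prod_c (h2 : p ≠ 2) : (∏ k ∈ Finset.univ.erase (0 : ZMod p), D.c 1 k.val) *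
    D.pi ^ (Fintype.card (RG p)) = p := by
  apply D.emb_inj 1
  rw [map_mul, map_prod, map_pow, emb_pi, map_natCast, ← prod_sn h2, ← pow_mul, mul_comm 2, card_RG p h2]
  have : p - 1 = (Finset.univ.erase (0:ZMod p)).card := by
    rw [Finset.card_erase_of_mem (Finset.mem_univ _), Finset.card_univ, ZMod.card]
  rw [this, ← Finset.prod_const, ← Finset.prod_mul_distrib]
  refine Finset.prod_congr rfl fun k _ ↦ ?_
  have := D.emb_c 1 1 k.val
  simpa using this

lemma isUnit_prod_c (h2 : p ≠ 2) : IsUnit (∏ k ∈ Finset.univ.erase (0 : ZMod p), D.c 1 k.val) := by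
  rw [IsUnit.prod_iff]
  intro k hk
  refine D.c_isUnit h2 1 one_ne_zero _ ?_
  simpa using hk

end RC

end Part4

section Part5

open Filter Topology Complex NumberField

section
variable {p : ℕ} [hpf : Fact p.Prime]

lemma sum_units_rg (h2 : p ≠ 2) {M : Type*} [AddCommMonoid M] (h : RG p → M) :
    ∑ u : (ZMod p)ˣ, h (rgmk p u) = 2 • ∑ α, h α := by
  classical
  rw [← Finset.sum_fiberwise_of_maps_to (s := Finset.univ) (t := Finset.univ) (g := rgmk p) (by simp),
    Finset.smul_sum]
  refine Finset.sum_congr rfl fun α _ ↦ ?_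
  obtain ⟨u, rfl⟩ := rgmk_surj p α
  have : (Finset.univ.filter fun i ↦ rgmk p i = rgmk p u) = {u, -u} := by
    ext i; simp [rgmk_eq]
  rw [this]
  have hne : u ≠ -u := by
    intro h
    have h3 : (u:ZMod p) = - u := by exact_mod_cast congrArg Units.val h
    have h4 : (2:ZMod p) * u = 0 := by linear_combination h3
    rcases mul_eq_zero.mp h4 with h5 | h5
    · have : ((2:ℕ):ZMod p) = 0 := by exact_mod_cast h5
      rw [ZMod.natCast_eq_zero_iff] at this
      exact h2 ((Nat.prime_dvd_prime_iff_eq hpf.out Nat.prime_two).mp this)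
    · exact u.ne_zero h5
  rw [Finset.sum_pair hne, two_nsmul, (rgmk_eq p (-u) u).mpr (Or.inr rfl)]

lemma sum_zmod_units {M : Type*} [AddCommMonoid M] (g : ZMod p → M) :
    ∑ j, g j = g 0 + ∑ u : (ZMod p)ˣ, g u := by
  classical
  rw [← Finset.add_sum_erase _ _ (Finset.mem_univ (0 : ZMod p))]
  congr 1
  refine (Finset.sum_bij (s := (Finset.univ : Finset (ZMod p)ˣ)) (t := Finset.univ.erase (0 : ZMod p)) (f := fun u ↦ g u) (g := g) (fun u _ ↦ (u : ZMod p)) ?_ ?_ ?_ ?_).symm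
  · intro u _; simp
  · intro u _ v _ h; exact Units.ext h
  · intro j hj
    exact ⟨Units.mk0 j (by simpa using hj), Finset.mem_univ _, rfl⟩
  · intros; rfl
end

namespace RC
variable {p : ℕ} [hpf : Fact p.Prime] {F : Type*} [Field F] [NumberField F] (D : RC p F)

noncomputable def embA (α : RG p) : 𝓞 F →+* ℂ := (D.φ α).comp (algebraMap (𝓞 F) F)

lemma embA_mk (a : (ZMod p)ˣ) : D.embA (rgmk p a) = D.emb a := rfl

noncomputable def bA (α : RG p) : 𝓞 F := D.b ((Function.surjInv (rgmk_surj p) α : (ZMod p)ˣ) : ZMod p)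

lemma bA_mk (u : (ZMod p)ˣ) : D.bA (rgmk p u) = D.b u := by
  unfold bA
  have := Function.surjInv_eq (rgmk_surj p) (rgmk p u)
  rcases (rgmk_eq p _ _).mp this with h | h
  · rw [h]
  · rw [h, Units.val_neg, b_neg]

lemma trace_eq (x : 𝓞 F) : ((Algebra.trace ℤ (𝓞 F) x : ℤ) : ℂ) = ∑ α, D.embA α x := by
  have h1 := Algebra.coe_trace_int x
  have h3 := trace_eq_sum_embeddings (K := ℚ) (L := F) ℂ (x := (x : F))
  rw [← h1] at h3
  have e : (algebraMap ℚ ℂ) ((Algebra.trace ℤ (𝓞 F) x : ℤ) : ℚ) = ((Algebra.trace ℤ (𝓞 F) x : ℤ) : ℂ) := by simp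
  rw [← e, h3]
  refine (Fintype.sum_equiv (D.φ.trans (RingHom.equivRatAlgHom F ℂ)) _ _ ?_).symm
  intro α
  rfl

lemma embA_symm (α β : RG p) : D.embA α (D.bA β) = D.embA β (D.bA α) := by
  obtain ⟨a, rfl⟩ := rgmk_surj p α
  obtain ⟨b, rfl⟩ := rgmk_surj p β
  rw [embA_mk, embA_mk, bA_mk, bA_mk, emb_b, emb_b, mul_comm]

lemma orth (h2 : p ≠ 2) (α β : RG p) : ∑ γ, D.embA γ (D.bA α) * D.embA γ (D.bA β) =
    if α = β then (p:ℂ) - 2 else - 2 := by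
  obtain ⟨a, rfl⟩ := rgmk_surj p α
  obtain ⟨b, rfl⟩ := rgmk_surj p β
  have h := sum_units_rg h2 (fun γ ↦ D.embA γ (D.bA (rgmk p a)) * D.embA γ (D.bA (rgmk p b)))
  have h3 := sum_zmod_units (fun j : ZMod p ↦
    ((ZMod.stdAddChar (j * (a:ZMod p)) + ZMod.stdAddChar (-(j * (a:ZMod p)))) * (ZMod.stdAddChar (j * (b:ZMod p)) + ZMod.stdAddChar (-(j * (b:ZMod p)))) : ℂ))
  have h4 : ∑ u : (ZMod p)ˣ, D.embA (rgmk p u) (D.bA (rgmk p a)) * D.embA (rgmk p u) (D.bA (rgmk p b)) =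
     ∑ u : (ZMod p)ˣ, ((ZMod.stdAddChar ((u:ZMod p) * (a:ZMod p)) + ZMod.stdAddChar (-((u:ZMod p) * (a:ZMod p)))) *
      (ZMod.stdAddChar ((u:ZMod p) * (b:ZMod p)) + ZMod.stdAddChar (-((u:ZMod p) * (b:ZMod p)))) : ℂ) := by
    refine Finset.sum_congr rfl fun u _ ↦ ?_
    rw [embA_mk, bA_mk, bA_mk, emb_b, emb_b]
  rw [h4] at h
  rw [h] at h3
  have e : ∀ j : ZMod p, ((ZMod.stdAddChar (j * (a:ZMod p)) + ZMod.stdAddChar (-(j * (a:ZMod p)))) * (ZMod.stdAddChar (j * (b:ZMod p)) + ZMod.stdAddChar (-(j * (b:ZMod p)))) : ℂ)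
     = ZMod.stdAddChar (j * ((a:ZMod p) + (b:ZMod p))) + ZMod.stdAddChar (j * ((a:ZMod p) - (b:ZMod p))) + ZMod.stdAddChar (j * ((b:ZMod p) - (a:ZMod p)))
       + ZMod.stdAddChar (j * (- (a:ZMod p) - (b:ZMod p))) := by
    intro j
    rw [show j * ((a:ZMod p) + b) = j * a + j * b by ring, show j * ((a:ZMod p) - b) = j * a + -(j * (b:ZMod p)) by ring,
      show j * ((b:ZMod p) - a) = -(j * (a:ZMod p)) + j * b by ring, show j * (-(a:ZMod p) - b) = -(j * (a:ZMod p)) + -(j * (b:ZMod p)) by ring]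
    simp only [AddChar.map_add_eq_mul]
    ring
  simp_rw [e] at h3
  rw [Finset.sum_add_distrib, Finset.sum_add_distrib, Finset.sum_add_distrib] at h3
  simp only [AddChar.sum_mulShift _ (ZMod.isPrimitive_stdAddChar p), ZMod.card, zero_mul, AddChar.map_zero_eq_one] at h3
  have f1 : ((a:ZMod p) + b = 0) ↔ a = -b := by
    rw [add_eq_zero_iff_eq_neg, ← Units.val_neg, Units.val_inj]
  have f2 : ((a:ZMod p) - b = 0) ↔ a = b := by
    rw [sub_eq_zero, Units.val_inj]
  have f3 : ((b:ZMod p) - a = 0) ↔ a = b := by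
    rw [sub_eq_zero, Units.val_inj, eq_comm]
  have f4 : (-(a:ZMod p) - b = 0) ↔ a = -b := by
    rw [← f1, ← neg_eq_zero (a := (a:ZMod p) + b)]; ring_nf
  have hne : ¬ (a = b ∧ a = -b) := by
    rintro ⟨h, h'⟩
    have h3 : (a:ZMod p) = - a := by
      conv_rhs => rw [h]
      exact_mod_cast congrArg Units.val h'
    have h4 : (2:ZMod p) * a = 0 := by linear_combination h3
    rcases mul_eq_zero.mp h4 with h5 | h5
    · have : ((2:ℕ):ZMod p) = 0 := by exact_mod_cast h5
      rw [ZMod.natCast_eq_zero_iff] at this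
      exact h2 ((Nat.prime_dvd_prime_iff_eq hpf.out Nat.prime_two).mp this)
    · exact a.ne_zero h5
  simp only [f1, f2, f3, f4, nsmul_eq_mul] at h3
  push_cast at h3
  apply mul_left_cancel₀ (two_ne_zero (α := ℂ))
  rw [← sub_eq_iff_eq_add'] at h3
  rw [← h3]
  simp only [rgmk_eq]
  by_cases h5 : a = b
  · have h6 : ¬ a = -b := fun h ↦ hne ⟨h5, h⟩
    simp only [if_pos h5, if_neg h6, if_pos (Or.inl h5 : a = b ∨ a = -b)]
    ring
  · by_cases h6 : a = -b
    · simp only [if_pos h6, if_neg h5, if_pos (Or.inr h6 : a = b ∨ a = -b)]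
      ring
    · simp only [if_neg h6, if_neg h5, if_neg (not_or.mpr ⟨h5, h6⟩)]
      ring

lemma trace_bA (h2 : p ≠ 2) (α β : RG p) : Algebra.trace ℤ (𝓞 F) (D.bA α * D.bA β) =
    if α = β then (p:ℤ) - 2 else - 2 := by
  have : ((Algebra.trace ℤ (𝓞 F) (D.bA α * D.bA β) : ℤ) : ℂ) = ((if α = β then (p:ℤ) - 2 else - 2 : ℤ) : ℂ) := by
    rw [D.trace_eq]
    simp only [map_mul]
    rw [D.orth h2]
    split_ifs <;> push_cast <;> rfl
  exact_mod_cast this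

/-- `p x` is an integral combination of the `b`'s -/
lemma p_mul (h2 : p ≠ 2) (x : 𝓞 F) : (p : 𝓞 F) * x = 2 * (Algebra.trace ℤ (𝓞 F) x : ℤ) +
    ∑ β, ((Algebra.trace ℤ (𝓞 F) (x * D.bA β) : ℤ) : 𝓞 F) * D.bA β := by
  apply D.emb_inj 1
  rw [← embA_mk]
  set α := rgmk p 1
  simp only [map_add, map_mul, map_sum, map_natCast, map_intCast, map_ofNat, D.trace_eq]
  simp only [Finset.sum_mul]
  rw [Finset.sum_comm]
  have : ∀ γ, ∑ β, D.embA γ x * D.embA γ (D.bA β) * D.embA α (D.bA β) =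
     D.embA γ x * (if γ = α then (p:ℂ) - 2 else - 2) := by
    intro γ
    simp only [mul_assoc, ← Finset.mul_sum]
    rw [← D.orth h2]
    congr 1
    exact Finset.sum_congr rfl fun β _ ↦ by rw [D.embA_symm γ, D.embA_symm α]
  simp_rw [this]
  have e : ∀ γ, D.embA γ x * (if γ = α then (p:ℂ) - 2 else - 2) = (if γ = α then p * D.embA γ x else 0) - 2 * D.embA γ x := by
    intro γ; split_ifs <;> ring
  simp_rw [e]
  rw [Finset.sum_sub_distrib, ← Finset.mul_sum, Finset.sum_ite_eq' Finset.univ α, if_pos (Finset.mem_univ _)]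
  ring

lemma det_aux (h2 : p ≠ 2) : (Matrix.of fun α β : RG p ↦ if α = β then (p:ℤ) - 2 else - 2).det = (p:ℤ)^(Fintype.card (RG p) - 1) := by
  have hp0 : (p:ℚ) ≠ 0 := by exact_mod_cast hpf.out.ne_zero
  have hcast := Int.cast_det (R := ℚ) (Matrix.of fun α β : RG p ↦ if α = β then (p:ℤ) - 2 else - 2)
  have hM : (Matrix.of fun α β : RG p ↦ if α = β then (p:ℤ) - 2 else - 2).map (Int.cast : ℤ → ℚ) =
     (p:ℚ) • (1 + Matrix.replicateCol Unit (fun _ : RG p ↦ (-2/p : ℚ)) * Matrix.replicateRow Unit (fun _ : RG p ↦ (1:ℚ))) := by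
    ext α β
    by_cases h : α = β
    · simp [h, Matrix.mul_apply]; field_simp; ring
    · simp [h, Matrix.mul_apply]; field_simp
  rw [hM, Matrix.det_smul, Matrix.det_one_add_replicateCol_mul_replicateRow] at hcast
  have hc := card_RG p h2
  have hp1 := hpf.out.one_lt
  have hcq : (Fintype.card (RG p) : ℚ) * 2 = p - 1 := by
    rw [← Nat.cast_one, ← Nat.cast_sub hp1.le, ← hc]; push_cast; ring
  have hcpos : 0 < Fintype.card (RG p) := Fintype.card_pos
  have : (p:ℚ)^(Fintype.card (RG p)) = p^(Fintype.card (RG p) - 1) * p := by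
    rw [← pow_succ, Nat.sub_add_cancel hcpos]
  have hd : (fun _ : RG p ↦ (1:ℚ)) ⬝ᵥ (fun _ : RG p ↦ (-2/p : ℚ)) = -(p-1)/p := by
    simp [dotProduct]; field_simp; linear_combination -hcq
  rw [hd, this] at hcast
  have : ((Matrix.of fun α β : RG p ↦ if α = β then (p:ℤ) - 2 else - 2).det : ℚ) = (p:ℚ)^(Fintype.card (RG p) - 1) := by
    rw [hcast]; field_simp; ring
  exact_mod_cast this

lemma discr_bA (h2 : p ≠ 2) : Algebra.discr ℤ D.bA = (p:ℤ)^(Fintype.card (RG p) - 1) := by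
  rw [Algebra.discr_def, ← det_aux h2]
  congr 1
  ext α β
  simp [Algebra.traceMatrix, Algebra.traceForm_apply, D.trace_bA h2]

lemma discr_rel (D : RC p F) (h2 : p ≠ 2) : ∃ m : ℤ, m^2 * NumberField.discr F = (p:ℤ)^(Fintype.card (RG p) - 1) := by
  have hc : Fintype.card (Module.Free.ChooseBasisIndex ℤ (𝓞 F)) = Fintype.card (RG p) := by
    rw [← Module.finrank_eq_card_chooseBasisIndex, RingOfIntegers.rank, D.finrank_eq]
  let B := (RingOfIntegers.basis F).reindex (Fintype.equivOfCardEq hc)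
  refine ⟨(Matrix.of fun i j ↦ B.repr (D.bA j) i).det, ?_⟩
  rw [← D.discr_bA h2, ← NumberField.discr_eq_discr F B, ← Algebra.discr_of_matrix_vecMul]
  congr 1
  ext1 j
  conv_rhs => rw [← B.sum_repr (D.bA j)]
  simp [Matrix.vecMul, dotProduct, zsmul_eq_mul, mul_comm]

end RC

end Part5

section Part6

open Filter Topology Complex NumberField

namespace RC
variable {p : ℕ} [hpf : Fact p.Prime] {F : Type*} [Field F] [NumberField F] (D : RC p F)

lemma b_dickson (j : ZMod p) (k : ℕ) : D.b (k * j) = (Polynomial.dickson 1 (1 : 𝓞 F) k).eval (D.b j) := by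
  induction k using Nat.twoStepInduction with
  | zero => simp [b_zero]; norm_num
  | one => simp
  | more k h1 h2 =>
    rw [Polynomial.dickson_add_two, Polynomial.eval_sub, Polynomial.eval_mul, Polynomial.eval_mul, ← h1, ← h2]
    simp only [Polynomial.eval_X, Polynomial.eval_C, one_mul]
    rw [b_mul, ← D.b_neg (j - _)]
    rw [show j + ((k+1:ℕ):ZMod p) * j = ((k+2:ℕ):ZMod p) * j by push_cast; ring,
      show -(j - ((k+1:ℕ):ZMod p) * j) = (k:ZMod p) * j by push_cast; ring]
    ring

/-- Frobenius on `b` -/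
lemma b_frob {R : Type*} [CommRing R] (q : 𝓞 F →+* R) (ℓ : ℕ) [hl : Fact ℓ.Prime] [CharP R ℓ] (j : ZMod p) (k : ℕ) :
    q (D.b j) ^ (ℓ^k) = q (D.b ((ℓ:ZMod p)^k * j)) := by
  induction k with
  | zero => simp
  | succ k ih =>
    rw [pow_succ, pow_mul, ih]
    rw [show (ℓ:ZMod p)^(k+1) * j = ℓ * ((ℓ:ZMod p)^k * j) by ring, b_dickson, ← Polynomial.eval₂_at_apply,
      ← Polynomial.eval_map, Polynomial.map_dickson, map_one, Polynomial.dickson_one_one_charP R ℓ]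
    simp

variable (ℓ : ℕ) [hl : Fact ℓ.Prime]

lemma coe_ne_zero_of_ne (hlp : ℓ ≠ p) : (ℓ : ZMod p) ≠ 0 := by
  rw [Ne, ZMod.natCast_eq_zero_iff]
  intro h
  exact hlp ((Nat.prime_dvd_prime_iff_eq hpf.out hl.out).mp h).symm

noncomputable def ul (hlp : ℓ ≠ p) : (ZMod p)ˣ := Units.mk0 (ℓ : ZMod p) (coe_ne_zero_of_ne ℓ hlp)

lemma frob_mem (D : RC p F) (h2 : p ≠ 2) (hlp : ℓ ≠ p) {R : Type*} [CommRing R] (q : 𝓞 F →+* R) [CharP R ℓ] (f : ℕ)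
    (hf : rgmk p (ul ℓ hlp) ^ f = 1) (x : 𝓞 F) : q x ^ (ℓ^f) = q x := by
  have hb : ∀ β, q (D.bA β) ^ (ℓ^f) = q (D.bA β) := by
    intro β
    obtain ⟨u, rfl⟩ := rgmk_surj p β
    rw [bA_mk, D.b_frob q ℓ]
    have : rgmk p (ul ℓ hlp ^ f * u) = rgmk p u := by rw [map_mul, map_pow, hf, one_mul]
    have h3 : ((ul ℓ hlp ^ f * u : (ZMod p)ˣ) : ZMod p) = (ℓ:ZMod p)^f * u := by
      push_cast; rfl
    rw [← h3, ← bA_mk, this, bA_mk]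
  have hadd : ExpChar R ℓ := ExpChar.prime hl.out
  have h := congrArg q (D.p_mul h2 x)
  have h' := congrArg (iterateFrobenius R ℓ f) h
  simp only [map_add, map_mul, map_sum, map_natCast, map_intCast, map_ofNat] at h h'
  simp only [iterateFrobenius_def, hb] at h'
  rw [← h] at h'
  have hu : IsUnit (p : R) := by
    have : Nat.Coprime p ℓ := (Nat.coprime_primes hpf.out hl.out).mpr (Ne.symm hlp)
    have := (ZMod.isUnit_iff_coprime p ℓ).mpr this
    have := this.map (ZMod.castHom (dvd_refl ℓ) R)
    simpa using this
  exact hu.mul_left_cancel h'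

lemma pi_notMem (h2 : p ≠ 2) (hlp : ℓ ≠ p) (P : Ideal (𝓞 F)) (hP : P ≠ ⊤) (hlP : (ℓ : 𝓞 F) ∈ P) : D.pi ∉ P := by
  intro h
  have hpP : (p : 𝓞 F) ∈ P := by
    rw [← D.prod_c h2]
    exact P.mul_mem_left _ (P.pow_mem_of_mem h _ Fintype.card_pos)
  have hc : IsCoprime (p:ℤ) (ℓ:ℤ) := by
    rw [Nat.isCoprime_iff_coprime]; exact (Nat.coprime_primes hpf.out hl.out).mpr (Ne.symm hlp)
  obtain ⟨u, v, huv⟩ := hc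
  apply hP
  rw [Ideal.eq_top_iff_one]
  have : (1 : 𝓞 F) = u * p + v * ℓ := by exact_mod_cast congrArg (Int.cast (R := 𝓞 F)) huv.symm
  rw [this]
  exact P.add_mem (P.mul_mem_left _ hpP) (P.mul_mem_left _ hlP)

lemma order_dvd (h2 : p ≠ 2) (hlp : ℓ ≠ p) (P : Ideal (𝓞 F)) (hP : P ≠ ⊤) (hlP : (ℓ : 𝓞 F) ∈ P)
    (k : ℕ) (hk : D.b ((ℓ:ZMod p)^k) - D.b 1 ∈ P) : rgmk p (ul ℓ hlp) ^ k = 1 := by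
  rw [← map_pow, ← map_one (rgmk p), rgmk_eq]
  by_contra hc
  push Not at hc
  have two_ne : (2:ZMod p) ≠ 0 := by
    intro h4
    have : ((2:ℕ):ZMod p) = 0 := by exact_mod_cast h4
    rw [ZMod.natCast_eq_zero_iff] at this
    exact h2 ((Nat.prime_dvd_prime_iff_eq hpf.out Nat.prime_two).mp this)
  set q : ZMod p := (ℓ:ZMod p)^k
  have hq1 : q ≠ 1 := fun h ↦ hc.1 (Units.ext (by push_cast; exact h))
  have hq2 : q ≠ -1 := fun h ↦ hc.2 (Units.ext (by push_cast; exact h))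
  have h := D.b_sub ((q+1)/2).val ((q-1)/2).val
  simp only [ZMod.natCast_zmod_val] at h
  rw [show (q+1)/2 + (q-1)/2 = q by field_simp; ring, show (q+1)/2 - (q-1)/2 = 1 by field_simp; ring] at h
  rw [h] at hk
  have u1 := D.c_isUnit h2 1 one_ne_zero ((q+1)/2).val (by
    rw [ZMod.natCast_zmod_val]; exact div_ne_zero (fun h ↦ hq2 (by linear_combination h)) two_ne)
  have u2 := D.c_isUnit h2 1 one_ne_zero ((q-1)/2).val (by
    rw [ZMod.natCast_zmod_val]; exact div_ne_zero (fun h ↦ hq1 (by linear_combination h)) two_ne)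
  rw [Ideal.unit_mul_mem_iff_mem _ (u1.mul u2)] at hk
  exact D.pi_notMem ℓ h2 hlp P hP hlP hk

lemma span_isMaximal : (Ideal.span {(ℓ : ℤ)}).IsMaximal :=
  Ideal.IsPrime.isMaximal ((Ideal.span_singleton_prime (by exact_mod_cast hl.out.ne_zero)).2
    (Nat.prime_iff_prime_int.1 hl.out)) (by simpa using hl.out.ne_zero)

lemma mem_primesOver (P : Ideal (𝓞 F)) : P ∈ IsDedekindDomain.primesOverFinset (Ideal.span {(ℓ : ℤ)}) (𝓞 F) ↔
      P.IsPrime ∧ P.LiesOver (Ideal.span {(ℓ : ℤ)}) := by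
  have hb : Ideal.span {(ℓ : ℤ)} ≠ ⊥ := by simpa using hl.out.ne_zero
  have := span_isMaximal ℓ
  rw [← Finset.mem_coe, IsDedekindDomain.coe_primesOverFinset hb]
  rfl

lemma nat_mem (P : Ideal (𝓞 F)) [hP : P.LiesOver (Ideal.span {(ℓ : ℤ)})] : (ℓ : 𝓞 F) ∈ P := by
  have h : (ℓ:ℤ) ∈ P.under ℤ := by
    rw [← hP.over]; exact Ideal.mem_span_singleton_self _
  simpa [Ideal.under] using h

lemma ne_bot' (P : Ideal (𝓞 F)) [hP : P.LiesOver (Ideal.span {(ℓ : ℤ)})] : P ≠ ⊥ := by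
  rintro rfl
  have := nat_mem ℓ (⊥ : Ideal (𝓞 F))
  simp [hl.out.ne_zero] at this

lemma charP_quot (P : Ideal (𝓞 F)) (hP : P ≠ ⊤) (h : (ℓ : 𝓞 F) ∈ P) : CharP (𝓞 F ⧸ P) ℓ := by
  have : Nontrivial (𝓞 F ⧸ P) := Ideal.Quotient.nontrivial_iff.mpr hP
  rw [CharP.charP_iff_prime_eq_zero hl.out, ← map_natCast (Ideal.Quotient.mk P)]
  exact Ideal.Quotient.eq_zero_iff_mem.mpr h

lemma absNorm_eq (D : RC p F) (h2 : p ≠ 2) (hlp : ℓ ≠ p) (P : Ideal (𝓞 F)) [hPp : P.IsPrime]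
    [hP : P.LiesOver (Ideal.span {(ℓ : ℤ)})] :
    (Ideal.span {(ℓ : ℤ)}).inertiaDeg' P = orderOf (rgmk p (ul ℓ hlp)) := by
  have hlP := nat_mem ℓ P
  have hbot := ne_bot' ℓ P
  have hchar := charP_quot ℓ P hPp.ne_top hlP
  have hmax : P.IsMaximal := hPp.isMaximal hbot
  let _ := Ideal.Quotient.field P
  have hfin : Finite (𝓞 F ⧸ P) := Ideal.finiteQuotientOfFreeOfNeBot P hbot
  let _ := Fintype.ofFinite (𝓞 F ⧸ P)
  set k := (Ideal.span {(ℓ : ℤ)}).inertiaDeg' P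
  set f := orderOf (rgmk p (ul ℓ hlp))
  have hcard : Fintype.card (𝓞 F ⧸ P) = ℓ^k := by
    rw [← Nat.card_eq_fintype_card, ← Ideal.absNorm_eq_pow_inertiaDeg' P hl.out, Ideal.absNorm_apply, Submodule.cardQuot_apply]
  apply le_antisymm
  · have h1 : Fintype.card (𝓞 F ⧸ P) ≤ ℓ^f := by
      have hlt : 1 < ℓ^f := Nat.one_lt_pow (orderOf_pos _).ne' hl.out.one_lt
      refine le_trans ?_ (FiniteField.X_pow_card_sub_X_natDegree_eq (𝓞 F ⧸ P) hlt).le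
      have hne := FiniteField.X_pow_card_sub_X_ne_zero (𝓞 F ⧸ P) hlt
      refine le_trans ?_ (Polynomial.card_roots' _)
      rw [← Finset.card_univ]
      classical
      refine le_trans (Finset.card_le_card ?_) (Multiset.toFinset_card_le _)
      intro x _
      rw [Multiset.mem_toFinset, Polynomial.mem_roots hne]
      obtain ⟨y, rfl⟩ := Ideal.Quotient.mk_surjective x
      have := D.frob_mem ℓ h2 hlp (Ideal.Quotient.mk P) f (pow_orderOf_eq_one _) y
      simp [this]
    rw [hcard] at h1
    exact (Nat.pow_le_pow_iff_right hl.out.one_lt).mp h1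
  · have hkpos : 0 < k := by
      by_contra h
      have : k = 0 := by omega
      rw [this, pow_zero] at hcard
      have := Fintype.one_lt_card (α := 𝓞 F ⧸ P)
      omega
    refine Nat.le_of_dvd hkpos (orderOf_dvd_of_pow_eq_one (D.order_dvd ℓ h2 hlp P hPp.ne_top hlP k ?_))
    rw [← Ideal.Quotient.eq_zero_iff_mem, map_sub, sub_eq_zero]
    have := D.b_frob (Ideal.Quotient.mk P) ℓ 1 k
    rw [mul_one] at this
    rw [← this, ← hcard, FiniteField.pow_card]

lemma ram_eq (D : RC p F) (h2 : p ≠ 2) (hlp : ℓ ≠ p) (P : Ideal (𝓞 F)) [hPp : P.IsPrime]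
    [hP : P.LiesOver (Ideal.span {(ℓ : ℤ)})] :
    (Ideal.span {(ℓ : ℤ)}).ramificationIdx' P = 1 := by
  have hlP := nat_mem ℓ P
  have hbot := ne_bot' ℓ P
  have hmap : Ideal.map (algebraMap ℤ (𝓞 F)) (Ideal.span {(ℓ : ℤ)}) = Ideal.span {(ℓ : 𝓞 F)} := by
    rw [Ideal.map_span]; simp
  apply Ideal.ramificationIdx'_spec
  · rw [pow_one, hmap, Ideal.span_singleton_le_iff_mem]; exact hlP
  · rw [hmap, Ideal.span_singleton_le_iff_mem]
    intro h
    have hlt : P^2 < P := by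
      simpa using Ideal.pow_right_strictAnti P hbot hPp.ne_top (show 1 < 2 by norm_num)
    obtain ⟨x, hx, hx2⟩ := SetLike.exists_of_lt hlt
    have htop : P^2 ≠ ⊤ := fun h ↦ by rw [h] at hlt; exact absurd hlt (by simp)
    have hchar := charP_quot ℓ (P^2) htop h
    have := D.frob_mem ℓ h2 hlp (Ideal.Quotient.mk (P^2)) _ (pow_orderOf_eq_one _) x
    apply hx2
    rw [← Ideal.Quotient.eq_zero_iff_mem, ← this, ← map_pow, Ideal.Quotient.eq_zero_iff_mem]
    have hge : 2 ≤ ℓ ^ orderOf (rgmk p (ul ℓ hlp)) := 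
      Nat.one_lt_pow (orderOf_pos _).ne' hl.out.one_lt
    exact Ideal.pow_le_pow_right hge (Ideal.pow_mem_pow hx _)

lemma card_primes (D : RC p F) (h2 : p ≠ 2) (hlp : ℓ ≠ p) :
    orderOf (rgmk p (ul ℓ hlp)) * (IsDedekindDomain.primesOverFinset (Ideal.span {(ℓ : ℤ)}) (𝓞 F)).card
      = Fintype.card (RG p) := by
  have hb : Ideal.span {(ℓ : ℤ)} ≠ ⊥ := by simpa using hl.out.ne_zero
  have := span_isMaximal ℓ
  have h := Ideal.sum_ramification_inertia (𝓞 F) ℚ F hb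
  rw [D.finrank_eq] at h
  rw [← h, mul_comm, ← smul_eq_mul, ← Finset.sum_const]
  refine Finset.sum_congr rfl fun P hP ↦ ?_
  rw [mem_primesOver] at hP
  obtain ⟨h3, h4⟩ := hP
  rw [D.ram_eq ℓ h2 hlp, D.absNorm_eq ℓ h2 hlp, one_mul]

lemma local_factor (D : RC p F) (h2 : p ≠ 2) (hlp : ℓ ≠ p) (s : ℂ) [Fintype (RG p →* ℂˣ)] :
    ∏ P ∈ IsDedekindDomain.primesOverFinset (Ideal.span {(ℓ : ℤ)}) (𝓞 F), (1 - (Ideal.absNorm P : ℂ) ^ (-s))⁻¹ =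
    ∏ ψ : RG p →* ℂˣ, (1 - (ψ (rgmk p (ul ℓ hlp)) : ℂ) * (ℓ:ℂ)^(-s))⁻¹ := by
  rw [Finset.prod_inv_distrib, Finset.prod_inv_distrib,
    prod_one_sub_char _ _ _ rfl (D.card_primes ℓ h2 hlp), ← Finset.prod_const]
  congr 1
  refine Finset.prod_congr rfl fun P hP ↦ ?_
  rw [mem_primesOver] at hP
  obtain ⟨h3, h4⟩ := hP
  rw [Ideal.absNorm_eq_pow_inertiaDeg' P hl.out, D.absNorm_eq ℓ h2 hlp]
  push_cast
  rw [← Complex.natCast_cpow_natCast_mul, mul_comm, Complex.cpow_mul_nat]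

/-- the prime above `p` -/
lemma primes_p (D : RC p F) (h2 : p ≠ 2) (s : ℂ) :
    ∏ P ∈ IsDedekindDomain.primesOverFinset (Ideal.span {(p : ℤ)}) (𝓞 F), (1 - (Ideal.absNorm P : ℂ) ^ (-s))⁻¹ =
      (1 - (p:ℂ)^(-s))⁻¹ := by
  have hn : Ideal.absNorm (Ideal.span {D.pi}) = p := by
    have h : Ideal.span {(p : 𝓞 F)} = (Ideal.span {D.pi}) ^ (Fintype.card (RG p)) := by
      rw [Ideal.span_singleton_pow, ← D.prod_c h2, Ideal.span_singleton_eq_span_singleton]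
      exact (associated_unit_mul_left _ _ (D.isUnit_prod_c h2))
    have h' := congrArg Ideal.absNorm h
    rw [map_pow, Ideal.absNorm_span_natCast, RingOfIntegers.rank, D.finrank_eq] at h'
    exact (Nat.pow_left_injective Fintype.card_pos.ne' h').symm
  have hpp : (Ideal.span {D.pi}).IsPrime := Ideal.isPrime_of_irreducible_absNorm (by rw [hn]; exact hpf.out)
  have hne : Ideal.span {D.pi} ≠ ⊥ := by
    intro h; rw [h] at hn; simp at hn; exact hpf.out.ne_zero hn.symm
  have hmax := hpp.isMaximal hne
  have hset : IsDedekindDomain.primesOverFinset (Ideal.span {(p : ℤ)}) (𝓞 F) = {Ideal.span {D.pi}} := by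
    ext P
    rw [mem_primesOver, Finset.mem_singleton]
    constructor
    · rintro ⟨h3, h4⟩
      have := nat_mem p P
      rw [← D.prod_c h2, Ideal.unit_mul_mem_iff_mem _ (D.isUnit_prod_c h2)] at this
      have := h3.mem_of_pow_mem _ this
      exact (hmax.eq_of_le h3.ne_top (by rwa [Ideal.span_singleton_le_iff_mem])).symm
    · rintro rfl
      refine ⟨hpp, ⟨?_⟩⟩
      refine (span_isMaximal p).eq_of_le (Ideal.IsPrime.ne_top (Ideal.IsPrime.under ℤ _)) ?_
      rw [Ideal.span_singleton_le_iff_mem, Ideal.under, Ideal.mem_comap, map_natCast, ← D.prod_c h2]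
      exact Ideal.mul_mem_left _ _ (Ideal.pow_mem_of_mem _ (Ideal.mem_span_singleton_self _) _ Fintype.card_pos)
  rw [hset, Finset.prod_singleton, hn]

end RC

end Part6

section Part7

open Filter Topology Complex NumberField

namespace RC
variable {p : ℕ} [hpf : Fact p.Prime] {F : Type*} [Field F] [NumberField F] (D : RC p F)

/-- the even character -/
noncomputable def chi (ψ : RG p →* ℂˣ) : DirichletCharacter ℂ p := MulChar.ofUnitHom (ψ.comp (rgmk p))

lemma chi_coe (ψ : RG p →* ℂˣ) (u : (ZMod p)ˣ) : chi ψ (u : ZMod p) = (ψ (rgmk p u) : ℂ) :=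
  MulChar.ofUnitHom_coe _ _

lemma chi_zero (ψ : RG p →* ℂˣ) : chi ψ (0 : ZMod p) = 0 := by
  exact MulChar.map_nonunit _ not_isUnit_zero

lemma chi_ne_one {ψ : RG p →* ℂˣ} (h : ψ ≠ 1) : chi ψ ≠ 1 := by
  intro h3
  apply h
  ext α
  obtain ⟨a, rfl⟩ := rgmk_surj p α
  rw [← chi_coe, h3, MulChar.one_apply_coe]; rfl

lemma chi_even (ψ : RG p →* ℂˣ) : (chi ψ).Even := by
  have : rgmk p (-1) = 1 := by
    rw [← map_one (rgmk p), rgmk_eq]; right; rfl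
  have h3 := chi_coe ψ (-1)
  rw [this] at h3
  simpa [DirichletCharacter.Even] using h3

lemma euler_local (D : RC p F) (h2 : p ≠ 2) (ℓ : ℕ) (hl : ℓ.Prime) (s : ℂ) [Fintype (RG p →* ℂˣ)] [DecidableEq (RG p →* ℂˣ)] :
    ∏ P ∈ IsDedekindDomain.primesOverFinset (Ideal.span {(ℓ : ℤ)}) (𝓞 F), (1 - (Ideal.absNorm P : ℂ) ^ (-s))⁻¹ =
    (1 - (ℓ:ℂ)^(-s))⁻¹ * ∏ ψ ∈ Finset.univ.erase (1 : RG p →* ℂˣ), (1 - chi ψ (ℓ : ZMod p) * (ℓ:ℂ)^(-s))⁻¹ := by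
  have : Fact ℓ.Prime := ⟨hl⟩
  by_cases hlp : ℓ = p
  · subst hlp
    rw [D.primes_p h2 s, Finset.prod_eq_one, mul_one]
    intro ψ _
    rw [ZMod.natCast_self, chi_zero]; simp
  · rw [D.local_factor ℓ h2 hlp s, ← Finset.mul_prod_erase _ _ (Finset.mem_univ (1 : RG p →* ℂˣ))]
    congr 1
    · simp
    · refine Finset.prod_congr rfl fun ψ _ ↦ ?_
      rw [← chi_coe]; rfl

lemma zeta_factor (D : RC p F) (h2 : p ≠ 2) [Fintype (RG p →* ℂˣ)] [DecidableEq (RG p →* ℂˣ)] :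
    ∀ᶠ s : ℝ in 𝓝[>] 1, dedekindZeta F s = riemannZeta s * ∏ ψ ∈ Finset.univ.erase (1 : RG p →* ℂˣ), (chi ψ).LFunction s := by
  filter_upwards [dedekind_euler_product F, self_mem_nhdsWithin] with s hs h1
  have hs1 : 1 < (s:ℂ).re := by simpa using h1
  have e2 := (riemannZeta_eulerProduct hs1).mul (tendsto_finsetProd (Finset.univ.erase (1 : RG p →* ℂˣ))
    (fun ψ _ ↦ (chi ψ).LSeries_eulerProduct hs1))
  refine tendsto_nhds_unique hs ?_
  convert e2 using 2 with N
  · rw [Finset.prod_comm, ← Finset.prod_mul_distrib]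
    refine Finset.prod_congr rfl fun ℓ hl ↦ ?_
    exact D.euler_local h2 ℓ (Nat.prime_of_mem_primesBelow hl) s
  · congr 1
    refine Finset.prod_congr rfl fun ψ _ ↦ ?_
    rw [DirichletCharacter.LFunction_eq_LSeries _ hs1]

lemma residue_eq (D : RC p F) (h2 : p ≠ 2) [Fintype (RG p →* ℂˣ)] [DecidableEq (RG p →* ℂˣ)] :
    (dedekindZeta_residue F : ℂ) = ∏ ψ ∈ Finset.univ.erase (1 : RG p →* ℂˣ), (chi ψ).LFunction 1 := by
  have h := tendsto_sub_one_mul_dedekindZeta_nhdsGT F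
  have hc : Tendsto (fun s : ℝ ↦ (s:ℂ)) (𝓝[>] 1) (𝓝[≠] 1) := by
    refine tendsto_nhdsWithin_iff.mpr ⟨?_, ?_⟩
    · exact (Complex.continuous_ofReal.tendsto' 1 1 (by simp)).mono_left nhdsWithin_le_nhds
    · filter_upwards [self_mem_nhdsWithin] with s hs
      simp only [Set.mem_compl_iff, Set.mem_singleton_iff]
      exact_mod_cast (ne_of_gt hs)
  have hz := riemannZeta_residue_one.comp hc
  have hc' : Tendsto (fun s : ℝ ↦ (s:ℂ)) (𝓝[>] 1) (𝓝 1) := hc.mono_right nhdsWithin_le_nhds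
  have hL := tendsto_finsetProd (Finset.univ.erase (1 : RG p →* ℂˣ))
    (f := fun ψ (s:ℝ) ↦ (chi ψ).LFunction s) (x := 𝓝[>] 1) (a := fun ψ ↦ (chi ψ).LFunction 1) (by
      intro ψ hψ
      exact ((DirichletCharacter.differentiable_LFunction (chi_ne_one (Finset.ne_of_mem_erase hψ))).continuous.tendsto 1).comp hc')
  have hm := hz.mul hL
  rw [one_mul] at hm
  refine tendsto_nhds_unique h (hm.congr' ?_)
  filter_upwards [D.zeta_factor h2] with s hs
  rw [hs, Function.comp]; ring

/-- log of sine on the quotient -/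
noncomputable def lf (p : ℕ) [Fact p.Prime] (α : RG p) : ℝ :=
  Real.log ‖sn p ((Function.surjInv (rgmk_surj p) α : (ZMod p)ˣ) : ZMod p)‖

lemma sn_neg (j : ZMod p) : sn p (-j) = - sn p j := by simp [sn]

lemma lf_mk (u : (ZMod p)ˣ) : lf p (rgmk p u) = Real.log ‖sn p u‖ := by
  unfold lf
  have := Function.surjInv_eq (rgmk_surj p) (rgmk p u)
  rcases (rgmk_eq p _ _).mp this with h | h
  · rw [h]
  · rw [h, Units.val_neg, sn_neg, norm_neg]

lemma norm_sn (j : ZMod p) : ‖sn p j‖ = ‖1 - ZMod.stdAddChar (2 * j)‖ := by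
  have : sn p j = - ZMod.stdAddChar (-j) * (1 - ZMod.stdAddChar (2 * j)) := by
    rw [two_mul, AddChar.map_add_eq_mul, sn]
    linear_combination (-ZMod.stdAddChar j) * stdmul j
  rw [this, norm_mul, norm_neg, stdAddChar_norm, one_mul]

lemma two_ne (h2 : p ≠ 2) : (2:ZMod p) ≠ 0 := by
  intro h4
  have : ((2:ℕ):ZMod p) = 0 := by exact_mod_cast h4
  rw [ZMod.natCast_eq_zero_iff] at this
  exact h2 ((Nat.prime_dvd_prime_iff_eq hpf.out Nat.prime_two).mp this)

lemma L_one (h2 : p ≠ 2) {ψ : RG p →* ℂˣ} (h : ψ ≠ 1) :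
    √p * ‖(chi ψ).LFunction 1‖ = 2 * ‖∑ α, (ψ α : ℂ) * (lf p α : ℂ)‖ := by
  rw [sum_L_one (chi_ne_one h) (chi_even ψ)]
  have h3 := sum_units_rg h2 (fun α ↦ (ψ α : ℂ) * (lf p α : ℂ))
  have e2 : ∑ j, chi ψ j * (Real.log ‖1 - ZMod.stdAddChar j‖ : ℂ) =
     ∑ j, chi ψ (2 * j) * (Real.log ‖1 - ZMod.stdAddChar (2 * j)‖ : ℂ) := by
    refine (Fintype.sum_equiv (Equiv.mulLeft₀ (2:ZMod p) (two_ne h2)) _ _ ?_).symm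
    intro j; rfl
  have e4 : ∑ j, chi ψ j * (Real.log ‖1 - ZMod.stdAddChar j‖ : ℂ) = chi ψ 2 * (2 • ∑ α, (ψ α : ℂ) * (lf p α : ℂ)) := by
    rw [e2, ← h3, sum_zmod_units, mul_zero, chi_zero, zero_mul, zero_add, Finset.mul_sum]
    refine Finset.sum_congr rfl fun u _ ↦ ?_
    rw [map_mul, chi_coe, lf_mk, norm_sn]; ring
  rw [e4, norm_mul, show (2:ZMod p) = (Units.mk0 2 (two_ne h2) : (ZMod p)ˣ) from rfl,
    DirichletCharacter.unit_norm_eq_one, one_mul, nsmul_eq_mul, norm_mul]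
  simp

lemma sum_lf (h2 : p ≠ 2) : ∑ α, lf p α ≠ 0 := by
  have h := sum_units_rg h2 (lf p)
  have h3 : ∑ u : (ZMod p)ˣ, lf p (rgmk p u) = Real.log p := by
    have h4 := congrArg (fun z ↦ Real.log ‖z‖) (prod_sn (p := p) h2)
    simp only [norm_prod, Complex.norm_natCast] at h4
    rw [Real.log_prod (fun k hk ↦ norm_ne_zero_iff.mpr (sn_ne_zero h2 (Finset.ne_of_mem_erase hk)))] at h4
    rw [← h4]
    have h5 := sum_zmod_units (fun j : ZMod p ↦ Real.log ‖sn p j‖)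
    rw [← Finset.add_sum_erase _ _ (Finset.mem_univ (0 : ZMod p))] at h5
    rw [add_left_cancel h5]
    exact Finset.sum_congr rfl fun u _ ↦ lf_mk u
  intro h0
  rw [h0, h3, smul_zero] at h
  have := Real.log_pos (x := p) (by exact_mod_cast hpf.out.one_lt)
  linarith

lemma prod_lf (D : RC p F) (h2 : p ≠ 2) [Fintype (RG p →* ℂˣ)] [DecidableEq (RG p →* ℂˣ)] :
    2 ^ (Fintype.card (RG p) - 1) * ∏ ψ ∈ Finset.univ.erase (1 : RG p →* ℂˣ), ‖∑ α, (ψ α : ℂ) * (lf p α : ℂ)‖ =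
     √p ^ (Fintype.card (RG p) - 1) * |dedekindZeta_residue F| := by
  have h := congrArg norm (D.residue_eq h2)
  rw [Complex.norm_real, Real.norm_eq_abs] at h
  have hc : (Finset.univ.erase (1 : RG p →* ℂˣ)).card = Fintype.card (RG p) - 1 := by
    rw [Finset.card_erase_of_mem (Finset.mem_univ _), Finset.card_univ, card_dual]
  rw [h, norm_prod, ← hc, ← Finset.prod_const, ← Finset.prod_const, ← Finset.prod_mul_distrib, ← Finset.prod_mul_distrib]
  exact Finset.prod_congr rfl fun ψ hψ ↦ (L_one h2 (Finset.ne_of_mem_erase hψ)).symm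

end RC

end Part7

section Part8

open Filter Topology Complex NumberField

namespace RC
variable {p : ℕ} [hpf : Fact p.Prime] {F : Type*} [Field F] [NumberField F] (D : RC p F)

lemma hom_ext (h2 : p ≠ 2) {g h : F →+* ℂ} (H : ∀ β, g (D.bA β) = h (D.bA β)) : g = h := by
  have : g.comp (algebraMap (𝓞 F) F) = h.comp (algebraMap (𝓞 F) F) := by
    ext x
    have e1 := congrArg (g.comp (algebraMap (𝓞 F) F)) (D.p_mul h2 x)
    have e2 := congrArg (h.comp (algebraMap (𝓞 F) F)) (D.p_mul h2 x)
    have H' : ∀ β, (g.comp (algebraMap (𝓞 F) F)) (D.bA β) = (h.comp (algebraMap (𝓞 F) F)) (D.bA β) := H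
    simp only [map_add, map_mul, map_sum, map_natCast, map_intCast, map_ofNat, H'] at e1 e2
    rw [← e2] at e1
    exact mul_left_cancel₀ (by exact_mod_cast hpf.out.ne_zero) e1
  exact IsLocalization.ringHom_ext (nonZeroDivisors (𝓞 F)) this

lemma isReal (h2 : p ≠ 2) (α : RG p) : ComplexEmbedding.IsReal (D.φ α) := by
  rw [ComplexEmbedding.isReal_iff]
  apply D.hom_ext h2
  intro β
  obtain ⟨a, rfl⟩ := rgmk_surj p α
  obtain ⟨b, rfl⟩ := rgmk_surj p β
  rw [ComplexEmbedding.conjugate_coe_eq, bA_mk, D.hφ, map_add, ← AddChar.map_neg_eq_conj, ← AddChar.map_neg_eq_conj, neg_neg, add_comm]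

lemma isTotallyReal (D : RC p F) (h2 : p ≠ 2) : IsTotallyReal F := by
  constructor
  intro v
  rw [← InfinitePlace.mk_embedding v, InfinitePlace.isReal_iff]
  obtain ⟨α, hα⟩ := D.φ.surjective v.embedding
  rw [← hα]
  have := D.isReal h2 α
  rwa [InfinitePlace.embedding_mk_eq_of_isReal this]

/-- places -/
noncomputable def pl (h2 : p ≠ 2) : RG p ≃ InfinitePlace F :=
  Equiv.ofBijective (fun α ↦ InfinitePlace.mk (D.φ α)) (by
    constructor
    · intro α β h
      rw [InfinitePlace.mk_eq_iff, ComplexEmbedding.isReal_iff.mp (D.isReal h2 α), or_self] at h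
      exact D.φ.injective h
    · intro v
      obtain ⟨α, hα⟩ := D.φ.surjective v.embedding
      exact ⟨α, by simp [hα]⟩)

lemma pl_apply (h2 : p ≠ 2) (α : RG p) (x : 𝓞 F) : D.pl h2 α (x : F) = ‖D.embA α x‖ := rfl

lemma torsion_eq (D : RC p F) (h2 : p ≠ 2) (x : (𝓞 F)ˣ) (hx : x ∈ Units.torsion F) : x = 1 ∨ x = -1 := by
  rw [Units.mem_torsion] at hx
  have h := hx (D.pl h2 1)
  rw [pl_apply] at h
  have hr := (ComplexEmbedding.IsReal.coe_embedding_apply (D.isReal h2 1) ((x : 𝓞 F) : F))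
  have hr' : D.embA 1 x = ((ComplexEmbedding.IsReal.embedding (D.isReal h2 1) ((x : 𝓞 F) : F) : ℝ) : ℂ) := hr.symm
  rw [hr', Complex.norm_real, Real.norm_eq_abs] at h
  have hinj : Function.Injective (D.embA 1) := by
    have := D.emb_inj 1
    rwa [← embA_mk, map_one] at this
  rcases eq_or_eq_neg_of_abs_eq h with h | h
  · left
    apply Units.ext
    apply hinj
    rw [hr', h]; simp
  · right
    apply Units.ext
    apply hinj
    rw [hr', h]; simp

lemma torsionOrder_eq (D : RC p F) (h2 : p ≠ 2) : Units.torsionOrder F = 2 := by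
  classical
  rw [Units.torsionOrder]
  have : (Units.torsion F : Set (𝓞 F)ˣ) = {1, -1} := by
    ext x
    constructor
    · intro h; simpa using D.torsion_eq h2 x h
    · rintro (rfl | rfl)
      · exact one_mem _
      · rw [SetLike.mem_coe, Units.torsion, CommGroup.mem_torsion, isOfFinOrder_iff_pow_eq_one]
        exact ⟨2, by norm_num, by simp⟩
  change Nat.card (Units.torsion F : Set (𝓞 F)ˣ) = 2
  rw [this, Nat.card_coe_set_eq, Set.ncard_pair]
  intro h
  have h3 : (1 : 𝓞 F) = -1 := congrArg Units.val h
  have h4 : (1 : 𝓞 F) ≠ 0 := one_ne_zero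
  have : (2 : 𝓞 F) * 1 = 0 := by linear_combination h3
  simp at this

lemma residue_val (D : RC p F) (h2 : p ≠ 2) :
    dedekindZeta_residue F = 2 ^ (Fintype.card (RG p) - 1) * Units.regulator F * classNumber F / √|(discr F : ℝ)| := by
  have := D.isTotallyReal h2
  have h1 : InfinitePlace.nrComplexPlaces F = 0 := IsTotallyReal.nrComplexPlaces_eq_zero F
  have h3 : InfinitePlace.nrRealPlaces F = Fintype.card (RG p) := by
    rw [← IsTotallyReal.finrank, D.finrank_eq]
  rw [dedekindZeta_residue_def, h1, h3, D.torsionOrder_eq h2, pow_zero, mul_one]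
  have : Fintype.card (RG p) = Fintype.card (RG p) - 1 + 1 := (Nat.sub_add_cancel Fintype.card_pos).symm
  have e : (2:ℝ)^(Fintype.card (RG p)) = 2 ^ (Fintype.card (RG p) - 1) * 2 := by
    conv_lhs => rw [this]
    rw [pow_succ]
  have hd : √|(discr F : ℝ)| ≠ 0 := by
    rw [Real.sqrt_ne_zero']
    exact abs_pos.mpr (by exact_mod_cast discr_ne_zero F)
  rw [e]
  push_cast
  field_simp

/-- cyclotomic units -/
noncomputable def uA (h2 : p ≠ 2) (α : RG p) : (𝓞 F)ˣ :=
  (D.c_isUnit h2 1 one_ne_zero ((Function.surjInv (rgmk_surj p) α : (ZMod p)ˣ) : ZMod p).val (by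
    rw [ZMod.natCast_zmod_val]; exact Units.ne_zero _)).unit

lemma log_uA (h2 : p ≠ 2) (α β : RG p) : Real.log ‖D.embA β (D.uA h2 α)‖ = lf p (α * β) - lf p β := by
  obtain ⟨b, rfl⟩ := rgmk_surj p β
  set a := Function.surjInv (rgmk_surj p) α with ha
  have hα : α = rgmk p a := (Function.surjInv_eq (rgmk_surj p) α).symm
  have hv : ((D.uA h2 α : (𝓞 F)ˣ) : 𝓞 F) = D.c 1 (a : ZMod p).val := rfl
  rw [hv, embA_mk]
  have h := D.emb_c b 1 (a : ZMod p).val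
  rw [mul_one, mul_one, ZMod.natCast_zmod_val, ← Units.val_mul] at h
  have h3 := congrArg (fun z ↦ Real.log ‖z‖) h
  simp only [norm_mul] at h3
  have hb : sn p (b:ZMod p) ≠ 0 := sn_ne_zero h2 b.ne_zero
  have hc : D.emb b (D.c 1 (a : ZMod p).val) ≠ 0 := by
    intro h0; rw [h0, zero_mul] at h
    exact sn_ne_zero h2 (Units.ne_zero _) h.symm
  rw [Real.log_mul (norm_ne_zero_iff.mpr hc) (norm_ne_zero_iff.mpr hb), ← lf_mk, ← lf_mk] at h3
  rw [hα, mul_comm, ← map_mul]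
  linarith

lemma index_eq (h2 : p ≠ 2) : ∃ m : ℕ, m ≠ 0 ∧
    (Subgroup.closure (D.uA h2 '' {1}ᶜ) ⊔ Units.torsion F).index = classNumber F * m := by
  classical
  let _ : Fintype (RG p →* ℂˣ) := Fintype.ofFinite _
  have := D.isTotallyReal h2
  let w' := D.pl h2 1
  have hcard : Fintype.card {w // w ≠ w'} = Fintype.card (Fin (Units.rank F)) := by
    rw [Fintype.card_subtype_compl, Fintype.card_subtype_eq, Fintype.card_fin, Units.rank]
  let e := Fintype.equivOfCardEq hcard
  let u : Fin (Units.rank F) → (𝓞 F)ˣ := fun i ↦ D.uA h2 ((D.pl h2).symm (e.symm i))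
  have hrange : Set.range u = D.uA h2 '' {1}ᶜ := by
    ext x
    constructor
    · rintro ⟨i, rfl⟩
      refine ⟨_, ?_, rfl⟩
      intro h
      apply (e.symm i).2
      rw [Set.mem_singleton_iff, Equiv.symm_apply_eq] at h
      exact h
    · rintro ⟨α, hα, rfl⟩
      refine ⟨e ⟨D.pl h2 α, fun h ↦ hα ((D.pl h2).injective h)⟩, ?_⟩
      simp [u]
  have hreg := Units.finrank_mul_regOfFamily_eq_det u w' e
  have hmat : (Matrix.of fun (i w : InfinitePlace F) =>
          if h : i = w' then (w.mult:ℝ) else ↑w.mult * Real.log (w ((algebraMap (𝓞 F) F) ↑(u (e ⟨i, h⟩))))).det =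
      (Matrix.of fun a b : RG p ↦ if a = 1 then 1 else lf p (a*b) - lf p b).det := by
    rw [← Matrix.det_submatrix_equiv_self (D.pl h2)]
    congr 1
    ext α β
    simp only [Matrix.submatrix_apply, Matrix.of_apply, IsTotallyReal.mult_eq, Nat.cast_one, one_mul]
    by_cases h : α = 1
    · simp [h, w']
    · have h' : D.pl h2 α ≠ w' := fun h0 ↦ h ((D.pl h2).injective h0)
      rw [dif_neg h', if_neg h]
      simp only [u, Equiv.symm_apply_apply]
      rw [← D.log_uA h2]; rfl
  rw [hmat, abs_reduced_group_det _ (sum_lf h2), D.finrank_eq] at hreg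
  have hn0 : ((Fintype.card (RG p) : ℕ) : ℝ) ≠ 0 := by exact_mod_cast Fintype.card_pos.ne'
  have hreg' := mul_left_cancel₀ hn0 hreg
  have hP := D.prod_lf h2
  rw [← hreg', D.residue_val h2] at hP
  obtain ⟨m, hm⟩ := D.discr_rel h2
  have hsq : |(m:ℝ)| * √|(discr F:ℝ)| = √p ^ (Fintype.card (RG p) - 1) := by
    have h3 : ((m:ℝ)^2 * |(discr F:ℝ)|) = (p:ℝ)^(Fintype.card (RG p) - 1) := by
      have := congrArg (fun z : ℤ ↦ |(z:ℝ)|) hm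
      simpa [abs_mul, abs_pow] using this
    have h4 := congrArg Real.sqrt h3
    rw [Real.sqrt_mul (sq_nonneg _), Real.sqrt_sq_eq_abs] at h4
    rw [h4, Real.sqrt_eq_iff_mul_self_eq (by positivity) (by positivity), ← mul_pow, Real.mul_self_sqrt (by positivity)]
  have hR := Units.regulator_pos F
  have hd : √|(discr F : ℝ)| ≠ 0 := by
    rw [Real.sqrt_ne_zero']
    exact abs_pos.mpr (by exact_mod_cast discr_ne_zero F)
  have hi := Units.regOfFamily_div_regulator u
  rw [hrange] at hi
  have hm0 : m ≠ 0 := by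
    rintro rfl
    have hpz : (p:ℤ) ≠ 0 := by exact_mod_cast hpf.out.ne_zero
    exact pow_ne_zero _ hpz (by rw [← hm]; simp)
  refine ⟨m.natAbs, by simpa using hm0, ?_⟩
  have key : Units.regOfFamily u = classNumber F * |(m:ℝ)| * Units.regulator F := by
    rw [← hsq, abs_of_nonneg (a := 2 ^ (Fintype.card (RG p) - 1) * Units.regulator F * (classNumber F : ℝ) / √|(discr F : ℝ)|) (by positivity)] at hP
    have h2p : (2:ℝ) ^ (Fintype.card (RG p) - 1) ≠ 0 := by positivity
    apply mul_left_cancel₀ h2p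
    rw [hP]
    field_simp
  rw [key, mul_div_cancel_right₀ _ hR.ne'] at hi
  have : (|(m:ℝ)|) = (m.natAbs : ℝ) := by rw [Nat.cast_natAbs]; simp
  rw [this] at hi
  exact_mod_cast hi.symm

end RC

end Part8

section Part9

open Filter Topology Complex NumberField

instance isAlgQbar : Algebra.IsAlgebraic ℚ (AlgebraicClosure ℚ) := by
  have h := AlgebraicClosure.isAlgebraic ℚ
  have e : (DivisionRing.toRatAlgebra : Algebra ℚ (AlgebraicClosure ℚ)) = AlgebraicClosure.instAlgebra ℚ :=
    Subsingleton.elim _ _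
  rw [e]
  exact h

section
variable {p : ℕ} [hpf : Fact p.Prime] {ζ : AlgebraicClosure ℚ}

lemma isIntegral_eta (hζ : IsPrimitiveRoot ζ p) : IsIntegral ℤ (ζ + ζ⁻¹) := by
  exact (hζ.isIntegral hpf.out.pos).add (hζ.inv.isIntegral hpf.out.pos)

noncomputable abbrev RF (ζ : AlgebraicClosure ℚ) : IntermediateField ℚ (AlgebraicClosure ℚ) := IntermediateField.adjoin ℚ {ζ + ζ⁻¹}

lemma RF_numberField (hζ : IsPrimitiveRoot ζ p) : NumberField (RF ζ) := by
  have : FiniteDimensional ℚ (RF ζ) := IntermediateField.adjoin.finiteDimensional (isIntegral_eta hζ).tower_top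
  exact { }

/-- the generator as an integer -/
noncomputable def etaI (hζ : IsPrimitiveRoot ζ p) : 𝓞 (RF ζ) :=
  ⟨⟨ζ + ζ⁻¹, IntermediateField.mem_adjoin_simple_self ℚ _⟩, by
    have := isIntegral_eta hζ
    exact (isIntegral_algHom_iff ((RF ζ).val.restrictScalars ℤ) (RF ζ).val.injective).mp this⟩

lemma std_pow (a : ZMod p) (v : ℕ) : (ZMod.stdAddChar a : ℂ) ^ v = ZMod.stdAddChar (a * (v : ZMod p)) := by
  rw [← AddChar.map_nsmul_eq_pow, nsmul_eq_mul, mul_comm]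

lemma std_inv (a : ZMod p) : (ZMod.stdAddChar a : ℂ)⁻¹ = ZMod.stdAddChar (-a) := by
  rw [AddChar.map_neg_eq_inv]

lemma std_prim {a : ZMod p} (ha : a ≠ 0) : IsPrimitiveRoot (ZMod.stdAddChar a : ℂ) p := by
  have h : orderOf (ZMod.stdAddChar a : ℂ) = p := by
    apply orderOf_eq_prime
    · rw [std_pow]; simp
    · intro h
      apply ha
      apply ZMod.injective_stdAddChar
      rw [h]; simp
  have := IsPrimitiveRoot.orderOf (ZMod.stdAddChar a : ℂ)
  rwa [h] at this

lemma exists_emb (hζ : IsPrimitiveRoot ζ p) (a : (ZMod p)ˣ) :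
    ∃ σ : AlgebraicClosure ℚ →ₐ[ℚ] ℂ, σ ζ = ZMod.stdAddChar (a : ZMod p) := by
  apply IntermediateField.exists_algHom_of_splits_of_aeval
  · intro s
    exact ⟨Algebra.IsIntegral.isIntegral s, IsAlgClosed.splits _⟩
  · have h1 := Polynomial.cyclotomic_eq_minpoly_rat hζ hpf.out.pos
    rw [← h1, Polynomial.aeval_def, ← Polynomial.eval_map, Polynomial.map_cyclotomic]
    exact (std_prim a.ne_zero).isRoot_cyclotomic hpf.out.pos

noncomputable def sig (hζ : IsPrimitiveRoot ζ p) (a : (ZMod p)ˣ) : AlgebraicClosure ℚ →ₐ[ℚ] ℂ := (exists_emb hζ a).choose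

lemma sig_zeta (hζ : IsPrimitiveRoot ζ p) (a : (ZMod p)ˣ) : sig hζ a ζ = ZMod.stdAddChar (a : ZMod p) :=
  (exists_emb hζ a).choose_spec

noncomputable def bI (hζ : IsPrimitiveRoot ζ p) (j : ZMod p) : 𝓞 (RF ζ) :=
  (Polynomial.dickson 1 (1 : 𝓞 (RF ζ)) j.val).eval (etaI hζ)

lemma bI_coe (hζ : IsPrimitiveRoot ζ p) (j : ZMod p) :
    ((bI hζ j : RF ζ) : AlgebraicClosure ℚ) = ζ ^ j.val + ζ⁻¹ ^ j.val := by
  have h : ∀ x : 𝓞 (RF ζ), ((x : RF ζ) : AlgebraicClosure ℚ) =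
    ((algebraMap (RF ζ) (AlgebraicClosure ℚ)).comp (algebraMap (𝓞 (RF ζ)) (RF ζ))) x := fun x ↦ rfl
  rw [h, bI, ← Polynomial.eval₂_at_apply, ← Polynomial.eval_map, Polynomial.map_dickson, map_one, ← h,
    ← Polynomial.dickson_one_one_eval_add_inv ζ ζ⁻¹ (mul_inv_cancel₀ (hζ.ne_zero hpf.out.ne_zero))]
  rfl

lemma sig_bI (hζ : IsPrimitiveRoot ζ p) (σ : AlgebraicClosure ℚ →+* ℂ) (a j : ZMod p) (hσ : σ ζ = ZMod.stdAddChar a) :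
    σ ((bI hζ j : RF ζ) : AlgebraicClosure ℚ) = ZMod.stdAddChar (a * j) + ZMod.stdAddChar (-(a * j)) := by
  rw [bI_coe, map_add, map_pow, map_pow, map_inv₀, hσ, std_inv, std_pow, std_pow, ZMod.natCast_zmod_val, neg_mul]

noncomputable def ph (hζ : IsPrimitiveRoot ζ p) (α : RG p) : RF ζ →+* ℂ :=
  ((sig hζ (Function.surjInv (rgmk_surj p) α)) : AlgebraicClosure ℚ →+* ℂ).comp (algebraMap (RF ζ) (AlgebraicClosure ℚ))

lemma ph_bI (hζ : IsPrimitiveRoot ζ p) (a : (ZMod p)ˣ) (j : ZMod p) :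
    ph hζ (rgmk p a) (bI hζ j) = ZMod.stdAddChar ((a : ZMod p) * j) + ZMod.stdAddChar (-((a : ZMod p) * j)) := by
  have h3 := sig_bI hζ (sig hζ (Function.surjInv (rgmk_surj p) (rgmk p a)) : AlgebraicClosure ℚ →+* ℂ) _ j (sig_zeta hζ _)
  refine Eq.trans h3 ?_
  have := Function.surjInv_eq (rgmk_surj p) (rgmk p a)
  rcases (rgmk_eq p _ _).mp this with h | h
  · rw [h]
  · rw [h, Units.val_neg, neg_mul, neg_neg, add_comm]

lemma bI_one (hζ : IsPrimitiveRoot ζ p) : ((bI hζ 1 : RF ζ)) = ⟨ζ + ζ⁻¹, IntermediateField.mem_adjoin_simple_self ℚ _⟩ := by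
  apply Subtype.ext
  have : Fact (1 < p) := ⟨hpf.out.one_lt⟩
  rw [bI_coe, ZMod.val_one]; simp

lemma ph_ext (hζ : IsPrimitiveRoot ζ p) (g h : RF ζ →+* ℂ) (H : g (bI hζ 1) = h (bI hζ 1)) : g = h := by
  rw [bI_one] at H
  have : g.toRatAlgHom = h.toRatAlgHom := by
    apply IntermediateField.algHom_ext_of_eq_adjoin ℚ (S := RF ζ) (s := {ζ + ζ⁻¹}) rfl
    intro x hx
    rw [Set.mem_singleton_iff] at hx
    subst hx
    exact H
  ext x
  exact congrArg (fun f ↦ f x) this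

lemma exists_std (z : ℂ) (hz : IsPrimitiveRoot z p) : ∃ a : (ZMod p)ˣ, z = ZMod.stdAddChar (a : ZMod p) := by
  obtain ⟨i, hi, h⟩ := (std_prim (p := p) one_ne_zero).eq_pow_of_pow_eq_one hz.pow_eq_one
  rw [std_pow, one_mul] at h
  refine ⟨Units.mk0 (i : ZMod p) ?_, h.symm⟩
  intro h0
  rw [h0, AddChar.map_zero_eq_one] at h
  exact hz.ne_one hpf.out.one_lt h.symm

lemma ph_bij (hζ : IsPrimitiveRoot ζ p) : Function.Bijective (ph hζ) := by
  constructor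
  · intro α β h
    obtain ⟨a, rfl⟩ := rgmk_surj p α
    obtain ⟨b, rfl⟩ := rgmk_surj p β
    have h1 := ph_bI hζ a 1
    rw [h, ph_bI, mul_one, mul_one] at h1
    have e1 := RC.stdmul (p := p) (a : ZMod p)
    have e2 := RC.stdmul (p := p) (b : ZMod p)
    have : ((ZMod.stdAddChar (a:ZMod p) : ℂ) - ZMod.stdAddChar (b:ZMod p)) * (ZMod.stdAddChar (a:ZMod p) - ZMod.stdAddChar (-(b:ZMod p))) = 0 := by
      linear_combination (-(ZMod.stdAddChar (a:ZMod p) : ℂ)) * h1 + e2 - e1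
    rw [rgmk_eq]
    rcases mul_eq_zero.mp this with h4 | h4
    · left; exact Units.ext (ZMod.injective_stdAddChar (sub_eq_zero.mp h4))
    · right; exact Units.ext (by rw [Units.val_neg]; exact (ZMod.injective_stdAddChar (sub_eq_zero.mp h4)))
  · intro g
    let _ : Algebra (RF ζ) ℂ := g.toAlgebra
    have : Algebra.IsAlgebraic (RF ζ) (AlgebraicClosure ℚ) := Algebra.IsAlgebraic.tower_top (K := ℚ) _
    have G : AlgebraicClosure ℚ →ₐ[RF ζ] ℂ := IsAlgClosed.lift
    have hG : IsPrimitiveRoot (G ζ) p := hζ.map_of_injective G.injective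
    obtain ⟨a, ha⟩ := exists_std _ hG
    refine ⟨rgmk p a, ph_ext hζ _ _ ?_⟩
    rw [ph_bI, ← sig_bI hζ (G : AlgebraicClosure ℚ →+* ℂ) (a : ZMod p) 1 ha]
    exact G.commutes _

lemma exists_RC (hζ : IsPrimitiveRoot ζ p) [NumberField (RF ζ)] : ∃ D : RC p (RF ζ), ∀ j, D.b j = bI hζ j :=
  ⟨{ b := bI hζ, φ := Equiv.ofBijective _ (ph_bij hζ), hφ := fun a j ↦ ph_bI hζ a j }, fun _ ↦ rfl⟩

/-- sine in the algebraic closure -/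
noncomputable def sqn (ζ : AlgebraicClosure ℚ) (k : ℕ) : AlgebraicClosure ℚ := ζ ^ k - ζ⁻¹ ^ k

lemma c_coe (hζ : IsPrimitiveRoot ζ p) [NumberField (RF ζ)] (D : RC p (RF ζ)) (hD : ∀ j, D.b j = bI hζ j) (k : ℕ) :
    ((D.c 1 k : RF ζ) : AlgebraicClosure ℚ) * sqn ζ 1 = sqn ζ k := by
  have h0 : ζ * ζ⁻¹ = 1 := mul_inv_cancel₀ (hζ.ne_zero hpf.out.ne_zero)
  induction k using Nat.twoStepInduction with
  | zero => simp [RC.c, sqn]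
  | one => simp [RC.c]
  | more k h1 h2 =>
    rw [RC.c, hD]
    have : (((bI hζ 1 * D.c 1 (k+1) - D.c 1 k : 𝓞 (RF ζ)) : RF ζ) : AlgebraicClosure ℚ) =
      (ζ + ζ⁻¹) * ((D.c 1 (k+1) : RF ζ) : AlgebraicClosure ℚ) - ((D.c 1 k : RF ζ) : AlgebraicClosure ℚ) := by
      have hh : ((bI hζ 1 : RF ζ) : AlgebraicClosure ℚ) = ζ + ζ⁻¹ := by rw [bI_one]
      rw [← hh]; rfl
    rw [this, sub_mul, mul_assoc, h1, h2]
    simp only [sqn]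
    linear_combination (ζ^k - ζ⁻¹^k) * h0
end

end Part9

section Part10

open Filter Topology Complex NumberField

namespace RC
variable {p : ℕ} [hpf : Fact p.Prime] {F : Type*} [Field F] [NumberField F] (D : RC p F)

lemma mem_clos (h2 : p ≠ 2) (x : (𝓞 F)ˣ) (hx : x ∈ Subgroup.closure (D.uA h2 '' {1}ᶜ)) :
    ∃ e : RG p → ℤ, x = ∏ α ∈ Finset.univ.erase 1, D.uA h2 α ^ e α := by
  classical
  induction hx using Subgroup.closure_induction with
  | mem x hx =>
    obtain ⟨α, hα, rfl⟩ := hx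
    refine ⟨fun β ↦ if β = α then 1 else 0, ?_⟩
    rw [Finset.prod_eq_single α]
    · simp
    · intro β _ h; simp [h]
    · intro h; simp at h; exact absurd h hα
  | one => exact ⟨0, by simp⟩
  | mul x y _ _ hx hy =>
    obtain ⟨e, rfl⟩ := hx
    obtain ⟨f, rfl⟩ := hy
    refine ⟨e + f, ?_⟩
    rw [← Finset.prod_mul_distrib]
    exact Finset.prod_congr rfl fun α _ ↦ (zpow_add _ _ _).symm
  | inv x _ hx =>
    obtain ⟨e, rfl⟩ := hx
    refine ⟨-e, ?_⟩
    rw [← Finset.prod_inv_distrib]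
    exact Finset.prod_congr rfl fun α _ ↦ (zpow_neg _ _).symm

lemma exists_rel (h2 : p ≠ 2) (hV : p ∣ classNumber F) :
    ∃ v t : (𝓞 F)ˣ, ∃ e : RG p → ℤ, ∃ α₀ : RG p, α₀ ≠ 1 ∧ ¬ (p:ℤ) ∣ e α₀ ∧ (t = 1 ∨ t = -1) ∧
      v ^ p = t * ∏ α ∈ Finset.univ.erase 1, D.uA h2 α ^ e α := by
  classical
  obtain ⟨m, hm, hi⟩ := D.index_eq h2
  set G := Subgroup.closure (D.uA h2 '' {1}ᶜ) ⊔ Units.torsion F with hG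
  have hi0 : G.index ≠ 0 := by
    rw [hi]; exact mul_ne_zero (Fintype.card_ne_zero) hm
  have hfin : Finite ((𝓞 F)ˣ ⧸ G) := by
    have : G.FiniteIndex := ⟨hi0⟩
    exact Subgroup.finite_quotient_of_finiteIndex
  have hdvd : p ∣ Nat.card ((𝓞 F)ˣ ⧸ G) := by
    change p ∣ G.index
    rw [hi]; exact hV.mul_right _
  obtain ⟨q, hq⟩ := exists_prime_orderOf_dvd_card' p hdvd
  obtain ⟨v, rfl⟩ := QuotientGroup.mk_surjective q
  have hv1 : v ∉ G := by
    intro h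
    rw [(QuotientGroup.eq_one_iff v).mpr h, orderOf_one] at hq
    exact hpf.out.one_lt.ne hq
  have hv2 : v ^ p ∈ G := by
    rw [← QuotientGroup.eq_one_iff, QuotientGroup.mk_pow, ← orderOf_dvd_iff_pow_eq_one, hq]
  obtain ⟨c, hc, t, ht, hct⟩ := Subgroup.mem_sup.mp hv2
  obtain ⟨e, rfl⟩ := D.mem_clos h2 c hc
  by_contra hcon
  push Not at hcon
  have hall : ∀ α : RG p, α ≠ 1 → (p:ℤ) ∣ e α := by
    intro α hα
    by_contra hd
    exact hcon v t e α hα hd (D.torsion_eq h2 t ht) (by rw [← hct, mul_comm])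
  choose! f hf using hall
  set w : (𝓞 F)ˣ := ∏ α ∈ Finset.univ.erase 1, D.uA h2 α ^ f α with hw
  have hwp : w ^ p = ∏ α ∈ Finset.univ.erase 1, D.uA h2 α ^ e α := by
    rw [hw, ← Finset.prod_pow]
    refine Finset.prod_congr rfl fun α hα ↦ ?_
    rw [hf α (Finset.ne_of_mem_erase hα), mul_comm, zpow_mul, zpow_natCast]
  have hwG : w ∈ Subgroup.closure (D.uA h2 '' {1}ᶜ) := by
    refine Subgroup.prod_mem _ fun α hα ↦ Subgroup.zpow_mem _ (Subgroup.subset_closure ?_) _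
    exact ⟨α, Finset.ne_of_mem_erase hα, rfl⟩
  have ht' : (v * w⁻¹) ^ p = t := by
    rw [mul_pow, inv_pow, hwp, ← hct, mul_inv_cancel_comm]
  have htor : v * w⁻¹ ∈ Units.torsion F := by
    rw [← ht', Units.torsion, CommGroup.mem_torsion] at ht
    rw [Units.torsion, CommGroup.mem_torsion]
    exact (isOfFinOrder_pow.mp ht).resolve_right hpf.out.ne_zero
  apply hv1
  have : v = w * (v * w⁻¹) := by rw [← mul_assoc, mul_inv_cancel_comm]
  rw [this]
  exact Subgroup.mul_mem_sup hwG htor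

end RC

/-- degree bound -/
lemma finrank_adjoin_le {K Ω : Type*} [Field K] [Field Ω] [Algebra K Ω] (p : ℕ) (hp : 0 < p) {ι : Type*}
    (s : Finset ι) (r : ι → Ω) (hr : ∀ i ∈ s, ∃ y : K, r i ^ p = algebraMap K Ω y) :
    FiniteDimensional K (IntermediateField.adjoin K (r '' s)) ∧
    Module.finrank K (IntermediateField.adjoin K (r '' s)) ≤ p ^ s.card := by
  classical
  induction s using Finset.induction_on with
  | empty =>
    have e : r '' ((∅ : Finset ι) : Set ι) = ∅ := by simp
    rw [e, IntermediateField.adjoin_empty]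
    exact ⟨inferInstance, by simp⟩
  | insert a s ha ih =>
    obtain ⟨ih1, ih2⟩ := ih fun i hi ↦ hr i (Finset.mem_insert_of_mem hi)
    obtain ⟨y, hy⟩ := hr a (Finset.mem_insert_self _ _)
    have hmon : (Polynomial.X ^ p - Polynomial.C y : Polynomial K).Monic := Polynomial.monic_X_pow_sub_C y hp.ne'
    have hroot : Polynomial.aeval (r a) (Polynomial.X ^ p - Polynomial.C y : Polynomial K) = 0 := by
      simp [hy]
    have hintg : IsIntegral K (r a) := ⟨_, hmon, hroot⟩
    have h1 : FiniteDimensional K (IntermediateField.adjoin K {r a}) := IntermediateField.adjoin.finiteDimensional hintg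
    have h3 : Module.finrank K (IntermediateField.adjoin K {r a}) ≤ p := by
      rw [IntermediateField.adjoin.finrank hintg]
      have := Polynomial.natDegree_le_of_dvd (minpoly.dvd K (r a) hroot) hmon.ne_zero
      rwa [Polynomial.natDegree_X_pow_sub_C] at this
    have e : IntermediateField.adjoin K (r '' (insert a s : Finset ι)) =
        IntermediateField.adjoin K {r a} ⊔ IntermediateField.adjoin K (r '' s) := by
      rw [← IntermediateField.adjoin_union, Finset.coe_insert, Set.image_insert_eq, Set.insert_eq]
    rw [e]
    refine ⟨IntermediateField.finiteDimensional_sup _ _, ?_⟩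
    rw [Finset.card_insert_of_notMem ha, pow_succ, mul_comm]
    exact (IntermediateField.finrank_sup_le _ _).trans (Nat.mul_le_mul h3 ih2)

end Part10

section Part11

open Filter Topology Complex NumberField

/-- elements of `Ωˣ` having a `p`-th root in `M` -/
def rootGp {K Ω : Type*} [Field K] [Field Ω] [Algebra K Ω] (p : ℕ) (M : IntermediateField K Ω) : Subgroup Ωˣ where
  carrier := {x | ∃ r ∈ M, r ^ p = x}
  one_mem' := ⟨1, M.one_mem, by simp⟩
  mul_mem' := by
    rintro x y ⟨r, hr, h⟩ ⟨s, hs, h'⟩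
    exact ⟨r * s, M.mul_mem hr hs, by rw [mul_pow, h, h']; simp⟩
  inv_mem' := by
    rintro x ⟨r, hr, h⟩
    exact ⟨r⁻¹, M.inv_mem hr, by rw [inv_pow, h]; simp⟩

section
variable {p : ℕ} [hpf : Fact p.Prime] {ζ : AlgebraicClosure ℚ}

/-- the map from units to the algebraic closure -/
noncomputable def ucoe (ζ : AlgebraicClosure ℚ) : (𝓞 (RF ζ))ˣ →* (AlgebraicClosure ℚ)ˣ :=
  Units.map ((algebraMap (RF ζ) (AlgebraicClosure ℚ)).comp (algebraMap (𝓞 (RF ζ)) (RF ζ))).toMonoidHom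

lemma ucoe_val (x : (𝓞 (RF ζ))ˣ) : (ucoe ζ x : AlgebraicClosure ℚ) = (((x : 𝓞 (RF ζ)) : RF ζ) : AlgebraicClosure ℚ) := rfl

lemma final_bound (h2 : p ≠ 2) (hζ : IsPrimitiveRoot ζ p)
    (hV : p ∣ Nat.card (ClassGroup (𝓞 (RF ζ))))
    (K : IntermediateField ℚ (AlgebraicClosure ℚ))
    (hK : K = IntermediateField.adjoin ℚ {ζ}) :
    Module.finrank K (IntermediateField.adjoin K {x : AlgebraicClosure ℚ | 1 - (1 - x ^ p) ^ p = 0}) ≤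
      p ^ (Fintype.card (RG p)) := by
  classical
  have hNF := RF_numberField hζ
  have hV' : p ∣ classNumber (RF ζ) := by
    rwa [classNumber, ← Nat.card_eq_fintype_card]
  obtain ⟨D, hD⟩ := exists_RC hζ
  obtain ⟨v, t, e, α₀, hα₀, hd, ht, hv⟩ := D.exists_rel h2 hV'
  have hp0 : p ≠ 0 := hpf.out.ne_zero
  have hζ0 : ζ ≠ 0 := hζ.ne_zero hp0
  have hζK : ζ ∈ K := by rw [hK]; exact IntermediateField.mem_adjoin_simple_self ℚ ζ
  have hFK : RF ζ ≤ K := by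
    rw [RF, IntermediateField.adjoin_simple_le_iff]
    exact K.add_mem hζK (K.inv_mem hζK)
  let U : RG p → (AlgebraicClosure ℚ)ˣ := fun α ↦ ucoe ζ (D.uA h2 α)
  have huK : ∀ x : (𝓞 (RF ζ))ˣ, (ucoe ζ x : AlgebraicClosure ℚ) ∈ K := fun x ↦ hFK (SetLike.coe_mem ((x : 𝓞 (RF ζ)) : RF ζ))
  -- p-th roots
  have hroot : ∀ x : AlgebraicClosure ℚ, ∃ r, r ^ p = x := fun x ↦ IsAlgClosed.exists_pow_nat_eq x hpf.out.pos
  choose rt hrt using hroot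
  let g : Option (Option (RG p)) → AlgebraicClosure ℚ := fun i ↦ match i with
    | none => ζ
    | some none => sqn ζ 1
    | some (some α) => U α
  have hgK : ∀ i, g i ∈ K := by
    rintro (_ | _ | α)
    · exact hζK
    · exact K.sub_mem (K.pow_mem hζK 1) (K.pow_mem (K.inv_mem hζK) 1)
    · exact huK _
  let S : Finset (Option (Option (RG p))) :=
    insert none (insert (some none) (((Finset.univ.erase 1).erase α₀).image (fun α ↦ some (some α))))
  have hS : S.card ≤ Fintype.card (RG p) := by
    have h1 : ((Finset.univ.erase (1 : RG p)).erase α₀).card = Fintype.card (RG p) - 1 - 1 := by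
      rw [Finset.card_erase_of_mem (Finset.mem_erase.mpr ⟨hα₀, Finset.mem_univ _⟩), Finset.card_erase_of_mem (Finset.mem_univ _), Finset.card_univ]
    have h3 : 1 < Fintype.card (RG p) := Fintype.one_lt_card_iff.mpr ⟨α₀, 1, hα₀⟩
    have h4 := Finset.card_image_le (s := (Finset.univ.erase (1 : RG p)).erase α₀) (f := fun α ↦ some (some α))
    have h5 := Finset.card_insert_le none (insert (some none) (((Finset.univ.erase (1 : RG p)).erase α₀).image (fun α ↦ some (some α))))
    have h6 := Finset.card_insert_le (some none) (((Finset.univ.erase (1 : RG p)).erase α₀).image (fun α ↦ some (some α)))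
    change (insert none (insert (some none) (((Finset.univ.erase (1 : RG p)).erase α₀).image (fun α ↦ some (some α))))).card ≤ _
    omega
  obtain ⟨hfd, hdeg⟩ := finrank_adjoin_le (K := K) p hpf.out.pos S (fun i ↦ rt (g i))
    (fun i _ ↦ ⟨⟨g i, hgK i⟩, hrt _⟩)
  set M := IntermediateField.adjoin K ((fun i ↦ rt (g i)) '' S) with hM
  have hKM : ∀ x ∈ K, x ∈ M := fun x hx ↦ M.algebraMap_mem ⟨x, hx⟩
  let H := rootGp p M
  have hHS : ∀ i ∈ S, ∀ x : (AlgebraicClosure ℚ)ˣ, (x : AlgebraicClosure ℚ) = g i → x ∈ H := by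
    intro i hi x hx
    exact ⟨rt (g i), IntermediateField.subset_adjoin _ _ ⟨i, hi, rfl⟩, by rw [hrt, hx]⟩
  have hHp : ∀ x : (AlgebraicClosure ℚ)ˣ, (x : AlgebraicClosure ℚ) ∈ K → x ^ p ∈ H := by
    intro x hx
    exact ⟨x, hKM _ hx, by simp⟩
  have hodd : Odd p := hpf.out.odd_of_ne_two h2
  have hneg : (-1 : (AlgebraicClosure ℚ)ˣ) ∈ H := ⟨-1, M.neg_mem M.one_mem, by rw [hodd.neg_one_pow]; simp⟩
  have hζH : ∀ x : (AlgebraicClosure ℚ)ˣ, (x : AlgebraicClosure ℚ) = ζ → x ∈ H := hHS none (by simp [S])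
  have hsH : ∀ x : (AlgebraicClosure ℚ)ˣ, (x : AlgebraicClosure ℚ) = sqn ζ 1 → x ∈ H := hHS (some none) (by simp [S])
  have hU1 : U 1 ∈ H := by
    have htor : D.uA h2 1 ∈ Units.torsion (RF ζ) := by
      rw [Units.mem_torsion]
      intro w
      obtain ⟨β, rfl⟩ := (D.pl h2).surjective w
      have h1 := D.log_uA h2 1 β
      rw [one_mul, sub_self] at h1
      have h3 : 0 < D.pl h2 β (D.uA h2 1 : (𝓞 (RF ζ))) := Units.pos_at_place _ _
      exact Real.eq_one_of_pos_of_log_eq_zero h3 h1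
    rcases D.torsion_eq h2 _ htor with h | h
    · simp only [U, h, map_one]; exact H.one_mem
    · have : U 1 = -1 := by
        simp only [U, h]
        ext
        rw [ucoe_val]; simp
      rw [this]; exact hneg
  have hUne : ∀ α, α ≠ α₀ → U α ∈ H := by
    intro α hα
    by_cases h1 : α = 1
    · rw [h1]; exact hU1
    · exact hHS (some (some α)) (by simp [S, hα, h1]) _ rfl
  have htH : ucoe ζ t ∈ H := by
    rcases ht with rfl | rfl
    · rw [map_one]; exact H.one_mem
    · have : ucoe ζ (-1) = -1 := by
        ext
        rw [ucoe_val]; simp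
      rw [this]; exact hneg
  have hrel := congrArg (ucoe ζ) hv
  rw [map_pow, map_mul, map_prod, ← Finset.mul_prod_erase _ _ (Finset.mem_erase.mpr ⟨hα₀, Finset.mem_univ _⟩)] at hrel
  simp only [map_zpow] at hrel
  have hUe : U α₀ ^ e α₀ ∈ H := by
    have h1 : ∏ x ∈ (Finset.univ.erase 1).erase α₀, (ucoe ζ) (D.uA h2 x) ^ e x ∈ H :=
      H.prod_mem fun α hα ↦ H.zpow_mem (hUne α (Finset.ne_of_mem_erase hα)) _
    have h3 := hHp (ucoe ζ v) (huK v)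
    rw [hrel] at h3
    rw [H.mul_mem_cancel_left htH, H.mul_mem_cancel_right h1] at h3
    exact h3
  have hU0 : U α₀ ∈ H := by
    have hcop : IsCoprime (p:ℤ) (e α₀) := (Nat.prime_iff_prime_int.mp hpf.out).coprime_iff_not_dvd.mpr hd
    obtain ⟨x, y, hxy⟩ := hcop
    have : U α₀ = (U α₀ ^ p) ^ x * (U α₀ ^ e α₀) ^ y := by
      rw [← zpow_natCast, ← zpow_mul, ← zpow_mul, ← zpow_add, mul_comm (p:ℤ), mul_comm (e α₀), hxy, zpow_one]
    rw [this]
    exact H.mul_mem (H.zpow_mem (hHp _ (huK _)) _) (H.zpow_mem hUe _)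
  have hUall : ∀ α, U α ∈ H := fun α ↦ by
    by_cases h : α = α₀
    · rw [h]; exact hU0
    · exact hUne α h
  have hs1 : sqn ζ 1 ≠ 0 := by
    intro h
    simp only [sqn, pow_one, sub_eq_zero] at h
    have h3 : ζ ^ 2 = 1 := by rw [sq]; nth_rewrite 2 [h]; exact mul_inv_cancel₀ hζ0
    have := Nat.le_of_dvd (by norm_num) (hζ.dvd_of_pow_eq_one 2 h3)
    have := hpf.out.two_le
    omega
  have key : ∀ i : ZMod p, i ≠ 0 → ∃ r ∈ M, r ^ p = 1 - ζ ^ i.val := by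
    intro i hi
    set j : (ZMod p)ˣ := Units.mk0 (i / 2) (div_ne_zero hi (RC.two_ne h2)) with hj
    set a := Function.surjInv (rgmk_surj p) (rgmk p j) with ha
    have hα := hUall (rgmk p j)
    have hc := c_coe hζ D hD (a : ZMod p).val
    have hUc : (U (rgmk p j) : AlgebraicClosure ℚ) * sqn ζ 1 = sqn ζ (a : ZMod p).val := hc
    let zu : (AlgebraicClosure ℚ)ˣ := Units.mk0 ζ hζ0
    let su : (AlgebraicClosure ℚ)ˣ := Units.mk0 (sqn ζ 1) hs1
    have hz : zu ∈ H := hζH zu rfl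
    have hs : su ∈ H := hsH su rfl
    have hpowmod : ∀ m n : ℕ, (m : ZMod p) = n → ζ ^ m = ζ ^ n := by
      intro m n hmn
      rw [ZMod.natCast_eq_natCast_iff] at hmn
      have key : ∀ q : ℕ, ζ ^ q = ζ ^ (q % p) := fun q => by
        conv_lhs => rw [← Nat.div_add_mod q p, pow_add, pow_mul, hζ.pow_eq_one, one_pow, one_mul]
      rw [key m, key n]
      exact congrArg (ζ ^ ·) hmn
    have h1 : 1 - ζ ^ (2 * (a : ZMod p).val) = -ζ ^ (a : ZMod p).val * sqn ζ (a : ZMod p).val := by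
      have : ζ ^ (a : ZMod p).val * ζ⁻¹ ^ (a : ZMod p).val = 1 := by rw [← mul_pow, mul_inv_cancel₀ hζ0, one_pow]
      rw [sqn]
      linear_combination -this
    have haj := (rgmk_eq p a j).mp (Function.surjInv_eq (rgmk_surj p) (rgmk p j))
    have h2i : (2:ZMod p) * (j : ZMod p) = i := by
      rw [hj, Units.val_mk0]; have := RC.two_ne (p := p) h2; field_simp
    rcases haj with haj | haj
    · have e1 : ζ ^ i.val = ζ ^ (2 * (a : ZMod p).val) := by
        apply hpowmod
        push_cast
        rw [ZMod.natCast_zmod_val, ZMod.natCast_zmod_val, haj, h2i]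
      have hmem : (-1 : (AlgebraicClosure ℚ)ˣ) * zu ^ (a : ZMod p).val * (U (rgmk p j) * su) ∈ H :=
        H.mul_mem (H.mul_mem hneg (H.pow_mem hz _)) (H.mul_mem hα hs)
      obtain ⟨r, hr, hr'⟩ := hmem
      refine ⟨r, hr, ?_⟩
      rw [hr', e1, h1, ← hUc]
      simp [zu, su]
    · have e1 : ζ ^ i.val * ζ ^ (2 * (a : ZMod p).val) = 1 := by
        rw [← pow_add, ← pow_zero ζ]
        apply hpowmod
        push_cast
        rw [ZMod.natCast_zmod_val, ZMod.natCast_zmod_val, haj, ← h2i]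
        push_cast; ring
      have hmem : zu ^ i.val * (zu ^ (a : ZMod p).val * (U (rgmk p j) * su)) ∈ H :=
        H.mul_mem (H.pow_mem hz _) (H.mul_mem (H.pow_mem hz _) (H.mul_mem hα hs))
      obtain ⟨r, hr, hr'⟩ := hmem
      refine ⟨r, hr, ?_⟩
      have h3 : 1 - ζ ^ i.val = ζ ^ i.val * (ζ ^ (a : ZMod p).val * sqn ζ (a : ZMod p).val) := by
        linear_combination (-ζ ^ i.val) * h1 - e1
      rw [hr', h3, ← hUc]
      simp [zu, su]
  have hLM : IntermediateField.adjoin K {x : AlgebraicClosure ℚ | 1 - (1 - x ^ p) ^ p = 0} ≤ M := by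
    rw [IntermediateField.adjoin_le_iff]
    intro x hx
    have hx' : (1 - x ^ p) ^ p = 1 := (sub_eq_zero.mp hx).symm
    have : NeZero p := ⟨hp0⟩
    obtain ⟨i, hi, hix⟩ := hζ.eq_pow_of_pow_eq_one hx'
    have hxp : x ^ p = 1 - ζ ^ i := by rw [hix]; ring
    by_cases hi0 : i = 0
    · rw [hi0, pow_zero, sub_self] at hxp
      rw [pow_eq_zero_iff hp0] at hxp
      rw [hxp]; exact M.zero_mem
    · have hine : (i : ZMod p) ≠ 0 := by
        rw [Ne, ZMod.natCast_eq_zero_iff]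
        intro h; exact hi0 (Nat.eq_zero_of_dvd_of_lt h hi)
      obtain ⟨r, hr, hrp⟩ := key i hine
      rw [ZMod.val_natCast_of_lt hi, ← hxp] at hrp
      have hx0 : x ≠ 0 := by
        rintro rfl
        rw [zero_pow hp0] at hxp
        have h1 := hζ.pow_ne_one_of_pos_of_lt hi0 hi
        exact h1 (sub_eq_zero.mp hxp.symm).symm
      have hr0 : r ≠ 0 := by
        rintro rfl
        rw [zero_pow hp0] at hrp
        exact hx0 (pow_eq_zero_iff hp0 |>.mp hrp.symm)
      obtain ⟨k, _, hk⟩ := hζ.eq_pow_of_pow_eq_one (ξ := x / r) (by rw [div_pow, hrp, div_self (pow_ne_zero _ hx0)])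
      have : x = ζ ^ k * r := by rw [hk]; field_simp
      rw [this]
      exact M.mul_mem (pow_mem (hKM _ hζK) k) hr
  have hle : Module.finrank K (IntermediateField.adjoin K {x : AlgebraicClosure ℚ | 1 - (1 - x ^ p) ^ p = 0}) ≤ Module.finrank K M :=
    LinearMap.finrank_le_finrank_of_injective (f := (IntermediateField.inclusion hLM).toLinearMap) (IntermediateField.inclusion_injective hLM)
  exact hle.trans (hdeg.trans (Nat.pow_le_pow_right hpf.out.pos hS))

end

end Part11

theorem stmt_7 (p : ℕ) (hp : p.Prime) (hodd : Odd p)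
    (ζ : AlgebraicClosure ℚ) (hζ : IsPrimitiveRoot ζ p)
    (hV : p ∣ Nat.card (ClassGroup (NumberField.RingOfIntegers
      (IntermediateField.adjoin ℚ {ζ + ζ⁻¹}))))
    (K : IntermediateField ℚ (AlgebraicClosure ℚ))
    (hK : K = IntermediateField.adjoin ℚ {ζ})
    (L : IntermediateField K (AlgebraicClosure ℚ))
    (hL : L = IntermediateField.adjoin K
      {x : AlgebraicClosure ℚ | 1 - (1 - x ^ p) ^ p = 0}) :
    Module.finrank K L < p ^ ((p + 1) / 2) := by
  have hpf : Fact p.Prime := ⟨hp⟩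
  have h2 : p ≠ 2 := by rintro rfl; exact absurd hodd (by decide)
  subst hL
  refine lt_of_le_of_lt (final_bound h2 hζ hV K hK) (Nat.pow_lt_pow_right hp.one_lt ?_)
  have := card_RG p h2
  have := hp.two_le
  omega
end

section
/- Let Λ₁ = 𝔽₃[e, f]/(e³ − 1, f³ − 1), with B_σ = 1 − (e + f)(1 − e)(1 − f) and B_τ = 1 + (e + f) − (e² + ef + f²) + e²f² in Λ₁. Let the group G = ℤ/3 × ℤ/3 act 𝔽₃-linearly on M = Λ₁ by (a, b)·m = B_σ^a B_τ^b m (well defined since B_σ³ = B_τ³ = 1). Then the group cohomology H¹(G, M) is an 𝔽₃-vector space of dimension 9, and H²(G, M) is an 𝔽₃-vector space of dimension 13. -/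
/-- `Λ₁ = 𝔽₃[e,f]/(e³-1, f³-1)`: the group ring of `(ℤ/3)²` over `𝔽₃ = ZMod 3`. -/
noncomputable abbrev Lam3 : Type := AddMonoidAlgebra (ZMod 3) (ZMod 3 × ZMod 3)

/-- The group-like generator `e`. -/
noncomputable def eGen : Lam3 := AddMonoidAlgebra.single ((1 : ZMod 3), (0 : ZMod 3)) 1

/-- The group-like generator `f`. -/
noncomputable def fGen : Lam3 := AddMonoidAlgebra.single ((0 : ZMod 3), (1 : ZMod 3)) 1

/-- `B_σ = 1 - (e + f)(1 - e)(1 - f)`. -/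
noncomputable def Bsig : Lam3 := 1 - (eGen + fGen) * (1 - eGen) * (1 - fGen)

/-- `B_τ = 1 + (e + f) - (e² + ef + f²) + e²f²`. -/
noncomputable def Btau : Lam3 :=
  1 + (eGen + fGen) - (eGen ^ 2 + eGen * fGen + fGen ^ 2) + eGen ^ 2 * fGen ^ 2


/-- The coordinate model of `Λ₁`, in the basis `x^i w^j` with `x = e - 1`, `w = f - 1`. -/
abbrev DMod : Type := Fin 9 → ZMod 3

/-- Multiplication by `B_σ - 1`. -/
def Yop (c : DMod) : DMod :=
  ![0, 0, 0, 0, c 0, c 1 - c 0, 0, c 3 - c 0, c 4 - c 3 - c 1]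

/-- Multiplication by `B_τ - 1`. -/
def Zop (c : DMod) : DMod :=
  ![0, 0, 0, 0, 0, -c 0, 0, -c 0, c 0 - c 1 - c 3]

/-- The action of `σ^i τ^j`. -/
def actD (i j : ZMod 3) (c : DMod) : DMod :=
  c + i • Yop c + j • Zop c + (i - i ^ 2) • Yop (Yop c)

/-- The parametrization of `Λ₁`. -/
noncomputable def Lmap : DMod →ₗ[ZMod 3] Lam3 where
  toFun c := c 0 • 1 + c 1 • (eGen - 1) + c 2 • (eGen - 1) ^ 2 + c 3 • (fGen - 1)
    + c 4 • ((eGen - 1) * (fGen - 1)) + c 5 • ((eGen - 1) ^ 2 * (fGen - 1))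
    + c 6 • (fGen - 1) ^ 2 + c 7 • ((eGen - 1) * (fGen - 1) ^ 2)
    + c 8 • ((eGen - 1) ^ 2 * (fGen - 1) ^ 2)
  map_add' a b := by simp only [Pi.add_apply]; module
  map_smul' r a := by simp only [Pi.smul_apply, RingHom.id_apply, smul_eq_mul]; module

lemma eGen_cube : eGen ^ 3 = 1 := by
  simp [eGen, AddMonoidAlgebra.single_pow, AddMonoidAlgebra.one_def]; rfl

lemma fGen_cube : fGen ^ 3 = 1 := by
  simp [fGen, AddMonoidAlgebra.single_pow, AddMonoidAlgebra.one_def]; rfl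

lemma three_Lam : (3 : Lam3) = 0 := by
  have : ((3 : ℕ) : Lam3) = 0 := by
    rw [← map_natCast (algebraMap (ZMod 3) Lam3)]
    have : ((3 : ℕ) : ZMod 3) = 0 := by decide
    rw [this, map_zero]
  exact_mod_cast this

lemma single_eq_pow (i j : ZMod 3) :
    (AddMonoidAlgebra.single (i, j) 1 : Lam3) = eGen ^ i.val * fGen ^ j.val := by
  simp [eGen, fGen, AddMonoidAlgebra.single_pow, AddMonoidAlgebra.single_mul_single]

lemma Lmap_surj : Function.Surjective Lmap := by
  rw [← LinearMap.range_eq_top, eq_top_iff]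
  rintro m -
  induction m using AddMonoidAlgebra.induction_linear with
  | zero => exact Submodule.zero_mem _
  | add a b ha hb => exact Submodule.add_mem _ ha hb
  | single g r =>
    have : (AddMonoidAlgebra.single g r : Lam3) = r • AddMonoidAlgebra.single g 1 := by simp
    rw [this]
    apply Submodule.smul_mem
    obtain ⟨i, j⟩ := g
    rw [single_eq_pow]
    have key : ∀ i j : ZMod 3, eGen ^ i.val * fGen ^ j.val =
        Lmap ![1, i, i - i ^ 2, j, i * j, (i - i ^ 2) * j, j - j ^ 2, i * (j - j ^ 2),
          (i - i ^ 2) * (j - j ^ 2)] := by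
      intro i j
      have h2 : (2 : ZMod 3) - 2 ^ 2 = 1 := by decide
      have v1 : (1 : ZMod 3).val = 1 := rfl
      have v2 : (2 : ZMod 3).val = 2 := rfl
      have hs : ∀ m : Lam3, (2 : ZMod 3) • m = m + m := fun m => two_smul _ m
      have h4 : ∀ m : Lam3, ((2 : ZMod 3) * 2) • m = m := fun m => by
        rw [show (2 : ZMod 3) * 2 = 1 by decide, one_smul]
      have h3 := three_Lam
      have ci : i = 0 ∨ i = 1 ∨ i = 2 := by revert i; decide
      have cj : j = 0 ∨ j = 1 ∨ j = 2 := by revert j; decide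
      rcases ci with rfl | rfl | rfl <;> rcases cj with rfl | rfl | rfl <;>
        simp [Lmap, h2, v1, v2, hs, h4, -mul_eq_mul_left_iff] <;> grind
    exact ⟨_, (key i j).symm⟩

lemma Lmap_inj : Function.Injective Lmap := by
  have h : Module.finrank (ZMod 3) DMod = Module.finrank (ZMod 3) Lam3 := by
    have e : Lam3 ≃ₗ[ZMod 3] ((ZMod 3 × ZMod 3) →₀ ZMod 3) := AddMonoidAlgebra.coeffLinearEquiv _
    rw [e.finrank_eq]
    simp
  exact (LinearMap.injective_iff_surjective_of_finrank_eq_finrank h).2 Lmap_surj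

noncomputable def Leq : DMod ≃ₗ[ZMod 3] Lam3 :=
  LinearEquiv.ofBijective Lmap ⟨Lmap_inj, Lmap_surj⟩

/-- The polynomial expansion behind `Lmap`, in any commutative ring. -/
def polyR {R : Type*} [CommRing R] (x w : R) (c0 c1 c2 c3 c4 c5 c6 c7 c8 : R) : R :=
  c0 + c1 * x + c2 * x ^ 2 + c3 * w + c4 * (x * w) + c5 * (x ^ 2 * w) + c6 * w ^ 2
    + c7 * (x * w ^ 2) + c8 * (x ^ 2 * w ^ 2)

lemma Lmap_eq (c : DMod) : Lmap c = polyR (eGen - 1) (fGen - 1)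
    (algebraMap (ZMod 3) Lam3 (c 0)) (algebraMap (ZMod 3) Lam3 (c 1))
    (algebraMap (ZMod 3) Lam3 (c 2)) (algebraMap (ZMod 3) Lam3 (c 3))
    (algebraMap (ZMod 3) Lam3 (c 4)) (algebraMap (ZMod 3) Lam3 (c 5))
    (algebraMap (ZMod 3) Lam3 (c 6)) (algebraMap (ZMod 3) Lam3 (c 7))
    (algebraMap (ZMod 3) Lam3 (c 8)) := by
  show c 0 • (1 : Lam3) + _ + _ + _ + _ + _ + _ + _ + _ = _
  simp only [polyR, Algebra.smul_def, mul_one]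

lemma polyR_sig {R : Type*} [CommRing R] (x w c0 c1 c2 c3 c4 c5 c6 c7 c8 : R)
    (hx : x ^ 3 = 0) (hw : w ^ 3 = 0) (h3 : (3 : R) = 0) :
    (1 - ((x + 1) + (w + 1)) * (1 - (x + 1)) * (1 - (w + 1))) *
      polyR x w c0 c1 c2 c3 c4 c5 c6 c7 c8 =
    polyR x w c0 c1 c2 c3 (c4 + c0) (c5 + (c1 - c0)) c6 (c7 + (c3 - c0))
      (c8 + (c4 - c3 - c1)) := by
  have hx4 : x ^ 4 = 0 := by rw [pow_succ, hx, zero_mul]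
  have hw4 : w ^ 4 = 0 := by rw [pow_succ, hw, zero_mul]
  simp only [polyR]
  grind

lemma polyR_tau {R : Type*} [CommRing R] (x w c0 c1 c2 c3 c4 c5 c6 c7 c8 : R)
    (hx : x ^ 3 = 0) (hw : w ^ 3 = 0) (h3 : (3 : R) = 0) :
    (1 + ((x + 1) + (w + 1)) - ((x + 1) ^ 2 + (x + 1) * (w + 1) + (w + 1) ^ 2)
      + (x + 1) ^ 2 * (w + 1) ^ 2) *
      polyR x w c0 c1 c2 c3 c4 c5 c6 c7 c8 =
    polyR x w c0 c1 c2 c3 c4 (c5 - c0) c6 (c7 - c0) (c8 + (c0 - c1 - c3)) := by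
  have hx4 : x ^ 4 = 0 := by rw [pow_succ, hx, zero_mul]
  have hw4 : w ^ 4 = 0 := by rw [pow_succ, hw, zero_mul]
  simp only [polyR]
  grind

lemma xcube : (eGen - 1) ^ 3 = 0 := by
  linear_combination eGen_cube + (eGen - eGen ^ 2) * three_Lam

lemma wcube : (fGen - 1) ^ 3 = 0 := by
  linear_combination fGen_cube + (fGen - fGen ^ 2) * three_Lam

lemma Bsig_mul (c : DMod) : Bsig * Lmap c = Lmap (c + Yop c) := by
  have h := polyR_sig (eGen - 1) (fGen - 1)
    (algebraMap (ZMod 3) Lam3 (c 0)) (algebraMap (ZMod 3) Lam3 (c 1))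
    (algebraMap (ZMod 3) Lam3 (c 2)) (algebraMap (ZMod 3) Lam3 (c 3))
    (algebraMap (ZMod 3) Lam3 (c 4)) (algebraMap (ZMod 3) Lam3 (c 5))
    (algebraMap (ZMod 3) Lam3 (c 6)) (algebraMap (ZMod 3) Lam3 (c 7))
    (algebraMap (ZMod 3) Lam3 (c 8)) xcube wcube three_Lam
  simp only [sub_add_cancel, ← map_add, ← map_sub] at h
  rw [Lmap_eq, Lmap_eq, Bsig, h]
  simp only [Pi.add_apply]
  congr 2 <;> simp [Yop]

lemma Btau_mul (c : DMod) : Btau * Lmap c = Lmap (c + Zop c) := by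
  have h := polyR_tau (eGen - 1) (fGen - 1)
    (algebraMap (ZMod 3) Lam3 (c 0)) (algebraMap (ZMod 3) Lam3 (c 1))
    (algebraMap (ZMod 3) Lam3 (c 2)) (algebraMap (ZMod 3) Lam3 (c 3))
    (algebraMap (ZMod 3) Lam3 (c 4)) (algebraMap (ZMod 3) Lam3 (c 5))
    (algebraMap (ZMod 3) Lam3 (c 6)) (algebraMap (ZMod 3) Lam3 (c 7))
    (algebraMap (ZMod 3) Lam3 (c 8)) xcube wcube three_Lam
  simp only [sub_add_cancel, ← map_add, ← map_sub] at h
  rw [Lmap_eq, Lmap_eq, Btau, h]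
  simp only [Pi.add_apply]
  congr 2 <;> simp [Zop, sub_eq_add_neg]

lemma Yop_coords (c : DMod) : Yop c 0 = 0 ∧ Yop c 1 = 0 ∧ Yop c 2 = 0 ∧ Yop c 3 = 0 ∧
    Yop c 4 = c 0 ∧ Yop c 5 = c 1 - c 0 ∧ Yop c 6 = 0 ∧ Yop c 7 = c 3 - c 0 ∧ Yop c 8 = c 4 - c 3 - c 1 :=
  ⟨rfl, rfl, rfl, rfl, rfl, rfl, rfl, rfl, rfl⟩

lemma Zop_coords (c : DMod) : Zop c 0 = 0 ∧ Zop c 1 = 0 ∧ Zop c 2 = 0 ∧ Zop c 3 = 0 ∧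
    Zop c 4 = 0 ∧ Zop c 5 = -c 0 ∧ Zop c 6 = 0 ∧ Zop c 7 = -c 0 ∧ Zop c 8 = c 0 - c 1 - c 3 :=
  ⟨rfl, rfl, rfl, rfl, rfl, rfl, rfl, rfl, rfl⟩

lemma D_ext {c d : DMod} (h0 : c 0 = d 0) (h1 : c 1 = d 1) (h2 : c 2 = d 2) (h3 : c 3 = d 3)
    (h4 : c 4 = d 4) (h5 : c 5 = d 5) (h6 : c 6 = d 6) (h7 : c 7 = d 7) (h8 : c 8 = d 8) :
    c = d := by
  funext n
  fin_cases n <;> assumption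

lemma three_zero : (3 : ZMod 3) = 0 := by decide

lemma Bact (i j : ZMod 3) (c : DMod) :
    Bsig ^ i.val * Btau ^ j.val * Lmap c = Lmap (actD i j c) := by
  have v1 : (1 : ZMod 3).val = 1 := rfl
  have v2 : (2 : ZMod 3).val = 2 := rfl
  have ci : i = 0 ∨ i = 1 ∨ i = 2 := by revert i; decide
  have cj : j = 0 ∨ j = 1 ∨ j = 2 := by revert j; decide
  rcases ci with rfl | rfl | rfl <;> rcases cj with rfl | rfl | rfl <;>
    simp only [v1, v2, ZMod.val_zero, pow_zero, pow_one, one_mul, mul_one, pow_two, mul_assoc,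
      Bsig_mul, Btau_mul] <;> congr 1 <;> apply D_ext <;>
    simp only [actD, Pi.add_apply, Pi.smul_apply, smul_eq_mul, Yop_coords, Zop_coords] <;>
    first | ring1 | (ring_nf; reduce_mod_char; done) | linear_combination (c 0) * three_zero

/-- The group. -/
abbrev GG : Type := Multiplicative (ZMod 3 × ZMod 3)

/-- The generator acting through `B_σ`. -/
def sG : GG := Multiplicative.ofAdd (1, 0)

/-- The generator acting through `B_τ`. -/
def tG : GG := Multiplicative.ofAdd (0, 1)

lemma sG_cube : sG * sG * sG = 1 := by decide

lemma tG_cube : tG * tG * tG = 1 := by decide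

lemma GG_gen (p : GG → Prop) (h1 : p 1) (hs : ∀ x, p x → p (x * sG))
    (ht : ∀ x, p x → p (x * tG)) (x : GG) : p x := by
  have h : ∀ x : GG, x = 1 ∨ x = 1 * sG ∨ x = 1 * sG * sG ∨ x = 1 * tG ∨ x = 1 * tG * sG ∨
      x = 1 * tG * sG * sG ∨ x = 1 * tG * tG ∨ x = 1 * tG * tG * sG ∨
      x = 1 * tG * tG * sG * sG := by decide
  rcases h x with h | h | h | h | h | h | h | h | h <;> rw [h] <;>
    first
    | exact h1
    | (repeat first | exact h1 | apply hs | apply ht)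

lemma exists_potential {V : Type*} [AddCommGroup V] (A B : GG → V)
    (hsq : ∀ x, A x + B (x * sG) = B x + A (x * tG))
    (hA : ∀ x, A x + A (x * sG) + A (x * sG * sG) = 0)
    (hB : ∀ x, B x + B (x * tG) + B (x * tG * tG) = 0) :
    ∃ φ : GG → V, ∀ x, φ (x * sG) - φ x = A x ∧ φ (x * tG) - φ x = B x := by
  let a : ZMod 3 → V := fun i =>
    if i = 0 then 0 else if i = 1 then A 1 else A 1 + A sG
  let pt : ZMod 3 → ZMod 3 → GG := fun i j => Multiplicative.ofAdd (i, j)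
  let φ : ZMod 3 → ZMod 3 → V := fun i j =>
    a i + (if j = 0 then 0 else if j = 1 then B (pt i 0) else B (pt i 0) + B (pt i 1))
  have e1 : ∀ i j, pt i j * sG = pt (i + 1) j := by decide
  have e2 : ∀ i j, pt i j * tG = pt i (j + 1) := by decide
  have p1 : (1 : GG) = pt 0 0 := rfl
  have p2 : sG = pt 1 0 := rfl
  have n1 : (1 : ZMod 3) + 1 = 2 := by decide
  have n2 : (2 : ZMod 3) + 1 = 0 := by decide
  have n3 : (2 : ZMod 3) ≠ 0 := by decide
  have n4 : (2 : ZMod 3) ≠ 1 := by decide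
  refine ⟨fun x => φ x.toAdd.1 x.toAdd.2, fun x => ?_⟩
  obtain ⟨i, j, rfl⟩ : ∃ i j, x = pt i j := ⟨x.toAdd.1, x.toAdd.2, rfl⟩
  rw [e1, e2]
  change φ (i + 1) j - φ i j = _ ∧ φ i (j + 1) - φ i j = _
  have hsq' := fun i j => hsq (pt i j)
  have hA' := fun i j => hA (pt i j)
  have hB' := fun i j => hB (pt i j)
  simp only [e1, e2] at hsq' hA' hB'
  have s00 := hsq' 0 0
  have s10 := hsq' 1 0
  have s20 := hsq' 2 0
  have s01 := hsq' 0 1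
  have s11 := hsq' 1 1
  have s21 := hsq' 2 1
  have a0 := hA' 0 0
  have b0 := hB' 0 0
  have b1 := hB' 1 0
  have b2 := hB' 2 0
  simp only [n1, n2, zero_add] at s00 s10 s20 s01 s11 s21 a0 b0 b1 b2
  clear hsq' hA' hB' hsq hA hB e1 e2
  have ci : i = 0 ∨ i = 1 ∨ i = 2 := by revert i; decide
  have cj : j = 0 ∨ j = 1 ∨ j = 2 := by revert j; decide
  rcases ci with rfl | rfl | rfl <;> rcases cj with rfl | rfl | rfl <;>
    simp only [φ, a, n1, n2, n3, n4, zero_add, one_ne_zero, if_true, if_false, p1, p2] <;>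
    constructor <;> grind

section structural

variable {V : Type*} [AddCommGroup V] [Module (ZMod 3) V] (ρ : Representation (ZMod 3) GG V)

lemma coc2_sumS (f : GG × GG → V)
    (hf : ∀ g h j : GG, f (g * h, j) + f (g, h) = ρ g (f (h, j)) + f (g, h * j)) (s : GG)
    (hs : s * s * s = 1) (x : GG) :
    f (x, s) + f (x * s, s) + f (x * s * s, s) =
      ρ x (f (1, s) + f (s, s) + f (s * s, s)) := by
  have h1 := hf x 1 s
  have h2 := hf x s s
  have h3 := hf x (s * s) s
  rw [hs] at h3
  rw [one_mul, mul_one] at h1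
  rw [← mul_assoc] at h3
  rw [map_add, map_add]
  grind

lemma coc2_sq (f : GG × GG → V)
    (hf : ∀ g h j : GG, f (g * h, j) + f (g, h) = ρ g (f (h, j)) + f (g, h * j)) (s t : GG)
    (x : GG) :
    (f (x * t, s) + f (x, t)) - (f (x * s, t) + f (x, s)) = ρ x (f (t, s) - f (s, t)) := by
  have h1 := hf x t s
  have h2 := hf x s t
  rw [mul_comm t s] at h1
  rw [map_sub]
  grind

lemma coc2_invS (f : GG × GG → V)
    (hf : ∀ g h j : GG, f (g * h, j) + f (g, h) = ρ g (f (h, j)) + f (g, h * j)) (s : GG)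
    (hs : s * s * s = 1) :
    ρ s (f (1, s) + f (s, s) + f (s * s, s)) = f (1, s) + f (s, s) + f (s * s, s) := by
  rw [← coc2_sumS ρ f hf s hs s, hs]
  abel

lemma coc2_invT (f : GG × GG → V)
    (hf : ∀ g h j : GG, f (g * h, j) + f (g, h) = ρ g (f (h, j)) + f (g, h * j)) (s t : GG)
    (hs : s * s * s = 1) :
    ρ t (f (1, s) + f (s, s) + f (s * s, s)) - (f (1, s) + f (s, s) + f (s * s, s)) =
      (f (t, s) - f (s, t)) + ρ s (f (t, s) - f (s, t)) + ρ (s * s) (f (t, s) - f (s, t)) := by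
  rw [← coc2_sumS ρ f hf s hs t]
  have h1 := coc2_sq ρ f hf s t 1
  have h2 := coc2_sq ρ f hf s t s
  have h3 := coc2_sq ρ f hf s t (s * s)
  rw [← h2, ← h3, hs]
  simp only [map_one, one_mul, Module.End.one_apply] at h1
  rw [← h1, mul_comm s t, mul_assoc t s s, mul_comm (s * s) t]
  abel

lemma coc2_cob (f : GG × GG → V)
    (hf : ∀ g h j : GG, f (g * h, j) + f (g, h) = ρ g (f (h, j)) + f (g, h * j))
    (ha : f (1, sG) + f (sG, sG) + f (sG * sG, sG) = 0)
    (hc : f (1, tG) + f (tG, tG) + f (tG * tG, tG) = 0)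
    (hb : f (tG, sG) - f (sG, tG) = 0) :
    ∃ h : GG → V, ∀ x g, ρ x (h g) - h (x * g) + h x = f (x, g) := by
  obtain ⟨φ, hφ⟩ := exists_potential (fun x => f (x, sG)) (fun x => f (x, tG))
    (fun x => by
      have := coc2_sq ρ f hf sG tG x
      rw [hb, map_zero] at this
      grind)
    (fun x => by
      have := coc2_sumS ρ f hf sG sG_cube x
      rwa [ha, map_zero] at this)
    (fun x => by
      have := coc2_sumS ρ f hf tG tG_cube x
      rwa [hc, map_zero] at this)
  have key : ∀ g, ∃ m : V, ∀ x, f (x, g) = φ (x * g) - φ x + ρ x m := by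
    apply GG_gen
    · refine ⟨f (1, 1), fun x => ?_⟩
      have := hf x 1 1
      simp only [mul_one] at this
      simp only [mul_one]
      grind
    · rintro g ⟨m, hm⟩
      refine ⟨m - f (g, sG), fun x => ?_⟩
      have h1 := hf x g sG
      have h2 := (hφ (x * g)).1
      have h3 := hm x
      rw [map_sub, ← mul_assoc]
      grind
    · rintro g ⟨m, hm⟩
      refine ⟨m - f (g, tG), fun x => ?_⟩
      have h1 := hf x g tG
      have h2 := (hφ (x * g)).2
      have h3 := hm x
      rw [map_sub, ← mul_assoc]
      grind
  refine ⟨fun g => f (1, 1) + φ 1 - φ g, fun x g => ?_⟩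
  obtain ⟨m, hm⟩ := key g
  have h1 := hm 1
  have h2 := hf 1 1 g
  simp only [map_one, one_mul, Module.End.one_apply] at h1 h2
  have hm' : m = f (1, 1) + φ 1 - φ g := by grind
  rw [hm x, hm']
  dsimp only
  generalize ρ x (f (1, 1) + φ 1 - φ g) = r
  abel

end structural


lemma finrank_of_same_ker {Z H E : Type*} [AddCommGroup Z] [Module (ZMod 3) Z]
    [AddCommGroup H] [Module (ZMod 3) H] [AddCommGroup E] [Module (ZMod 3) E]
    (p : Z →ₗ[ZMod 3] H) (q : Z →ₗ[ZMod 3] E) (hp : Function.Surjective p)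
    (hq : Function.Surjective q) (h : ∀ z, p z = 0 ↔ q z = 0) :
    Module.finrank (ZMod 3) H = Module.finrank (ZMod 3) E := by
  have hk : LinearMap.ker p = LinearMap.ker q := by
    ext z
    exact h z
  exact (((p.quotKerEquivOfSurjective hp).symm.trans (Submodule.quotEquivOfEq _ _ hk)).trans
    (q.quotKerEquivOfSurjective hq)).finrank_eq

/-- Coordinates on `H¹`. -/
def th1 : DMod × DMod →ₗ[ZMod 3] (Fin 9 → ZMod 3) where
  toFun p := ![p.1 1, p.1 2, p.1 3, p.1 6, p.2 2, p.2 6, p.2 5 + p.1 4, p.2 7 + p.1 4,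
    p.2 8 + p.1 4 + p.1 5 + p.1 7]
  map_add' p q := by
    apply D_ext <;> simp <;> ring
  map_smul' r p := by
    apply D_ext <;> simp <;> ring

/-- Coordinates on `H²`. -/
def th2 : DMod × DMod × DMod →ₗ[ZMod 3] (Fin 13 → ZMod 3) where
  toFun p := ![p.1 2, p.1 5, p.1 6, p.1 7, p.2.1 1, p.2.1 2, p.2.1 3, p.2.1 6,
    p.2.2 2, p.2.2 5, p.2.2 6, p.2.2 7, p.2.2 8]
  map_add' p q := by
    funext n
    fin_cases n <;> rfl
  map_smul' r p := by
    funext n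
    fin_cases n <;> rfl

section main

variable (ρ : Representation (ZMod 3) GG Lam3)

/-- The values of a 1-cochain on generators. -/
noncomputable def ev1 : (GG → Lam3) →ₗ[ZMod 3] DMod × DMod where
  toFun F := (Leq.symm (F sG), Leq.symm (F tG))
  map_add' F F' := by simp
  map_smul' r F := by simp

/-- The invariants of a 2-cochain. -/
noncomputable def ev2 : (GG × GG → Lam3) →ₗ[ZMod 3] DMod × DMod × DMod where
  toFun f := (Leq.symm (f (1, sG) + f (sG, sG) + f (sG * sG, sG)),
    Leq.symm (f (tG, sG) - f (sG, tG)),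
    Leq.symm (f (1, tG) + f (tG, tG) + f (tG * tG, tG)))
  map_add' F F' := by
    simp only [Pi.add_apply, Prod.mk_add_mk, map_add, map_sub]
    refine Prod.ext ?_ (Prod.ext ?_ ?_) <;> dsimp only <;> abel
  map_smul' r F := by
    simp only [Pi.smul_apply, Prod.smul_mk, ← smul_add, ← smul_sub, map_smul, RingHom.id_apply]

lemma coc1_D {a b : DMod} (h1 : actD 2 0 a + actD 1 0 a + a = 0)
    (h2 : actD 1 0 b + a = actD 0 1 a + b) :
    a 0 = 0 ∧ b 0 = 0 ∧ b 1 = 0 ∧ b 3 = 0 ∧ b 4 = - a 1 - a 3 := by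
  have e1 := congrFun h1 8
  have e4 := congrFun h2 4
  have e5 := congrFun h2 5
  have e7 := congrFun h2 7
  have e8 := congrFun h2 8
  simp only [actD, Pi.add_apply, Pi.smul_apply, smul_eq_mul, Yop_coords, Zop_coords,
    Pi.zero_apply] at e1 e4 e5 e7 e8
  have f0 : a 0 = 0 := by
    linear_combination e1 - (a 8 + (a 4 - a 3 - a 1) - a 0) * three_zero
  have g0 : b 0 = 0 := by linear_combination e4
  have g1 : b 1 = 0 := by linear_combination e5 + g0 - f0
  have g3 : b 3 = 0 := by linear_combination e7 + g0 - f0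
  exact ⟨f0, g0, g1, g3, by linear_combination e8 + g1 + g3 + f0⟩

lemma coc1_D_conv {a b : DMod} (f0 : a 0 = 0) (g0 : b 0 = 0) (g1 : b 1 = 0) (g3 : b 3 = 0)
    (g4 : b 4 = - a 1 - a 3) (i j k l : ZMod 3) :
    (i + k) • a + ((i + k) - (i + k) ^ 2) • Yop a + (j + l) • b + ((i + k) * (j + l)) • Yop b =
    actD i j (k • a + (k - k ^ 2) • Yop a + l • b + (k * l) • Yop b) +
    (i • a + (i - i ^ 2) • Yop a + j • b + (i * j) • Yop b) := by
  apply D_ext <;>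
  simp only [actD, Pi.add_apply, Pi.smul_apply, smul_eq_mul, Yop_coords, Zop_coords, f0, g0, g1,
    g3, g4] <;>
  first
    | ring1
    | linear_combination (-(i * k) * a 1) * three_zero
    | linear_combination (-(i * k) * a 3) * three_zero
    | linear_combination (-(i * k) * (a 4 - a 3 - a 1)) * three_zero

lemma D_rep (p q : DMod) (h0 : p 0 = 0) (g0 : q 0 = 0) (g1 : q 1 = 0) (g3 : q 3 = 0)
    (g4 : q 4 = - p 1 - p 3) (h : th1 (p, q) = 0) :
    ∃ m : DMod, p = actD 1 0 m - m ∧ q = actD 0 1 m - m := by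
  have h' := fun n => congrFun h n
  have e0 : p 1 = 0 := h' 0
  have e1 : p 2 = 0 := h' 1
  have e2 : p 3 = 0 := h' 2
  have e3 : p 6 = 0 := h' 3
  have e4 : q 2 = 0 := h' 4
  have e5 : q 6 = 0 := h' 5
  have e6 : q 5 + p 4 = 0 := h' 6
  have e7 : q 7 + p 4 = 0 := h' 7
  have e8 : q 8 + p 4 + p 5 + p 7 = 0 := h' 8
  obtain ⟨m, m0, m1, m3, m4⟩ : ∃ m : DMod, m 0 = p 4 ∧ m 1 = p 5 + p 4 ∧ m 3 = p 7 + p 4 ∧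
      m 4 = p 8 + (p 7 + p 4) + (p 5 + p 4) :=
    ⟨![p 4, p 5 + p 4, 0, p 7 + p 4, p 8 + (p 7 + p 4) + (p 5 + p 4), 0, 0, 0, 0],
      rfl, rfl, rfl, rfl⟩
  refine ⟨m, ?_, ?_⟩
  · apply D_ext <;>
    simp only [actD, Pi.add_apply, Pi.sub_apply, Pi.smul_apply, smul_eq_mul, Yop_coords,
      Zop_coords, m0, m1, m3, m4, h0, e0, e1, e2, e3] <;> ring
  · apply D_ext <;>
    simp only [actD, Pi.add_apply, Pi.sub_apply, Pi.smul_apply, smul_eq_mul, Yop_coords,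
      Zop_coords, m0, m1, m3, m4, g0, g1, g3, g4, e0, e2, e4, e5] <;>
    first
    | ring1
    | linear_combination e6
    | linear_combination e7
    | linear_combination e8

/-- The carry cocycle of `ℤ/3`. -/
def cr (i k : ZMod 3) : ZMod 3 := if 3 ≤ i.val + k.val then 1 else 0

lemma cr_coc : ∀ i k m : ZMod 3, cr (i + k) m + cr i k = cr k m + cr i (k + m) := by decide

lemma coc2_D {a b c : DMod} (h1 : actD 1 0 a = a)
    (h2 : actD 0 1 a - a = b + actD 1 0 b + actD 2 0 b)
    (h3 : actD 1 0 c - c = (-b) + actD 0 1 (-b) + actD 0 2 (-b)) :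
    (a 0 = 0 ∧ a 1 = 0 ∧ a 3 = 0 ∧ a 4 = 0) ∧ b 0 = 0 ∧
      (c 0 = 0 ∧ c 1 = 0 ∧ c 3 = 0 ∧ c 4 = 0) := by
  have a4 := congrFun h1 4
  have a5 := congrFun h1 5
  have a7 := congrFun h1 7
  have a8 := congrFun h1 8
  have b8 := congrFun h2 8
  have c4 := congrFun h3 4
  have c5 := congrFun h3 5
  have c7 := congrFun h3 7
  have c8 := congrFun h3 8
  simp only [actD, Pi.add_apply, Pi.sub_apply, Pi.neg_apply, Pi.smul_apply, smul_eq_mul,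
    Yop_coords, Zop_coords] at a4 a5 a7 a8 b8 c4 c5 c7 c8
  have f0 : a 0 = 0 := by linear_combination a4
  have f1 : a 1 = 0 := by linear_combination a5 + f0
  have f3 : a 3 = 0 := by linear_combination a7 + f0
  have f4 : a 4 = 0 := by linear_combination a8 + f3 + f1
  have g0 : b 0 = 0 := by
    linear_combination -b8 + f0 - f1 - f3 - (b 8 + (b 4 - b 3 - b 1) - b 0) * three_zero
  have k0 : c 0 = 0 := by linear_combination c4 - b 4 * three_zero
  have k1 : c 1 = 0 := by linear_combination c5 + k0 - (b 5 - b 0) * three_zero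
  have k3 : c 3 = 0 := by linear_combination c7 + k0 - (b 7 - b 0) * three_zero
  have k4 : c 4 = 0 := by
    linear_combination c8 + k3 + k1 - (b 8 + (b 0 - b 1 - b 3)) * three_zero
  exact ⟨⟨f0, f1, f3, f4⟩, g0, k0, k1, k3, k4⟩

/-- The explicit 2-cocycle. -/
def cocD (a b c : DMod) (i j k l : ZMod 3) : DMod :=
  (j * k) • b + (j * (k - k ^ 2) + i * j * k) • Yop b + (k * (j - j ^ 2)) • Zop b
    + cr i k • a + cr j l • c

lemma coc2_D_conv {a b c : DMod} (a0 : a 0 = 0) (a1 : a 1 = 0) (a3 : a 3 = 0) (a4 : a 4 = 0)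
    (b0 : b 0 = 0) (c0 : c 0 = 0) (c1 : c 1 = 0) (c3 : c 3 = 0) (c4 : c 4 = 0)
    (i j k l m n : ZMod 3) :
    cocD a b c (i + k) (j + l) m n + cocD a b c i j k l =
      actD i j (cocD a b c k l m n) + cocD a b c i j (k + m) (l + n) := by
  have q1 := cr_coc i k m
  have q2 := cr_coc j l n
  apply D_ext <;>
  simp only [cocD, actD, Pi.add_apply, Pi.smul_apply, smul_eq_mul, Yop_coords, Zop_coords, a0, a1,
    a3, a4, b0, c0, c1, c3, c4]
  · ring
  · ring
  · linear_combination a 2 * q1 + c 2 * q2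
  · ring
  · ring
  · linear_combination a 5 * q1 + c 5 * q2 + (j * k * m * b 1) * three_zero
  · linear_combination a 6 * q1 + c 6 * q2
  · linear_combination a 7 * q1 + c 7 * q2 + (j * k * m * b 3) * three_zero
  · linear_combination a 8 * q1 + c 8 * q2 + (j * k * m * (b 4 - b 3 - b 1)) * three_zero
      + (j * l * m * (b 3 + b 1)) * three_zero

lemma th2_cob (p q : DMod) : th2 (p + actD 1 0 p + actD 2 0 p,
    actD 0 1 p - p - (actD 1 0 q - q), q + actD 0 1 q + actD 0 2 q) = 0 := by
  funext n
  fin_cases n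
  · show (p + actD 1 0 p + actD 2 0 p) 2 = 0
    simp only [actD, Pi.add_apply, Pi.smul_apply, smul_eq_mul, Yop_coords, Zop_coords]
    linear_combination p 2 * three_zero
  · show (p + actD 1 0 p + actD 2 0 p) 5 = 0
    simp only [actD, Pi.add_apply, Pi.smul_apply, smul_eq_mul, Yop_coords, Zop_coords]
    linear_combination (p 5 + p 1 - p 0) * three_zero
  · show (p + actD 1 0 p + actD 2 0 p) 6 = 0
    simp only [actD, Pi.add_apply, Pi.smul_apply, smul_eq_mul, Yop_coords, Zop_coords]
    linear_combination p 6 * three_zero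
  · show (p + actD 1 0 p + actD 2 0 p) 7 = 0
    simp only [actD, Pi.add_apply, Pi.smul_apply, smul_eq_mul, Yop_coords, Zop_coords]
    linear_combination (p 7 + p 3 - p 0) * three_zero
  · show (actD 0 1 p - p - (actD 1 0 q - q)) 1 = 0
    simp only [actD, Pi.add_apply, Pi.sub_apply, Pi.smul_apply, smul_eq_mul, Yop_coords, Zop_coords]
    ring
  · show (actD 0 1 p - p - (actD 1 0 q - q)) 2 = 0
    simp only [actD, Pi.add_apply, Pi.sub_apply, Pi.smul_apply, smul_eq_mul, Yop_coords, Zop_coords]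
    ring
  · show (actD 0 1 p - p - (actD 1 0 q - q)) 3 = 0
    simp only [actD, Pi.add_apply, Pi.sub_apply, Pi.smul_apply, smul_eq_mul, Yop_coords, Zop_coords]
    ring
  · show (actD 0 1 p - p - (actD 1 0 q - q)) 6 = 0
    simp only [actD, Pi.add_apply, Pi.sub_apply, Pi.smul_apply, smul_eq_mul, Yop_coords, Zop_coords]
    ring
  · show (q + actD 0 1 q + actD 0 2 q) 2 = 0
    simp only [actD, Pi.add_apply, Pi.smul_apply, smul_eq_mul, Yop_coords, Zop_coords]
    linear_combination q 2 * three_zero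
  · show (q + actD 0 1 q + actD 0 2 q) 5 = 0
    simp only [actD, Pi.add_apply, Pi.smul_apply, smul_eq_mul, Yop_coords, Zop_coords]
    linear_combination (q 5 - q 0) * three_zero
  · show (q + actD 0 1 q + actD 0 2 q) 6 = 0
    simp only [actD, Pi.add_apply, Pi.smul_apply, smul_eq_mul, Yop_coords, Zop_coords]
    linear_combination q 6 * three_zero
  · show (q + actD 0 1 q + actD 0 2 q) 7 = 0
    simp only [actD, Pi.add_apply, Pi.smul_apply, smul_eq_mul, Yop_coords, Zop_coords]
    linear_combination (q 7 - q 0) * three_zero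
  · show (q + actD 0 1 q + actD 0 2 q) 8 = 0
    simp only [actD, Pi.add_apply, Pi.smul_apply, smul_eq_mul, Yop_coords, Zop_coords]
    linear_combination (q 8 + (q 0 - q 1 - q 3)) * three_zero

lemma D_rep2 (a b c : DMod) (a0 : a 0 = 0) (a1 : a 1 = 0) (a3 : a 3 = 0) (a4 : a 4 = 0)
    (b0 : b 0 = 0) (c0 : c 0 = 0) (c1 : c 1 = 0) (c3 : c 3 = 0) (c4 : c 4 = 0)
    (h : th2 (a, b, c) = 0) :
    ∃ p q : DMod, a = p + actD 1 0 p + actD 2 0 p ∧ b = actD 0 1 p - p - (actD 1 0 q - q) ∧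
      c = q + actD 0 1 q + actD 0 2 q := by
  have h' := fun n => congrFun h n
  have a2 : a 2 = 0 := h' 0
  have a5 : a 5 = 0 := h' 1
  have a6 : a 6 = 0 := h' 2
  have a7 : a 7 = 0 := h' 3
  have b1 : b 1 = 0 := h' 4
  have b2 : b 2 = 0 := h' 5
  have b3 : b 3 = 0 := h' 6
  have b6 : b 6 = 0 := h' 7
  have c2 : c 2 = 0 := h' 8
  have c5 : c 5 = 0 := h' 9
  have c6 : c 6 = 0 := h' 10
  have c7 : c 7 = 0 := h' 11
  have c8 : c 8 = 0 := h' 12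
  obtain ⟨p, p0, p1, p2, p3, p4, p5, p6, p7, p8⟩ : ∃ p : DMod, p 0 = a 8 ∧ p 1 = 0 ∧ p 2 = 0 ∧
      p 3 = 0 ∧ p 4 = 0 ∧ p 5 = 0 ∧ p 6 = 0 ∧ p 7 = 0 ∧ p 8 = 0 :=
    ⟨![a 8, 0, 0, 0, 0, 0, 0, 0, 0], rfl, rfl, rfl, rfl, rfl, rfl, rfl, rfl, rfl⟩
  obtain ⟨q, q0, q1, q2, q3, q4, q5, q6, q7, q8⟩ : ∃ q : DMod, q 0 = -b 4 ∧
      q 1 = -b 4 - a 8 - b 5 ∧ q 2 = 0 ∧ q 3 = -b 4 - a 8 - b 7 ∧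
      q 4 = (-b 4 - a 8 - b 7) + (-b 4 - a 8 - b 5) + a 8 - b 8 ∧
      q 5 = 0 ∧ q 6 = 0 ∧ q 7 = 0 ∧ q 8 = 0 :=
    ⟨![-b 4, -b 4 - a 8 - b 5, 0, -b 4 - a 8 - b 7,
      (-b 4 - a 8 - b 7) + (-b 4 - a 8 - b 5) + a 8 - b 8, 0, 0, 0, 0],
      rfl, rfl, rfl, rfl, rfl, rfl, rfl, rfl, rfl⟩
  refine ⟨p, q, ?_, ?_, ?_⟩
  · apply D_ext <;>
    simp only [actD, Pi.add_apply, Pi.sub_apply, Pi.smul_apply, smul_eq_mul, Yop_coords,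
      Zop_coords, p0, p1, p2, p3, p4, p5, p6, p7, p8, a0, a1, a2, a3, a4, a5, a6, a7] <;>
    first | ring1 | linear_combination (-a 8) * three_zero | linear_combination (a 8) * three_zero
  · apply D_ext <;>
    simp only [actD, Pi.add_apply, Pi.sub_apply, Pi.smul_apply, smul_eq_mul, Yop_coords,
      Zop_coords, p0, p1, p2, p3, p4, p5, p6, p7, p8, q0, q1, q2, q3, q4, q5, q6, q7, q8,
      b0, b1, b2, b3, b6] <;> ring
  · apply D_ext <;>
    simp only [actD, Pi.add_apply, Pi.sub_apply, Pi.smul_apply, smul_eq_mul, Yop_coords,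
      Zop_coords, q0, q1, q2, q3, q4, q5, q6, q7, q8, c0, c1, c2, c3, c4, c5, c6, c7, c8] <;>
    first
    | ring1
    | linear_combination (b 4) * three_zero
    | linear_combination (-b 4) * three_zero
    | linear_combination (b 4 + a 8 + b 5) * three_zero
    | linear_combination (b 4 + a 8 + b 7) * three_zero
    | linear_combination
        (-((-b 4 - a 8 - b 7) + (-b 4 - a 8 - b 5) + a 8 - b 8)) * three_zero
    | linear_combination (-(b 4 + a 8 * 2 + b 5 + b 7)) * three_zero

end main

section final

variable (ρ : Representation (ZMod 3) GG Lam3)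

lemma symm_act (hρ : ∀ (g : GG) (m : Lam3),
      ρ g m = Bsig ^ ((Multiplicative.toAdd g).1.val) *
        Btau ^ ((Multiplicative.toAdd g).2.val) * m) (g : GG) (m : Lam3) :
    Leq.symm (ρ g m) = actD (Multiplicative.toAdd g).1 (Multiplicative.toAdd g).2 (Leq.symm m) := by
  obtain ⟨c, rfl⟩ := Leq.surjective m
  rw [hρ, LinearEquiv.symm_apply_apply, LinearEquiv.symm_apply_eq]
  exact Bact _ _ c




lemma dimH1 (hact : ∀ (g : GG) (m : Lam3), Leq.symm (ρ g m) =
    actD (Multiplicative.toAdd g).1 (Multiplicative.toAdd g).2 (Leq.symm m)) :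
    Module.finrank (ZMod 3) (groupCohomology (Rep.of ρ) 1) = 9 := by
  have hs : ∀ m, Leq.symm (ρ sG m) = actD 1 0 (Leq.symm m) := fun m => hact sG m
  have ht : ∀ m, Leq.symm (ρ tG m) = actD 0 1 (Leq.symm m) := fun m => hact tG m
  have hss : ∀ m, Leq.symm (ρ (sG * sG) m) = actD 2 0 (Leq.symm m) := fun m => hact (sG * sG) m
  have key := finrank_of_same_ker (groupCohomology.H1π (Rep.of ρ)).hom
    ((th1 ∘ₗ ev1).domRestrict (groupCohomology.cocycles₁ (Rep.of ρ)))
    ((ModuleCat.epi_iff_surjective _).1 inferInstance) ?_ ?_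
  · rw [key]
    simp
  · intro v
    let a : DMod := ![0, v 0, v 1, v 2, 0, 0, v 3, 0, 0]
    let b : DMod := ![0, 0, v 4, 0, -v 0 - v 2, v 6, v 5, v 7, v 8]
    let F : GG → Lam3 := fun g => Leq ((Multiplicative.toAdd g).1 • a +
      ((Multiplicative.toAdd g).1 - (Multiplicative.toAdd g).1 ^ 2) • Yop a +
      (Multiplicative.toAdd g).2 • b +
      ((Multiplicative.toAdd g).1 * (Multiplicative.toAdd g).2) • Yop b)
    have hF : F ∈ groupCohomology.cocycles₁ (Rep.of ρ) := by
      rw [groupCohomology.mem_cocycles₁_iff]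
      intro g h
      apply Leq.symm.injective
      refine Eq.trans ?_ (map_add Leq.symm (ρ g (F h)) (F g)).symm
      rw [hact]
      simp only [F, LinearEquiv.symm_apply_apply]
      exact coc1_D_conv (a := a) (b := b) rfl rfl rfl rfl rfl _ _ _ _
    refine ⟨⟨F, hF⟩, ?_⟩
    show th1 (Leq.symm (F sG), Leq.symm (F tG)) = v
    have e1 : Leq.symm (F sG) = a := by
      simp only [F, LinearEquiv.symm_apply_apply]
      simp [sG]
    have e2 : Leq.symm (F tG) = b := by
      simp only [F, LinearEquiv.symm_apply_apply]
      simp [tG]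
    rw [e1, e2]
    funext n
    fin_cases n <;> simp [th1, a, b]
  · rintro ⟨F, hF⟩
    have hF' : ∀ g h : GG, F (g * h) = ρ g (F h) + F g :=
      (groupCohomology.mem_cocycles₁_iff _).1 hF
    have hone : F 1 = 0 := by
      have := hF' 1 1
      simpa using this
    refine (groupCohomology.H1π_eq_zero_iff (A := Rep.of ρ) ⟨F, hF⟩).trans ?_
    show F ∈ groupCohomology.coboundaries₁ (Rep.of ρ) ↔
      th1 (Leq.symm (F sG), Leq.symm (F tG)) = 0
    constructor
    · rintro ⟨m, hm⟩
      have hm' : ∀ g, F g = ρ g m - m := fun g => (congrFun hm g).symm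
      rw [hm', hm', map_sub, map_sub, hs, ht]
      generalize Leq.symm m = m
      funext n
      fin_cases n <;>
      simp [th1, actD, Yop_coords, Zop_coords]
      ring
    · intro h
      obtain ⟨h0, g0, g1, g3, g4⟩ := coc1_D (a := Leq.symm (F sG)) (b := Leq.symm (F tG)) (by
        rw [← hs, ← hss, ← map_add, ← map_add]
        rw [add_assoc, ← hF', ← hF', sG_cube, hone, map_zero]) (by
        rw [← hs, ← ht, ← map_add, ← map_add, ← hF', ← hF', mul_comm])
      obtain ⟨m, hm1, hm2⟩ := D_rep _ _ h0 g0 g1 g3 g4 h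
      have es : F sG = ρ sG (Leq m) - Leq m := by
        apply Leq.symm.injective
        rw [hm1, map_sub, hs, LinearEquiv.symm_apply_apply]
      have et : F tG = ρ tG (Leq m) - Leq m := by
        apply Leq.symm.injective
        rw [hm2, map_sub, ht, LinearEquiv.symm_apply_apply]
      refine ⟨Leq m, ?_⟩
      funext g
      show ρ g (Leq m) - Leq m = F g
      refine GG_gen (fun g => ρ g (Leq m) - Leq m = F g) ?_ ?_ ?_ g
      · simp [hone]
      · intro x hx
        rw [hF', es, ← hx, map_sub, map_mul, Module.End.mul_apply]
        abel
      · intro x hx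
        rw [hF', et, ← hx, map_sub, map_mul, Module.End.mul_apply]
        abel

lemma ev2_cob (hact : ∀ (g : GG) (m : Lam3), Leq.symm (ρ g m) =
    actD (Multiplicative.toAdd g).1 (Multiplicative.toAdd g).2 (Leq.symm m))
    (f : GG × GG → Lam3) (h : GG → Lam3)
    (hh : ∀ x g, ρ x (h g) - h (x * g) + h x = f (x, g)) :
    ev2 f = (Leq.symm (h sG) + actD 1 0 (Leq.symm (h sG)) + actD 2 0 (Leq.symm (h sG)),
      actD 0 1 (Leq.symm (h sG)) - Leq.symm (h sG) -
        (actD 1 0 (Leq.symm (h tG)) - Leq.symm (h tG)),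
      Leq.symm (h tG) + actD 0 1 (Leq.symm (h tG)) + actD 0 2 (Leq.symm (h tG))) := by
  have hs : ∀ m, Leq.symm (ρ sG m) = actD 1 0 (Leq.symm m) := fun m => hact sG m
  have ht : ∀ m, Leq.symm (ρ tG m) = actD 0 1 (Leq.symm m) := fun m => hact tG m
  have hss : ∀ m, Leq.symm (ρ (sG * sG) m) = actD 2 0 (Leq.symm m) := fun m => hact (sG * sG) m
  have htt : ∀ m, Leq.symm (ρ (tG * tG) m) = actD 0 2 (Leq.symm m) := fun m => hact (tG * tG) m
  rw [← hs, ← hss, ← ht, ← hs, ← ht, ← htt, ← map_sub, ← map_sub, ← map_sub, ← map_add,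
    ← map_add, ← map_add, ← map_add]
  show (_, _, _) = _
  refine Prod.ext ?_ (Prod.ext ?_ ?_)
  · apply congrArg Leq.symm
    rw [← hh, ← hh, ← hh, sG_cube, one_mul, map_one, Module.End.one_apply]
    abel
  · apply congrArg Leq.symm
    rw [← hh, ← hh, mul_comm tG sG]
    abel
  · apply congrArg Leq.symm
    rw [← hh, ← hh, ← hh, tG_cube, one_mul, map_one, Module.End.one_apply]
    abel

lemma dimH2 (hact : ∀ (g : GG) (m : Lam3), Leq.symm (ρ g m) =
    actD (Multiplicative.toAdd g).1 (Multiplicative.toAdd g).2 (Leq.symm m)) :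
    Module.finrank (ZMod 3) (groupCohomology (Rep.of ρ) 2) = 13 := by
  have hs : ∀ m, Leq.symm (ρ sG m) = actD 1 0 (Leq.symm m) := fun m => hact sG m
  have ht : ∀ m, Leq.symm (ρ tG m) = actD 0 1 (Leq.symm m) := fun m => hact tG m
  have hss : ∀ m, Leq.symm (ρ (sG * sG) m) = actD 2 0 (Leq.symm m) := fun m => hact (sG * sG) m
  have htt : ∀ m, Leq.symm (ρ (tG * tG) m) = actD 0 2 (Leq.symm m) := fun m => hact (tG * tG) m
  have key := finrank_of_same_ker (groupCohomology.H2π (Rep.of ρ)).hom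
    ((th2 ∘ₗ ev2).domRestrict (groupCohomology.cocycles₂ (Rep.of ρ)))
    ((ModuleCat.epi_iff_surjective _).1 inferInstance) ?_ ?_
  · rw [key]
    simp
  · intro v
    let a : DMod := ![0, 0, v 0, 0, 0, v 1, v 2, v 3, 0]
    let b : DMod := ![0, v 4, v 5, v 6, 0, 0, v 7, 0, 0]
    let c : DMod := ![0, 0, v 8, 0, 0, v 9, v 10, v 11, v 12]
    let f : GG × GG → Lam3 := fun g => Leq (cocD a b c (Multiplicative.toAdd g.1).1
      (Multiplicative.toAdd g.1).2 (Multiplicative.toAdd g.2).1 (Multiplicative.toAdd g.2).2)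
    have hf : f ∈ groupCohomology.cocycles₂ (Rep.of ρ) := by
      rw [groupCohomology.mem_cocycles₂_iff]
      intro g h j
      apply Leq.symm.injective
      refine (map_add Leq.symm (f (g * h, j)) (f (g, h))).trans
        (Eq.trans ?_ (map_add Leq.symm (ρ g (f (h, j))) (f (g, h * j))).symm)
      rw [hact]
      simp only [f, LinearEquiv.symm_apply_apply]
      exact coc2_D_conv (a := a) (b := b) (c := c) rfl rfl rfl rfl rfl rfl rfl rfl rfl _ _ _ _ _ _
    refine ⟨⟨f, hf⟩, ?_⟩
    show th2 (ev2 f) = v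
    have e : ev2 f = (a, b, c) := by
      have c01 : cr 0 1 = 0 := by decide
      have c10 : cr 1 0 = 0 := by decide
      have c00 : cr 0 0 = 0 := by decide
      have c11 : cr 1 1 = 0 := by decide
      have c20 : cr (1 + 1) 0 = 0 := by decide
      have c21 : cr (1 + 1) 1 = 1 := by decide
      show (_, _, _) = _
      simp only [f, ← map_add, ← map_sub, LinearEquiv.symm_apply_apply]
      refine Prod.ext ?_ (Prod.ext ?_ ?_)
      · simp [cocD, sG, c00, c11, c21, c01]
      · simp [cocD, sG, tG, c00, c10, c01]
      · simp [cocD, tG, c00, c11, c21, c01]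
    rw [e]
    funext n
    fin_cases n <;> simp [th2, a, b, c]
  · rintro ⟨f, hf⟩
    have hf' : ∀ g h j : GG, f (g * h, j) + f (g, h) = ρ g (f (h, j)) + f (g, h * j) :=
      (groupCohomology.mem_cocycles₂_iff _).1 hf
    refine (groupCohomology.H2π_eq_zero_iff (A := Rep.of ρ) ⟨f, hf⟩).trans ?_
    show f ∈ groupCohomology.coboundaries₂ (Rep.of ρ) ↔ th2 (ev2 f) = 0
    constructor
    · rintro ⟨h, hh⟩
      rw [ev2_cob ρ hact f h (fun x g => congrFun hh (x, g))]
      exact th2_cob _ _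
    · intro h
      have k1 := congrArg Leq.symm (coc2_invS ρ f hf' sG sG_cube)
      have T2 : ∀ A B : Lam3, ρ tG A - A = B + ρ sG B + ρ (sG * sG) B →
          actD 0 1 (Leq.symm A) - Leq.symm A =
            Leq.symm B + actD 1 0 (Leq.symm B) + actD 2 0 (Leq.symm B) := by
        intro A B e
        rw [← ht, ← hs, ← hss, ← map_sub, ← map_add, ← map_add, e]
      have T3 : ∀ A B : Lam3, ρ sG A - A = -B + ρ tG (-B) + ρ (tG * tG) (-B) →
          actD 1 0 (Leq.symm A) - Leq.symm A =
            -Leq.symm B + actD 0 1 (-Leq.symm B) + actD 0 2 (-Leq.symm B) := by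
        intro A B e
        rw [← map_neg, ← ht, ← hs, ← htt, ← map_sub, ← map_add, ← map_add, e]
      have k2 := T2 _ _ (coc2_invT ρ f hf' sG tG sG_cube)
      have k3 := coc2_invT ρ f hf' tG sG tG_cube
      rw [← neg_sub (f (tG, sG)) (f (sG, tG))] at k3
      replace k3 := T3 _ _ k3
      rw [hs] at k1
      obtain ⟨⟨a0, a1, a3, a4⟩, b0, c0, c1, c3, c4⟩ := coc2_D k1 k2 k3
      obtain ⟨p, q, hp, hb, hq⟩ := D_rep2 _ _ _ a0 a1 a3 a4 b0 c0 c1 c3 c4 h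
      let h0 : GG → Lam3 := fun g => if g = sG then Leq p else if g = tG then Leq q else 0
      have hs0 : Leq.symm (h0 sG) = p := by simp [h0]
      have ht0 : Leq.symm (h0 tG) = q := by
        have : tG ≠ sG := by decide
        simp [h0, this]
      let f0 : GG × GG → Lam3 := fun x => ρ x.1 (h0 x.2) - h0 (x.1 * x.2) + h0 x.1
      have e0 := ev2_cob ρ hact f0 h0 (fun _ _ => rfl)
      rw [hs0, ht0, ← hp, ← hb, ← hq] at e0
      have e1 : ev2 (f - f0) = 0 := by
        rw [map_sub, e0]
        exact sub_self _
      have hf0 : ∀ g h j : GG, f0 (g * h, j) + f0 (g, h) = ρ g (f0 (h, j)) + f0 (g, h * j) := by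
        intro g h j
        simp only [f0, map_add, map_sub, map_mul, Module.End.mul_apply, mul_assoc]
        abel
      have z1 := congrArg (fun z => Leq z.1) e1
      have z2 := congrArg (fun z => Leq z.2.1) e1
      have z3 := congrArg (fun z => Leq z.2.2) e1
      obtain ⟨h1, hh1⟩ := coc2_cob ρ (f - f0) (by
        intro g h j
        have i1 := hf' g h j
        have i2 := hf0 g h j
        simp only [Pi.sub_apply, map_sub]
        rw [sub_add_sub_comm, i1, i2]
        abel) (by simpa [ev2] using z1) (by simpa [ev2] using z3) (by simpa [ev2] using z2)
      refine ⟨h0 + h1, ?_⟩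
      funext ⟨x, g⟩
      show ρ x (h0 g + h1 g) - (h0 (x * g) + h1 (x * g)) + (h0 x + h1 x) = f (x, g)
      have i1 : ρ x (h1 g) - h1 (x * g) + h1 x = f (x, g) - f0 (x, g) := hh1 x g
      have i2 : f0 (x, g) = ρ x (h0 g) - h0 (x * g) + h0 x := rfl
      rw [i2] at i1
      rw [map_add, ← sub_eq_zero, ← sub_eq_zero.2 i1]
      abel

end final

/-- Let `G = ℤ/3 × ℤ/3` act `𝔽₃`-linearly on `M = Λ₁` by `(a,b)·m = B_σ^a B_τ^b m`.
Then `H¹(G, M)` has dimension `9` and `H²(G, M)` has dimension `13` over `𝔽₃`. -/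
theorem stmt_17
    (ρ : Representation (ZMod 3) (Multiplicative (ZMod 3 × ZMod 3)) Lam3)
    (hρ : ∀ (g : Multiplicative (ZMod 3 × ZMod 3)) (m : Lam3),
      ρ g m = Bsig ^ ((Multiplicative.toAdd g).1.val) *
        Btau ^ ((Multiplicative.toAdd g).2.val) * m) :
    Module.finrank (ZMod 3) (groupCohomology (Rep.of ρ) 1) = 9 ∧
      Module.finrank (ZMod 3) (groupCohomology (Rep.of ρ) 2) = 13 := by
  exact ⟨dimH1 ρ (symm_act ρ hρ), dimH2 ρ (symm_act ρ hρ)⟩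
end
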